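/- Let X be a conjugacy class of involutions in the affine Weyl group G_n of type C̃_n (n ≥ 2). If the commuting involution graph C(G_n,X) is connected, then its diameter is at most n+2. -/

import Mathlib

/-!
Common setup: the affine Weyl group of type C̃ₙ, realized as the semidirect
product of the group Wₙ of signed permutations of {1,…,n} with the translation
lattice ℤⁿ.  An element is a triple `(π, s, v)`, where `π` is the underlying
permutation of the n points, `s i` is the sign attached to the point `i`
(so the signed permutation maps the point `i` to the point `π i` with sign `s i`),
and `v ∈ ℤⁿ` is the translation part.  The multiplication realizes
`(α,v)(τ,u) = (ατ, vᵗ + u)`.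
-/

/-- An element of the affine Weyl group of type C̃ₙ: a signed permutation
`(π, s)` together with a translation vector `v ∈ ℤⁿ`. -/
@[ext]
structure AffineWeylC (n : ℕ) where
  π : Equiv.Perm (Fin n)
  s : Fin n → ℤˣ
  v : Fin n → ℤ

namespace AffineWeylC

variable {n : ℕ}

instance : One (AffineWeylC n) := ⟨⟨1, 1, 0⟩⟩

instance : Mul (AffineWeylC n) :=
  ⟨fun g h => ⟨h.π * g.π, fun j => g.s j * h.s (g.π j),
    fun i => (h.s (h.π⁻¹ i) : ℤ) * g.v (h.π⁻¹ i) + h.v i⟩⟩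

instance : Inv (AffineWeylC n) :=
  ⟨fun g => ⟨g.π⁻¹, fun k => (g.s (g.π⁻¹ k))⁻¹,
    fun i => -(((g.s i)⁻¹ : ℤˣ) : ℤ) * g.v (g.π i)⟩⟩

@[simp] lemma mul_π (g h : AffineWeylC n) : (g * h).π = h.π * g.π := rfl
@[simp] lemma mul_s (g h : AffineWeylC n) (j : Fin n) :
    (g * h).s j = g.s j * h.s (g.π j) := rfl
@[simp] lemma mul_v (g h : AffineWeylC n) (i : Fin n) :
    (g * h).v i = (h.s (h.π⁻¹ i) : ℤ) * g.v (h.π⁻¹ i) + h.v i := rfl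
@[simp] lemma one_π : (1 : AffineWeylC n).π = 1 := rfl
@[simp] lemma one_s (j : Fin n) : (1 : AffineWeylC n).s j = 1 := rfl
@[simp] lemma one_v (i : Fin n) : (1 : AffineWeylC n).v i = 0 := rfl
@[simp] lemma inv_π (g : AffineWeylC n) : g⁻¹.π = g.π⁻¹ := rfl
@[simp] lemma inv_s (g : AffineWeylC n) (k : Fin n) :
    g⁻¹.s k = (g.s (g.π⁻¹ k))⁻¹ := rfl
@[simp] lemma inv_v (g : AffineWeylC n) (i : Fin n) :
    g⁻¹.v i = -(((g.s i)⁻¹ : ℤˣ) : ℤ) * g.v (g.π i) := rfl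

instance : Group (AffineWeylC n) where
  mul_assoc a b c := by
    refine AffineWeylC.ext ?_ (funext fun j => ?_) (funext fun i => ?_)
    · simp [mul_assoc]
    · simp only [mul_s, mul_π, Equiv.Perm.mul_apply]
      rw [mul_assoc]
    · simp only [mul_v, mul_s, mul_π, mul_inv_rev, Equiv.Perm.mul_apply,
        Equiv.Perm.coe_inv, Equiv.apply_symm_apply, Units.val_mul]
      ring
  one_mul a := by
    refine AffineWeylC.ext ?_ (funext fun j => ?_) (funext fun i => ?_) <;>
      simp
  mul_one a := by
    refine AffineWeylC.ext ?_ (funext fun j => ?_) (funext fun i => ?_) <;>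
      simp
  inv_mul_cancel a := by
    refine AffineWeylC.ext ?_ (funext fun j => ?_) (funext fun i => ?_)
    · simp
    · simp
    · simp only [mul_v, inv_v, inv_s, one_v,
        show a.π (a.π⁻¹ i) = i from a.π.apply_symm_apply i]
      have h1 : ((a.s (a.π⁻¹ i) : ℤ)) * (((a.s (a.π⁻¹ i))⁻¹ : ℤˣ) : ℤ) = 1 := by
        rw [← Units.val_mul, mul_inv_cancel, Units.val_one]
      linear_combination (-(a.v i)) * h1

/-- `g` is an involution: a non-identity element squaring to the identity. -/
def Involution (g : AffineWeylC n) : Prop := g ≠ 1 ∧ g * g = 1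

/-- The conjugacy class of `a`. -/
def conjClass (a : AffineWeylC n) : Set (AffineWeylC n) := {b | IsConj a b}

/-- The number of transpositions (2-cycles) of the underlying signed permutation. -/
noncomputable def numTrans (g : AffineWeylC n) : ℕ :=
  {i : Fin n | g.π i ≠ i}.ncard / 2

/-- The number of negative 1-cycles of `g` carrying an even label. -/
noncomputable def numNegEven (g : AffineWeylC n) : ℕ :=
  {i : Fin n | g.π i = i ∧ g.s i = -1 ∧ Even (g.v i)}.ncard

/-- The number of negative 1-cycles of `g` carrying an odd label. -/
noncomputable def numNegOdd (g : AffineWeylC n) : ℕ :=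
  {i : Fin n | g.π i = i ∧ g.s i = -1 ∧ Odd (g.v i)}.ncard

/-- The number of positive 1-cycles (fixed points) of `g`. -/
noncomputable def numPos (g : AffineWeylC n) : ℕ :=
  {i : Fin n | g.π i = i ∧ g.s i = 1}.ncard

/-- The labelled cycle type `(m, k_e, k_o, l)` of an involution. -/
noncomputable def cycleType (g : AffineWeylC n) : ℕ × ℕ × ℕ × ℕ :=
  (numTrans g, numNegEven g, numNegOdd g, numPos g)

/-- `g` has labelled cycle type `(m, k_e, k_o, l)`. -/
def HasType (g : AffineWeylC n) (m ke ko l : ℕ) : Prop :=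
  numTrans g = m ∧ numNegEven g = ke ∧ numNegOdd g = ko ∧ numPos g = l

/-- The canonical class representative
`a_{m,k_e,k_o,l} = (1 2)⁺₀ ⋯ (2m−1 2m)⁺₀ (2m+1)⁻₀ ⋯ (2m+k_e)⁻₀
(2m+k_e+1)⁻₁ ⋯ (n−l)⁻₁ (n−l+1)⁺₀ ⋯ (n)⁺₀`
(here written with 0-based indices): points `0,…,2m-1` are paired off into
label‑0 positive transpositions, points `2m,…,2m+k_e-1` are negative 1-cycles
with label 0, points `2m+k_e,…,2m+k_e+k_o-1` are negative 1-cycles with label 1,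
and the remaining `l` points are positive fixed points with label 0. -/
def IsCanon (a : AffineWeylC n) (m ke ko l : ℕ) : Prop :=
  2*m + ke + ko + l = n ∧
  (∀ i : Fin n, i.val < 2*m → i.val % 2 = 0 → (a.π i).val = i.val + 1) ∧
  (∀ i : Fin n, i.val < 2*m → i.val % 2 = 1 → (a.π i).val = i.val - 1) ∧
  (∀ i : Fin n, 2*m ≤ i.val → a.π i = i) ∧
  (∀ i : Fin n, i.val < 2*m → a.s i = 1 ∧ a.v i = 0) ∧
  (∀ i : Fin n, 2*m ≤ i.val → i.val < 2*m + ke → a.s i = -1 ∧ a.v i = 0) ∧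
  (∀ i : Fin n, 2*m + ke ≤ i.val → i.val < 2*m + ke + ko → a.s i = -1 ∧ a.v i = 1) ∧
  (∀ i : Fin n, 2*m + ke + ko ≤ i.val → a.s i = 1 ∧ a.v i = 0)

/-- The labelled positive transposition `(α β)⁺_λ`. -/
def posTrans (α β : Fin n) (lam : ℤ) : AffineWeylC n :=
  ⟨Equiv.swap α β, 1, fun i => if i = α then lam else if i = β then -lam else 0⟩

/-- The labelled negative transposition `(α β)⁻_λ`. -/
def negTrans (α β : Fin n) (lam : ℤ) : AffineWeylC n :=
  ⟨Equiv.swap α β, fun i => if i = α then -1 else if i = β then -1 else 1,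
    fun i => if i = α then lam else if i = β then lam else 0⟩

/-- The labelled negative 1-cycle `(α)⁻_λ`. -/
def negOne (α : Fin n) (lam : ℤ) : AffineWeylC n :=
  ⟨1, fun i => if i = α then -1 else 1, fun i => if i = α then lam else 0⟩

/-- The finite Weyl group Wₙ of type Cₙ, as the subgroup of the affine Weyl
group consisting of the elements with trivial translation part. -/
def WeylSub (n : ℕ) : Subgroup (AffineWeylC n) where
  carrier := {g | g.v = 0}
  one_mem' := rfl
  mul_mem' := by
    intro g h hg hh
    show (g * h).v = 0
    funext i
    simp only [mul_v]
    rw [show g.v = 0 from hg, show h.v = 0 from hh]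
    simp
  inv_mem' := by
    intro g hg
    show g⁻¹.v = 0
    funext i
    simp only [inv_v]
    rw [show g.v = 0 from hg]
    simp

/-- The projection `G_n → W_n`, `(σ, v) ↦ σ`. -/
def weylPart (n : ℕ) : AffineWeylC n →* WeylSub n where
  toFun g := ⟨⟨g.π, g.s, 0⟩, rfl⟩
  map_one' := by
    apply Subtype.ext
    refine AffineWeylC.ext rfl rfl rfl
  map_mul' g h := by
    apply Subtype.ext
    refine AffineWeylC.ext rfl rfl (funext fun i => ?_)
    simp

end AffineWeylC

/-- The commuting graph on a subset `X` of a group: the vertices are the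
elements of `X`, and distinct vertices are adjacent iff they commute. -/
def commGraph {G : Type*} [Group G] (X : Set G) : SimpleGraph X where
  Adj x y := (x : G) ≠ (y : G) ∧ Commute (x : G) (y : G)
  symm := ⟨fun _ _ h => ⟨fun e => h.1 e.symm, h.2.symm⟩⟩
  loopless := ⟨fun _ h => h.1 rfl⟩

namespace AffineWeylC

/-- The infinite dihedral group of affine maps `z ↦ s * z + c` of `ℤ`. -/
@[ext]
structure Aff where
  s : ℤˣ
  c : ℤ

namespace Aff

instance : One Aff := ⟨⟨1, 0⟩⟩
instance : Mul Aff := ⟨fun a b => ⟨a.s * b.s, a.s * b.c + a.c⟩⟩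
instance : Inv Aff := ⟨fun a => ⟨a.s, -(a.s * a.c)⟩⟩

@[simp] lemma one_s : (1 : Aff).s = 1 := rfl
@[simp] lemma one_c : (1 : Aff).c = 0 := rfl
@[simp] lemma mul_s (a b : Aff) : (a * b).s = a.s * b.s := rfl
@[simp] lemma mul_c (a b : Aff) : (a * b).c = a.s * b.c + a.c := rfl
@[simp] lemma inv_s (a : Aff) : (a⁻¹).s = a.s := rfl
@[simp] lemma inv_c (a : Aff) : (a⁻¹).c = -(a.s * a.c) := rfl

instance : Group Aff :=
  Group.ofLeftAxioms
    (fun a b c => by ext <;> simp [mul_assoc]; ring)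
    (fun a => by ext <;> simp)
    (fun a => by
      have h : (a.s : ℤ) * a.c + -((a.s : ℤ) * a.c) = 0 := by ring
      ext <;> simp)

end Aff

/-- The kinds of points of an involution: moved points, even and odd negative fixed points,
and positive fixed points. -/
inductive Kind
  | moved | even | odd | pos

instance : DecidableEq Kind := fun a b => by
  cases a <;> cases b <;> first | exact isTrue rfl | exact isFalse nofun

namespace Aff

/-- The conjugacy class of an element of order at most two. -/
def kind (a : Aff) : Kind := if a.s = 1 then .pos else if Even a.c then .even else .odd

lemma kind_ne_moved (a : Aff) : a.kind ≠ .moved := by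
  unfold kind; split_ifs <;> simp

lemma eq_one_of_sq {a : Aff} (h : a * a = 1) (hs : a.s = 1) : a = 1 := by
  have := congrArg Aff.c h
  simp [hs] at this
  ext <;> simp [hs]
  omega

lemma sq_of_s {a : Aff} (hs : a.s = -1) : a * a = 1 := by
  ext <;> simp [hs]

lemma eq_one_of_kind {a : Aff} (h : a * a = 1) (hk : a.kind = .pos) : a = 1 := by
  refine eq_one_of_sq h ?_
  by_contra hs
  simp only [kind, hs, if_false] at hk
  split_ifs at hk

@[simp] lemma kind_one : (1 : Aff).kind = .pos := by simp [kind]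

lemma s_of_kind {a : Aff} (hk : a.kind ≠ .pos) : a.s = -1 := by
  rcases Int.units_eq_one_or a.s with h | h
  · exact absurd (by simp [kind, h]) hk
  · exact h

lemma neg_one_ne_one : (-1 : ℤˣ) ≠ 1 := by decide

lemma kind_conj {a b w : Aff} (h : w * a = b * w) : a.kind = b.kind := by
  have h1 := congrArg Aff.s h
  have h2 := congrArg Aff.c h
  simp only [mul_s, mul_c] at h1 h2
  have h3 : a.s = b.s := by
    rw [mul_comm b.s] at h1; exact mul_left_cancel h1
  unfold kind
  rw [h3]
  split_ifs with hs he ho ho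
  all_goals first | rfl | skip
  all_goals
    have hb : b.s = -1 := (Int.units_eq_one_or _).resolve_left hs
    exfalso
    rw [hb] at h2
    rcases Int.units_eq_one_or w.s with hw | hw <;> rw [hw] at h2 <;>
      simp at h2 <;> grind

lemma exists_conj {a b : Aff} (ha : a * a = 1) (hb : b * b = 1) (h : a.kind = b.kind) :
    ∃ w : Aff, w * a = b * w := by
  by_cases hp : a.kind = .pos
  · exact ⟨1, by rw [eq_one_of_kind ha hp, eq_one_of_kind hb (h ▸ hp)]⟩
  have h1 := s_of_kind hp
  have h2 := s_of_kind (h ▸ hp)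
  have h3 : Even a.c ↔ Even b.c := by
    simp only [kind, h1, h2, neg_one_ne_one, if_false] at h
    split_ifs at h <;> tauto
  refine ⟨⟨1, (b.c - a.c) / 2⟩, ?_⟩
  ext
  · simp [h1, h2]
  · simp [h2]; grind

lemma exists_conj_sq (g : Aff) {a b : Aff} (ha : a * a = 1) (hb : b * b = 1)
    (h : a.kind = b.kind) : ∃ w : Aff, w * a = b * w ∧ (g⁻¹ * w) * (g⁻¹ * w) = 1 := by
  by_cases hp : a.kind = .pos
  · exact ⟨g, by rw [eq_one_of_kind ha hp, eq_one_of_kind hb (h ▸ hp)]; simp, by simp⟩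
  obtain ⟨w, hw⟩ := exists_conj ha hb h
  have h1 := s_of_kind hp
  rcases Int.units_eq_one_or (g⁻¹ * w).s with h2 | h2
  · refine ⟨w * a, by rw [← mul_assoc b, ← hw], sq_of_s ?_⟩
    rw [← mul_assoc, mul_s, h2, h1, one_mul]
  · exact ⟨w, hw, sq_of_s h2⟩

/-- Two reflections commute only if they coincide. -/
lemma eq_of_comm {a b : Aff} (ha : a.kind ≠ .pos) (hb : b.kind ≠ .pos) (h : a * b = b * a) :
    a = b := by
  have h1 := s_of_kind ha
  have h2 := s_of_kind hb
  have := congrArg Aff.c h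
  simp [h1, h2] at this
  ext
  · rw [h1, h2]
  · omega

end Aff

end AffineWeylC

namespace AffineWeylC

variable {n : ℕ}

/-- The affine map attached to the point `i` by `g`. -/
def lab (g : AffineWeylC n) (i : Fin n) : Aff := ⟨g.s i, g.v (g.π i)⟩

lemma lab_mul (g h : AffineWeylC n) (i : Fin n) : (g * h).lab i = h.lab (g.π i) * g.lab i := by
  ext
  · simp [lab, mul_comm]
  · simp [lab]

lemma lab_one (i : Fin n) : (1 : AffineWeylC n).lab i = 1 := rfl

lemma ext_lab {g h : AffineWeylC n} (h1 : ∀ i, g.π i = h.π i) (h2 : ∀ i, g.lab i = h.lab i) :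
    g = h := by
  refine AffineWeylC.ext (Equiv.ext h1) (funext fun i => congrArg Aff.s (h2 i))
    (funext fun i => ?_)
  have := congrArg Aff.c (h2 (g.π⁻¹ i))
  simpa [lab, ← h1] using this

/-- The element with underlying permutation `σ` and affine maps `ω`. -/
def ofLab (σ : Equiv.Perm (Fin n)) (ω : Fin n → Aff) : AffineWeylC n :=
  ⟨σ, fun i => (ω i).s, fun i => (ω (σ⁻¹ i)).c⟩

@[simp] lemma ofLab_π (σ : Equiv.Perm (Fin n)) (ω : Fin n → Aff) : (ofLab σ ω).π = σ := rfl

@[simp] lemma ofLab_lab (σ : Equiv.Perm (Fin n)) (ω : Fin n → Aff) (i : Fin n) :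
    (ofLab σ ω).lab i = ω i := by
  ext <;> simp [lab, ofLab]

/-- An element of order at most two, given by its underlying permutation of the points and by
the affine maps carried by the points. -/
structure Cfg (n : ℕ) where
  p : Fin n → Fin n
  d : Fin n → Aff
  pp : ∀ i, p (p i) = i
  dd : ∀ i, d (p i) * d i = 1

namespace Cfg

variable {x y z : Cfg n}

lemma p_inj (x : Cfg n) {i j : Fin n} : x.p i = x.p j ↔ i = j :=
  ⟨fun h => by rw [← x.pp i, h, x.pp], fun h => h ▸ rfl⟩

lemma d_p (x : Cfg n) (i : Fin n) : x.d (x.p i) = (x.d i)⁻¹ := eq_inv_of_mul_eq_one_left (x.dd i)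

lemma sq (x : Cfg n) {i : Fin n} (h : x.p i = i) : x.d i * x.d i = 1 := by
  have := x.dd i; rwa [h] at this

/-- The group element described by a configuration. -/
def toG (x : Cfg n) : AffineWeylC n := ofLab ⟨x.p, x.p, x.pp, x.pp⟩ x.d

@[simp] lemma toG_π (x : Cfg n) (i : Fin n) : x.toG.π i = x.p i := rfl

@[simp] lemma toG_lab (x : Cfg n) (i : Fin n) : x.toG.lab i = x.d i := ofLab_lab _ _ i

lemma toG_sq (x : Cfg n) : x.toG * x.toG = 1 :=
  ext_lab (fun i => x.pp i) fun i => by simp [lab_mul, lab_one, x.dd]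

lemma exists_toG {g : AffineWeylC n} (h : g * g = 1) : ∃ x : Cfg n, x.toG = g := by
  refine ⟨⟨g.π, g.lab, fun i => ?_, fun i => ?_⟩, ext_lab (fun _ => rfl) fun i => by simp⟩
  · have := congrArg AffineWeylC.π h
    simpa using Equiv.ext_iff.1 this i
  · rw [← lab_mul, h, lab_one]

@[ext] lemma ext_cfg (h1 : ∀ i, x.p i = y.p i) (h2 : ∀ i, x.d i = y.d i) : x = y := by
  cases x; cases y
  obtain rfl := funext h1
  obtain rfl := funext h2
  rfl

lemma toG_inj (h : x.toG = y.toG) : x = y := by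
  ext1 i
  · rw [← toG_π, h, toG_π]
  · rw [← toG_lab, h, toG_lab]

/-- Two configurations commute. -/
def Comm (x y : Cfg n) : Prop :=
  ∀ i, x.p (y.p i) = y.p (x.p i) ∧ x.d (y.p i) * y.d i = y.d (x.p i) * x.d i

lemma comm_iff : Comm x y ↔ Commute x.toG y.toG := by
  constructor
  · intro h
    refine ext_lab (fun i => (h i).1.symm) fun i => ?_
    simp [lab_mul, (h i).2]
  · intro h i
    constructor
    · have := congrArg (fun g => g.π i) h.eq
      simpa using this.symm
    · have := congrArg (fun g => g.lab i) h.eq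
      simpa [lab_mul] using this.symm

/-- Two configurations are conjugate. -/
def ConjS (x y : Cfg n) : Prop :=
  ∃ σ : Equiv.Perm (Fin n), ∃ ω : Fin n → Aff,
    ∀ i, y.p (σ i) = σ (x.p i) ∧ y.d (σ i) * ω i = ω (x.p i) * x.d i

lemma conjS_iff : ConjS x y ↔ IsConj x.toG y.toG := by
  rw [isConj_comm, isConj_iff]
  constructor
  · rintro ⟨σ, ω, h⟩
    refine ⟨ofLab σ ω, ?_⟩
    rw [mul_inv_eq_iff_eq_mul]
    refine ext_lab (fun i => (h i).1) fun i => ?_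
    simp [lab_mul, (h i).2]
  · rintro ⟨c, h⟩
    rw [mul_inv_eq_iff_eq_mul] at h
    refine ⟨c.π, c.lab, fun i => ⟨?_, ?_⟩⟩
    · have := congrArg (fun g => g.π i) h
      simpa using this
    · have := congrArg (fun g => g.lab i) h
      simpa [lab_mul] using this

lemma ConjS.refl (x : Cfg n) : ConjS x x := conjS_iff.2 (IsConj.refl _)
lemma ConjS.symm (h : ConjS x y) : ConjS y x := conjS_iff.2 (conjS_iff.1 h).symm
lemma ConjS.trans (h : ConjS x y) (h' : ConjS y z) : ConjS x z :=
  conjS_iff.2 ((conjS_iff.1 h).trans (conjS_iff.1 h'))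

/-- The conjugate of a configuration. -/
def conj (x : Cfg n) (σ : Equiv.Perm (Fin n)) (ω : Fin n → Aff) : Cfg n where
  p i := σ (x.p (σ⁻¹ i))
  d i := ω (x.p (σ⁻¹ i)) * x.d (σ⁻¹ i) * (ω (σ⁻¹ i))⁻¹
  pp i := by simp [x.pp]
  dd i := by simp [x.pp, x.d_p]; group

lemma conjS_conj (x : Cfg n) (σ : Equiv.Perm (Fin n)) (ω : Fin n → Aff) :
    ConjS x (x.conj σ ω) := ⟨σ, ω, fun i => by simp [conj]⟩

/-- The kind of a point. -/
def ty (x : Cfg n) (i : Fin n) : Kind := if x.p i = i then (x.d i).kind else .moved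

lemma ty_eq_moved {i : Fin n} : x.ty i = .moved ↔ x.p i ≠ i := by
  unfold ty; split_ifs with h <;> simp [h, Aff.kind_ne_moved]

lemma ty_of_fixed {i : Fin n} (h : x.p i = i) : x.ty i = (x.d i).kind := by simp [ty, h]

lemma ty_eq_pos {i : Fin n} : x.ty i = .pos ↔ x.p i = i ∧ x.d i = 1 := by
  unfold ty; split_ifs with h
  · refine ⟨fun h' => ⟨h, Aff.eq_one_of_kind (x.sq h) h'⟩, fun h' => by simp [h'.2]⟩
  · simp [h]

lemma ConjS.ty (h : ConjS x y) : ∃ σ : Equiv.Perm (Fin n), ∀ i, y.ty (σ i) = x.ty i := by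
  obtain ⟨σ, ω, h⟩ := h
  refine ⟨σ, fun i => ?_⟩
  unfold Cfg.ty
  have h1 := h i
  by_cases hi : x.p i = i
  · simp only [hi] at h1
    rw [if_pos hi, if_pos h1.1, Aff.kind_conj h1.2.symm]
  · have : y.p (σ i) ≠ σ i := by rw [h1.1]; simpa using hi
    rw [if_neg hi, if_neg this]

/-- One step in the commuting graph of a conjugacy class; trivial steps are allowed. -/
def Step (x y : Cfg n) : Prop := Comm x y ∧ ConjS x y

lemma Comm.symm (h : Comm x y) : Comm y x := comm_iff.2 (comm_iff.1 h).symm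
lemma Step.symm (h : Step x y) : Step y x := ⟨h.1.symm, h.2.symm⟩
lemma Step.refl (x : Cfg n) : Step x x := ⟨fun _ => ⟨rfl, rfl⟩, .refl x⟩

/-- There is a chain of at most `k` steps. -/
inductive Within : ℕ → Cfg n → Cfg n → Prop
  | refl (x : Cfg n) : Within 0 x x
  | tail {k : ℕ} {x y z : Cfg n} : Within k x y → Step y z → Within (k + 1) x z

lemma Step.within (h : Step x y) : Within 1 x y := .tail (.refl x) h

lemma Within.trans {k l : ℕ} (h : Within k x y) (h' : Within l y z) : Within (k + l) x z := by
  induction h' with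
  | refl => exact h
  | tail _ hs ih => exact .tail (ih h) hs

lemma Within.mono {k l : ℕ} (h : Within k x y) (hk : k ≤ l) : Within l x y := by
  induction l, hk using Nat.le_induction with
  | base => exact h
  | succ m _ ih => exact .tail ih (.refl y)

lemma Within.symm {k : ℕ} (h : Within k x y) : Within k y x := by
  induction h with
  | refl x => exact .refl x
  | tail _ hs ih => exact (hs.symm.within.trans ih).mono (by omega)

lemma Within.conjS {k : ℕ} (h : Within k x y) : ConjS x y := by
  induction h with
  | refl x => exact .refl x
  | tail _ hs ih => exact ih.trans hs.2

lemma Within.edist_le {k : ℕ} (h : Within k x y) {X : Set (AffineWeylC n)}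
    (hX : ∀ u v : Cfg n, ConjS u v → u.toG ∈ X → v.toG ∈ X) (hx : x.toG ∈ X) (hy : y.toG ∈ X) :
    (commGraph X).edist ⟨x.toG, hx⟩ ⟨y.toG, hy⟩ ≤ k := by
  induction h with
  | refl x => simp
  | @tail k x u y h hs ih =>
    have hu : u.toG ∈ X := hX _ _ h.conjS hx
    have h1 : (commGraph X).edist ⟨u.toG, hu⟩ ⟨y.toG, hy⟩ ≤ 1 := by
      by_cases he : u.toG = y.toG
      · simp [he]
      · have : (commGraph X).Adj ⟨u.toG, hu⟩ ⟨y.toG, hy⟩ := ⟨he, comm_iff.1 hs.1⟩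
        exact (SimpleGraph.edist_eq_one_iff_adj.2 this).le
    calc _ ≤ _ := SimpleGraph.edist_triangle (v := (⟨u.toG, hu⟩ : X))
      _ ≤ (k : ℕ∞) + 1 := add_le_add (ih hx hu) h1
      _ = _ := by norm_cast

end Cfg

end AffineWeylC

namespace AffineWeylC

variable {n : ℕ}

namespace Cfg

section

variable {x y z : Cfg n}

/-- The point `i` is fixed, with label `a`. -/
def Fx (x : Cfg n) (i : Fin n) (a : Aff) : Prop := x.p i = i ∧ x.d i = a

/-- The points `i` and `j` form a 2-cycle, with label `g` read from `i` to `j`. -/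
def Ed (x : Cfg n) (i j : Fin n) (g : Aff) : Prop := i ≠ j ∧ x.p i = j ∧ x.d i = g

/-- The configurations agree outside `A`. -/
def Off (A : Finset (Fin n)) (x y : Cfg n) : Prop :=
  ∀ i, i ∉ A → y.p i = x.p i ∧ y.d i = x.d i

lemma Ed.symm {i j : Fin n} {g : Aff} (h : x.Ed i j g) : x.Ed j i g⁻¹ :=
  ⟨h.1.symm, by rw [← h.2.1, x.pp], by rw [← h.2.1, x.d_p, h.2.2]⟩

lemma Fx.sq {i : Fin n} {a : Aff} (h : x.Fx i a) : a * a = 1 := by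
  have := x.sq h.1; rwa [h.2] at this

lemma Fx.off {A : Finset (Fin n)} {i : Fin n} {a : Aff} (h : x.Fx i a) (ho : Off A x y)
    (hi : i ∉ A) : y.Fx i a := ⟨(ho i hi).1.trans h.1, (ho i hi).2.trans h.2⟩

lemma Ed.off {A : Finset (Fin n)} {i j : Fin n} {a : Aff} (h : x.Ed i j a) (ho : Off A x y)
    (hi : i ∉ A) : y.Ed i j a := ⟨h.1, (ho i hi).1.trans h.2.1, (ho i hi).2.trans h.2.2⟩

lemma Off.trans {A B : Finset (Fin n)} (h : Off A x y) (h' : Off B y z) : Off (A ∪ B) x z := by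
  intro i hi
  rw [Finset.notMem_union] at hi
  exact ⟨(h' i hi.2).1.trans (h i hi.1).1, (h' i hi.2).2.trans (h i hi.1).2⟩

lemma Off.mono {A B : Finset (Fin n)} (h : Off A x y) (hAB : A ⊆ B) : Off B x y :=
  fun i hi => h i fun hi' => hi (hAB hi')

lemma Off.symm {A : Finset (Fin n)} (h : Off A x y) : Off A y x :=
  fun i hi => ⟨(h i hi).1.symm, (h i hi).2.symm⟩

lemma conj_step {A : Finset (Fin n)} (hA : ∀ i ∈ A, x.p i ∈ A) {σ : Equiv.Perm (Fin n)}
    {ω : Fin n → Aff} (hσ : ∀ i ∉ A, σ i = i) (hω : ∀ i ∉ A, ω i = 1) :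
    Off A x (x.conj σ ω) ∧ ((∀ i ∈ A, x.p ((x.conj σ ω).p i) = (x.conj σ ω).p (x.p i) ∧
      x.d ((x.conj σ ω).p i) * (x.conj σ ω).d i = (x.conj σ ω).d (x.p i) * x.d i) →
      Step x (x.conj σ ω)) := by
  have hp : ∀ i, i ∉ A → x.p i ∉ A := fun i hi h => hi (x.pp i ▸ hA _ h)
  have ho : Off A x (x.conj σ ω) := by
    intro i hi
    have h1 : σ⁻¹ i = i := by rw [Equiv.Perm.inv_eq_iff_eq, hσ i hi]
    constructor
    · simp only [conj, h1]; exact hσ _ (hp i hi)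
    · simp only [conj, h1, hω i hi, hω _ (hp i hi)]; simp
  refine ⟨ho, fun h => ⟨fun i => ?_, conjS_conj _ _ _⟩⟩
  by_cases hi : i ∈ A
  · exact h i hi
  · rw [(ho i hi).1, (ho i hi).2, (ho _ (hp i hi)).1, (ho _ (hp i hi)).2]
    exact ⟨rfl, rfl⟩

/-- A fixed point moves onto a positive fixed point. -/
lemma move_token {i j : Fin n} {a b : Aff} (hi : x.Fx i a) (hj : x.Fx j 1) (hij : i ≠ j)
    (hb : b * b = 1) (hk : b.kind = a.kind) :
    ∃ x' : Cfg n, Step x x' ∧ x'.Fx i 1 ∧ x'.Fx j b ∧ Off {i, j} x x' := by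
  obtain ⟨w, hw⟩ := Aff.exists_conj hi.sq hb hk.symm
  obtain ⟨hip, rfl⟩ := hi
  obtain ⟨hjp, hjd⟩ := hj
  obtain ⟨h1, h2⟩ := conj_step (x := x) (A := {i, j}) (σ := Equiv.swap i j)
    (ω := fun k => if k = i then w else 1) (by simp [hip, hjp])
    (by intro k hk; simp at hk; exact Equiv.swap_apply_of_ne_of_ne hk.1 hk.2)
    (by intro k hk; simp at hk; simp [hk.1])
  set x' := x.conj (Equiv.swap i j) (fun k => if k = i then w else 1) with hx'
  have e1 : x'.p i = i := by simp [hx', conj, hjp]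
  have e2 : x'.p j = j := by simp [hx', conj, hip]
  have e3 : x'.d i = 1 := by simp [hx', conj, hjp, hij.symm, hjd]
  have e4 : x'.d j = b := by simp [hx', conj, hip, hw]
  refine ⟨x', h2 ?_, ⟨e1, e3⟩, ⟨e2, e4⟩, h1⟩
  intro k hk
  simp at hk
  rcases hk with rfl | rfl <;> simp [e1, e2, e3, e4, hip, hjp, hjd]

/-- A 2-cycle and two fixed points of the same kind exchange their positions. -/
lemma move_edge {a b c d : Fin n} {g γ δ w r : Aff} (hab : x.Ed a b g) (hc : x.Fx c γ)
    (hd : x.Fx d δ) (hcd : c ≠ d) (hw : w * γ = δ * w) (hr : r * r = 1) (hk : r.kind = γ.kind) :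
    ∃ x' : Cfg n, Step x x' ∧ x'.Ed c d w ∧ x'.Fx a r ∧ x'.Fx b (g * r * g⁻¹) ∧
      Off {a, b, c, d} x x' := by
  obtain ⟨v, hv⟩ := Aff.exists_conj hc.sq hr hk.symm
  have hba := hab.symm.2
  obtain ⟨hne, hap, rfl⟩ := hab
  obtain ⟨hbp, hbd⟩ := hba
  obtain ⟨hcp, rfl⟩ := hc
  obtain ⟨hdp, rfl⟩ := hd
  have hac : a ≠ c := by rintro rfl; exact hne (hcp.symm.trans hap)
  have had : a ≠ d := by rintro rfl; exact hne (hdp.symm.trans hap)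
  have hbc : b ≠ c := by rintro rfl; exact hne (hbp.symm.trans hcp)
  have hbd' : b ≠ d := by rintro rfl; exact hne (hbp.symm.trans hdp)
  set g := x.d a with hg
  set σ : Equiv.Perm (Fin n) := Equiv.swap a c * Equiv.swap b d with hσ
  set ω : Fin n → Aff := fun k => if k = b then w * g⁻¹ else if k = c then v else
    if k = d then g * v * w⁻¹ else 1 with hω
  have sa : σ a = c := by
    simp [hσ, Equiv.swap_apply_of_ne_of_ne hne had]
  have sb : σ b = d := by
    simp [hσ, Equiv.swap_apply_of_ne_of_ne had.symm hcd.symm]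
  have sc : σ c = a := by
    simp [hσ, Equiv.swap_apply_of_ne_of_ne hbc.symm hcd]
  have sd : σ d = b := by
    simp [hσ, Equiv.swap_apply_of_ne_of_ne hne.symm hbc]
  obtain ⟨h1, h2⟩ := conj_step (x := x) (A := {a, b, c, d}) (σ := σ)
    (ω := ω) (by simp [hap, hbp, hcp, hdp])
    (by intro k hk; simp at hk
        simp [hσ, Equiv.swap_apply_of_ne_of_ne hk.2.1 hk.2.2.2,
          Equiv.swap_apply_of_ne_of_ne hk.1 hk.2.2.1])
    (by intro k hk; simp at hk; simp [hω, hk])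
  have ia : σ⁻¹ a = c := by rw [Equiv.Perm.inv_eq_iff_eq, sc]
  have ib : σ⁻¹ b = d := by rw [Equiv.Perm.inv_eq_iff_eq, sd]
  have ic : σ⁻¹ c = a := by rw [Equiv.Perm.inv_eq_iff_eq, sa]
  have id : σ⁻¹ d = b := by rw [Equiv.Perm.inv_eq_iff_eq, sb]
  have oa : ω a = 1 := by simp [hω, hne, hac, had]
  have ob : ω b = w * g⁻¹ := by simp [hω]
  have oc : ω c = v := by simp [hω, hbc.symm]
  have od : ω d = g * v * w⁻¹ := by simp [hω, hbd'.symm, hcd.symm]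
  have hv' : v * x.d c * v⁻¹ = r := by rw [hv]; group
  have hw' : w⁻¹ * x.d d * w = x.d c := by rw [mul_assoc, ← hw]; group
  have hw'' : x.d d = w * x.d c * w⁻¹ := by rw [hw]; group
  set x' := x.conj σ ω with hx'
  have pa : x'.p a = a := by simp only [hx', conj, ia, hcp, sc]
  have pb : x'.p b = b := by simp only [hx', conj, ib, hdp, sd]
  have pc : x'.p c = d := by simp only [hx', conj, ic, hap, sb]
  have pd : x'.p d = c := by simp only [hx', conj, id, hbp, sa]
  have da : x'.d a = r := by simp only [hx', conj, ia, hcp, oc, hv']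
  have db : x'.d b = g * r * g⁻¹ := by
    simp only [hx', conj, ib, hdp, od]
    rw [hw'', ← hv']; group
  have dc : x'.d c = w := by
    simp only [hx', conj, ic, hap, oa, ob, ← hg]; group
  have dd : x'.d d = w⁻¹ := by rw [← pc, d_p, dc]
  refine ⟨x', h2 ?_, ⟨hcd, pc, dc⟩, ⟨pa, da⟩, ⟨pb, db⟩, h1⟩
  intro k hk
  simp only [Finset.mem_insert, Finset.mem_singleton] at hk
  rcases hk with rfl | rfl | rfl | rfl
  · simp only [pa, pb, da, db, hap, ← hg, true_and]; group
  · simp only [pa, pb, da, db, hbp, hbd, true_and]; group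
  · simp only [pc, dc, hcp, hdp, true_and]; rw [hw]
  · simp only [pd, dd, hcp, hdp, true_and]; rw [hw'']; group

/-- The label of a 2-cycle changes by a factor of order at most two. -/
lemma move_label {a b : Fin n} {g g' : Aff} (hab : x.Ed a b g)
    (h : g⁻¹ * g' * (g⁻¹ * g') = 1) :
    ∃ x' : Cfg n, Step x x' ∧ x'.Ed a b g' ∧ Off {a, b} x x' := by
  have hba := hab.symm.2
  obtain ⟨hne, hap, rfl⟩ := hab
  obtain ⟨hbp, hbd⟩ := hba
  set ω : Fin n → Aff := fun k => if k = b then g' * (x.d a)⁻¹ else 1 with hω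
  obtain ⟨h1, h2⟩ := conj_step (x := x) (A := {a, b}) (σ := 1)
    (ω := ω) (by simp [hap, hbp]) (by simp) (by intro k hk; simp at hk; simp [hω, hk])
  set x' := x.conj 1 ω with hx'
  have pa : x'.p a = b := by simp [hx', conj, hap]
  have pb : x'.p b = a := by simp [hx', conj, hbp]
  have da : x'.d a = g' := by simp [hx', conj, hap, hω, hne]
  have db : x'.d b = g'⁻¹ := by rw [← pa, d_p, da]
  refine ⟨x', h2 ?_, ⟨hne, pa, da⟩, h1⟩
  intro k hk
  simp only [Finset.mem_insert, Finset.mem_singleton] at hk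
  have h3 : (x.d a)⁻¹ * g' = g'⁻¹ * x.d a := by
    have := inv_eq_of_mul_eq_one_left h
    simpa using this.symm
  have h4 : x.d a * g'⁻¹ = g' * (x.d a)⁻¹ := by
    have h5 : (x.d a)⁻¹ = g'⁻¹ * x.d a * g'⁻¹ := by rw [← h3]; group
    rw [h5]; group
  rcases hk with rfl | rfl
  · simp only [pa, pb, da, db, hap, hbp, hbd, true_and]; exact h3
  · simp only [pa, pb, da, db, hap, hbp, hbd, true_and]; exact h4

/-- Two 2-cycles exchange partners. -/
lemma move_cross {i a j b : Fin n} {g k : Aff} (hia : x.Ed i a g) (hjb : x.Ed j b k)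
    (hij : i ≠ j) (hib : i ≠ b) (h : Aff) :
    ∃ x' : Cfg n, Step x x' ∧ x'.Ed i j h ∧ x'.Ed a b (k * h * g⁻¹) ∧
      Off {i, a, j, b} x x' := by
  have hai := hia.symm.2
  have hbj := hjb.symm.2
  obtain ⟨hne, ip, rfl⟩ := hia
  obtain ⟨hne', jp, rfl⟩ := hjb
  obtain ⟨ap, ad⟩ := hai
  obtain ⟨bp, bd⟩ := hbj
  have haj : a ≠ j := by rintro rfl; exact hib (ap.symm.trans jp)
  have hab : a ≠ b := by rintro rfl; exact hij (ap.symm.trans bp)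
  set ω : Fin n → Aff := fun t => if t = a then h * (x.d i)⁻¹ else
    if t = j then x.d i * h⁻¹ else 1 with hω
  obtain ⟨h1, h2⟩ := conj_step (x := x) (A := {i, a, j, b}) (σ := Equiv.swap a j)
    (ω := ω) (by simp [ip, ap, jp, bp])
    (by intro k hk; simp at hk; exact Equiv.swap_apply_of_ne_of_ne hk.2.1 hk.2.2.1)
    (by intro k hk; simp at hk; simp [hω, hk])
  have si := Equiv.swap_apply_of_ne_of_ne hne hij
  have sb := Equiv.swap_apply_of_ne_of_ne hab.symm hne'.symm
  set x' := x.conj (Equiv.swap a j) ω with hx'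
  have pi : x'.p i = j := by simp [hx', conj, si, ip]
  have pa : x'.p a = b := by simp [hx', conj, jp, sb]
  have pj : x'.p j = i := by simp [hx', conj, ap, si]
  have pb : x'.p b = a := by simp [hx', conj, sb, bp]
  have di : x'.d i = h := by simp [hx', conj, si, ip, hω, hne, hij]
  have da : x'.d a = x.d j * h * (x.d i)⁻¹ := by
    simp [hx', conj, jp, hω, haj.symm, hab.symm, hne'.symm, mul_assoc]
  have dj : x'.d j = h⁻¹ := by rw [← pi, d_p, di]
  have db : x'.d b = x.d i * h⁻¹ * (x.d j)⁻¹ := by rw [← pa, d_p, da]; group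
  refine ⟨x', h2 ?_, ⟨hij, pi, di⟩, ⟨hab, pa, da⟩, h1⟩
  intro t ht
  simp only [Finset.mem_insert, Finset.mem_singleton] at ht
  rcases ht with rfl | rfl | rfl | rfl
  · simp only [pi, ip, jp, pa, di, da, true_and]; group
  · simp only [pa, ap, bp, pi, ad, bd, di, da, true_and]; group
  · simp only [pj, jp, ip, pb, dj, db, true_and]; group
  · simp only [pb, bp, ap, pj, dj, db, ad, bd, true_and]; group

/-- Steps supported on disjoint sets can be made simultaneously. -/
lemma Step.parallel {A B : Finset (Fin n)} (h1 : Step x y) (h2 : Step y z) (hA : Off A x y)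
    (hB : Off B y z) (hpA : ∀ i ∈ A, x.p i ∈ A) (hpB : ∀ i ∈ B, x.p i ∈ B)
    (hd : Disjoint A B) : Step x z := by
  have hpA' : ∀ i, i ∉ A → x.p i ∉ A := fun i hi h => hi (x.pp i ▸ hpA _ h)
  have hpB' : ∀ i, i ∉ B → x.p i ∉ B := fun i hi h => hi (x.pp i ▸ hpB _ h)
  refine ⟨fun i => ?_, h1.2.trans h2.2⟩
  have hBA : ∀ i ∈ B, i ∉ A := fun i hi hi' => Finset.disjoint_left.1 hd hi' hi
  by_cases hi : i ∈ B
  · have hi' := hBA i hi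
    have h3 := h2.1 i
    have h4 := hBA _ (hpB i hi)
    have h5 : z.p i ∉ A := by
      intro hz
      have h6 : y.p (z.p i) ∈ A := by
        by_contra hc
        have := hA _ hc
        rw [y.pp] at this
        have h7 := hpA' _ hc
        rw [← this.1] at h7; exact h7 hz
      have h8 : z.p i ∉ B := fun h => hBA _ h hz
      have := hB _ h8
      rw [z.pp] at this
      rw [← this.1] at h6
      exact hi' h6
    rw [(hA i hi').1, (hA i hi').2, (hA _ h5).1, (hA _ h5).2] at h3
    exact h3
  · have h3 := h1.1 i
    have h4 := hpB' i hi
    rw [← (hB i hi).1, ← (hB i hi).2, ← (hB _ h4).1, ← (hB _ h4).2] at h3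
    exact h3

end

end Cfg

end AffineWeylC

namespace AffineWeylC

variable {n : ℕ}

namespace Cfg

variable {x y z : Cfg n} {S : Finset (Fin n)}

lemma Fx.ty {i : Fin n} {a : Aff} (h : x.Fx i a) : x.ty i = a.kind := by
  rw [ty_of_fixed h.1, h.2]

lemma Ed.ty {i j : Fin n} {g : Aff} (h : x.Ed i j g) : x.ty i = .moved :=
  ty_eq_moved.2 fun h' => h.1 (h'.symm.trans h.2.1)

lemma fx_of_ty {i : Fin n} {t : Kind} (h : x.ty i = t) (ht : t ≠ .moved) :
    x.Fx i (x.d i) ∧ (x.d i).kind = t := by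
  have hp : x.p i = i := by
    by_contra hp; exact ht (h.symm.trans (ty_eq_moved.2 hp))
  exact ⟨⟨hp, rfl⟩, (ty_of_fixed hp).symm.trans h⟩

lemma fx_of_pos {i : Fin n} (h : x.ty i = .pos) : x.Fx i 1 := ty_eq_pos.1 h

lemma ed_of_ty {i : Fin n} (h : x.ty i = .moved) : x.Ed i (x.p i) (x.d i) :=
  ⟨(ty_eq_moved.1 h).symm, rfl, rfl⟩

/-- The configurations `x` and `y` are conjugate and differ only on `S`. -/
structure Good (S : Finset (Fin n)) (x y : Cfg n) : Prop where
  left : ∀ i ∈ S, x.p i ∈ S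
  right : ∀ i ∈ S, y.p i ∈ S
  off : Off S x y
  conj : ConjS x y

lemma Good.symm (h : Good S x y) : Good S y x := ⟨h.right, h.left, h.off.symm, h.conj.symm⟩

lemma Good.step {k : ℕ} (h : Good S x y) (hw : Within k x z) (ho : Off S x z) : Good S z y := by
  refine ⟨fun i hi => ?_, h.right, fun i hi => ?_, hw.conjS.symm.trans h.conj⟩
  · by_contra hc
    have h1 := (ho _ hc).1
    rw [z.pp] at h1
    have h2 := h.off _ hc
    have h3 := h.left _ (h1 ▸ hi)
    rw [x.pp] at h3
    exact hc h3
  · rw [(ho i hi).1, (ho i hi).2]; exact h.off i hi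

lemma Good.sdiff {A : Finset (Fin n)} (h : Good S x y)
    (hA : ∀ i ∈ A, y.p i = x.p i ∧ y.d i = x.d i ∧ x.p i ∈ A) : Good (S \ A) x y := by
  have hp : ∀ i, i ∉ A → x.p i ∉ A := fun i hi h' => hi (x.pp i ▸ (hA _ h').2.2)
  have hp' : ∀ i, i ∉ A → y.p i ∉ A := fun i hi h' => by
    have := hA _ h'
    rw [← this.1, y.pp] at this
    exact hi this.2.2
  refine ⟨fun i hi => ?_, fun i hi => ?_, fun i hi => ?_, h.conj⟩
  · rw [Finset.mem_sdiff] at hi ⊢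
    exact ⟨h.left i hi.1, hp i hi.2⟩
  · rw [Finset.mem_sdiff] at hi ⊢
    exact ⟨h.right i hi.1, hp' i hi.2⟩
  · by_cases hi' : i ∈ A
    · exact ⟨(hA i hi').1, (hA i hi').2.1⟩
    · exact h.off i fun hS => hi (Finset.mem_sdiff.2 ⟨hS, hi'⟩)

lemma Good.erase {i : Fin n} {a : Aff} (h : Good S x y) (hx : x.Fx i a) (hy : y.Fx i a) :
    Good (S.erase i) x y := by
  rw [Finset.erase_eq]
  refine h.sdiff fun k hk => ?_
  rw [Finset.mem_singleton] at hk
  subst hk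
  simp [hx.1, hx.2, hy.1, hy.2]

lemma Good.erase_ed {i j : Fin n} {g : Aff} (h : Good S x y) (hx : x.Ed i j g)
    (hy : y.Ed i j g) : Good ((S.erase i).erase j) x y := by
  have : (S.erase i).erase j = S \ {i, j} := by ext k; simp; tauto
  rw [this]
  refine h.sdiff fun k hk => ?_
  have hx' := hx.symm
  have hy' := hy.symm
  simp only [Finset.mem_insert, Finset.mem_singleton] at hk
  rcases hk with rfl | rfl
  · simp [hx.2.1, hx.2.2, hy.2.1, hy.2.2]
  · simp [hx'.2.1, hx'.2.2, hy'.2.1, hy'.2.2]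

/-- The number of points of a given kind in `S`. -/
def cnt (S : Finset (Fin n)) (x : Cfg n) (t : Kind) : ℕ := (S.filter fun i => x.ty i = t).card

lemma cnt_erase {i : Fin n} (hi : i ∈ S) (t : Kind) :
    cnt S x t = cnt (S.erase i) x t + if x.ty i = t then 1 else 0 := by
  unfold cnt
  rw [Finset.filter_erase]
  split_ifs with h
  · rw [Finset.card_erase_of_mem (by simp [hi, h]), Nat.sub_add_cancel]
    exact Finset.card_pos.2 ⟨i, by simp [hi, h]⟩
  · rw [Finset.erase_eq_of_notMem (by simp [h])]; rfl

lemma exists_of_cnt {B : Finset (Fin n)} {t : Kind} (h : B.card < cnt S x t) :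
    ∃ b ∈ S, x.ty b = t ∧ b ∉ B := by
  obtain ⟨b, hb, hb'⟩ := Finset.exists_mem_notMem_of_card_lt_card h
  rw [Finset.mem_filter] at hb
  exact ⟨b, hb.1, hb.2, hb'⟩

lemma card_le_cnt {B : Finset (Fin n)} {t : Kind} (h : ∀ i ∈ B, i ∈ S ∧ x.ty i = t) :
    B.card ≤ cnt S x t := Finset.card_le_card fun i hi => by simpa using h i hi

lemma Good.cnt_eq (h : Good S x y) (t : Kind) : cnt S x t = cnt S y t := by
  have h1 : (Finset.univ.filter fun i => x.ty i = t).card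
      = (Finset.univ.filter fun i => y.ty i = t).card := by
    obtain ⟨σ, hσ⟩ := h.conj.ty
    refine Finset.card_bij (fun i _ => σ i) (by simp [hσ]) (by simp) fun b hb => ⟨σ⁻¹ b, ?_⟩
    have := hσ (σ⁻¹ b)
    simp at this
    simpa [← this] using hb
  have h2 : (Sᶜ.filter fun i => x.ty i = t) = (Sᶜ.filter fun i => y.ty i = t) := by
    refine Finset.filter_congr fun i hi => ?_
    have := h.off i (Finset.mem_compl.1 hi)
    simp only [Cfg.ty, this.1, this.2]
  have h3 : ∀ u : Cfg n, (Finset.univ.filter fun i => u.ty i = t).card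
      = cnt S u t + (Sᶜ.filter fun i => u.ty i = t).card := by
    intro u
    unfold cnt
    rw [← Finset.card_union_of_disjoint, ← Finset.filter_union, Finset.union_compl]
    exact Finset.disjoint_filter_filter disjoint_compl_right
  rw [h3, h3, h2] at h1
  omega

lemma card_eq_cnt (S : Finset (Fin n)) (x : Cfg n) :
    S.card = cnt S x .moved + cnt S x .even + cnt S x .odd + cnt S x .pos := by
  unfold cnt
  rw [Finset.card_eq_sum_card_fiberwise (f := x.ty)
    (t := {.moved, .even, .odd, .pos}) (fun i _ => by cases x.ty i <;> simp)]
  rw [Finset.sum_insert (by simp), Finset.sum_insert (by simp), Finset.sum_insert (by simp),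
    Finset.sum_singleton]
  ring

lemma one_le_cnt {i : Fin n} {t : Kind} (hi : i ∈ S) (h : x.ty i = t) : 1 ≤ cnt S x t := by
  have := card_le_cnt (S := S) (x := x) (B := {i}) (t := t) (by simp [hi, h])
  simpa using this

lemma two_le_cnt {i j : Fin n} {t : Kind} (hi : i ∈ S) (hj : j ∈ S) (hij : i ≠ j)
    (h : x.ty i = t) (h' : x.ty j = t) : 2 ≤ cnt S x t := by
  have := card_le_cnt (S := S) (x := x) (B := {i, j}) (t := t) (by simp [hi, hj, h, h'])
  rwa [Finset.card_pair hij] at this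

lemma three_le_cnt {i j k : Fin n} {t : Kind} (hi : i ∈ S) (hj : j ∈ S) (hk : k ∈ S)
    (hij : i ≠ j) (hik : i ≠ k) (hjk : j ≠ k)
    (h : x.ty i = t) (h' : x.ty j = t) (h'' : x.ty k = t) : 3 ≤ cnt S x t := by
  have := card_le_cnt (S := S) (x := x) (B := {i, j, k}) (t := t)
    (by simp [hi, hj, hk, h, h', h''])
  rwa [Finset.card_eq_three.2 ⟨i, j, k, hij, hik, hjk, rfl⟩] at this

lemma exists_one {t : Kind} (h : 1 ≤ cnt S x t) : ∃ b ∈ S, x.ty b = t := by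
  obtain ⟨b, hb, h1, -⟩ := exists_of_cnt (B := ∅) (S := S) (x := x) (t := t) (by rw [Finset.card_empty]; omega)
  exact ⟨b, hb, h1⟩

lemma exists_ne {t : Kind} (h : 2 ≤ cnt S x t) (i : Fin n) :
    ∃ b ∈ S, x.ty b = t ∧ b ≠ i := by
  obtain ⟨b, hb, h1, h2⟩ := exists_of_cnt (B := {i}) (S := S) (x := x) (t := t)
    (by rw [Finset.card_singleton]; omega)
  exact ⟨b, hb, h1, by simpa using h2⟩

lemma exists_ne_ne {t : Kind} (h : 3 ≤ cnt S x t) (i j : Fin n) :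
    ∃ b ∈ S, x.ty b = t ∧ b ≠ i ∧ b ≠ j := by
  obtain ⟨b, hb, h1, h2⟩ := exists_of_cnt (B := {i, j}) (S := S) (x := x) (t := t)
    (lt_of_le_of_lt Finset.card_le_two h)
  exact ⟨b, hb, h1, by simpa using h2⟩

end Cfg

end AffineWeylC

namespace AffineWeylC

variable {n : ℕ}

/-- The two kinds of negative fixed points, in some order. -/
def Kind.Pair (s t : Kind) : Prop := (s = .even ∧ t = .odd) ∨ (s = .odd ∧ t = .even)

namespace Kind.Pair

variable {s t : Kind}

lemma symm (h : Pair s t) : Pair t s := by unfold Pair at *; tauto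
lemma ne (h : Pair s t) : s ≠ t := by rcases h with ⟨rfl, rfl⟩ | ⟨rfl, rfl⟩ <;> simp
lemma ne_moved (h : Pair s t) : s ≠ .moved := by rcases h with ⟨rfl, rfl⟩ | ⟨rfl, rfl⟩ <;> simp
lemma ne_pos (h : Pair s t) : s ≠ .pos := by rcases h with ⟨rfl, rfl⟩ | ⟨rfl, rfl⟩ <;> simp

lemma cases (h : Pair s t) (u : Kind) : u = .moved ∨ u = s ∨ u = t ∨ u = .pos := by
  rcases h with ⟨rfl, rfl⟩ | ⟨rfl, rfl⟩ <;> cases u <;> simp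

end Kind.Pair

namespace Cfg

variable {x y z : Cfg n} {S : Finset (Fin n)}

lemma cnt_erase_self {i : Fin n} (hi : i ∈ S) {t : Kind} (h : x.ty i = t) :
    cnt S x t = cnt (S.erase i) x t + 1 := by rw [cnt_erase hi, if_pos h]

lemma cnt_erase_ne {i : Fin n} (hi : i ∈ S) {t : Kind} (h : x.ty i ≠ t) :
    cnt S x t = cnt (S.erase i) x t := by rw [cnt_erase hi, if_neg h, add_zero]

lemma Good.eq_of_pos (h : Good S x y) (hm : ∀ i ∈ S, y.ty i = .pos) : y = x := by
  have hx : ∀ i ∈ S, x.ty i = .pos := by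
    have h1 : S.card = cnt S y .pos := by
      unfold cnt; rw [Finset.filter_true_of_mem hm]
    rw [← h.cnt_eq] at h1
    exact fun i hi => Finset.card_filter_eq_iff.1 h1.symm i hi
  ext1 i <;> by_cases hi : i ∈ S
  · rw [(fx_of_pos (hm i hi)).1, (fx_of_pos (hx i hi)).1]
  · exact (h.off i hi).1
  · rw [(fx_of_pos (hm i hi)).2, (fx_of_pos (hx i hi)).2]
  · exact (h.off i hi).2

lemma not_moved_of_cnt {i : Fin n} (h : cnt S x .moved = 0) (hi : i ∈ S) : x.ty i ≠ .moved :=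
  fun h' => by have := one_le_cnt hi h'; omega

lemma fixed_aux {s s' : Kind} (hp : s.Pair s') (N : ℕ) :
    ∀ (S : Finset (Fin n)) (x : Cfg n), S.card = N → Good S x y → cnt S y .moved = 0 →
      1 ≤ cnt S y .pos →
      (∀ t t', t.Pair t' → (∃ p ∈ S, x.ty p = t ∧ y.ty p = .pos) →
        Within (cnt S y t + cnt S y t' + min 1 (cnt S y t')) x y) ∧
      Within (cnt S y s + cnt S y s' + min 1 (cnt S y s) + min 1 (cnt S y s')) x y := by
  induction N using Nat.strong_induction_on with
  | _ N IH =>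
  have hres : ∀ (S : Finset (Fin n)) (x : Cfg n), S.card = N → Good S x y →
      cnt S y .moved = 0 → 1 ≤ cnt S y .pos →
      ∀ t t', t.Pair t' → (∃ p ∈ S, x.ty p = t ∧ y.ty p = .pos) →
      Within (cnt S y t + cnt S y t' + min 1 (cnt S y t')) x y := by
    intro S x hN hG hm hl
    have hmx : cnt S x .moved = 0 := by rw [hG.cnt_eq, hm]
    rintro t t' ht ⟨p, hpS, hpt, hpp⟩
    obtain ⟨i, hiS, hix, hiy⟩ : ∃ i ∈ S, x.ty i = .pos ∧ y.ty i ≠ .pos := by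
      by_contra! hc
      have h1 := cnt_erase_self hpS hpp
      have h2 := cnt_erase_ne (x := x) hpS (t := .pos) (by rw [hpt]; exact ht.ne_pos)
      have h3 : cnt (S.erase p) x .pos ≤ cnt (S.erase p) y .pos :=
        card_le_cnt fun k hk => by
          simp only [Finset.mem_filter] at hk
          exact ⟨hk.1, hc k (Finset.mem_of_mem_erase hk.1) hk.2⟩
      have := hG.cnt_eq .pos
      omega
    have him := not_moved_of_cnt hm hiS
    obtain ⟨hyi, -⟩ := fx_of_ty (x := y) rfl him
    have hxi := fx_of_pos hix
    have key : ∀ b ∈ S, x.ty b = y.ty i → ∃ x', Step x x' ∧ Off {b, i} x x' ∧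
        Good (S.erase i) x' y ∧ x'.Fx b 1 := by
      intro b hb hbt
      obtain ⟨hxb, hbk⟩ := fx_of_ty hbt him
      have hbi : b ≠ i := by rintro rfl; exact hiy (hbt ▸ hix)
      obtain ⟨x', h1, h2, h3, h4⟩ := move_token hxb hxi hbi hyi.sq
        (by rw [hbk, hyi.ty])
      refine ⟨x', h1, h4, ?_, h2⟩
      refine (hG.step h1.within (h4.mono ?_)).erase h3 hyi
      simp [Finset.insert_subset_iff, hb, hiS]
    have hc := Finset.card_erase_lt_of_mem hiS
    have hm' : cnt (S.erase i) y .moved = 0 := by rw [← cnt_erase_ne hiS him, hm]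
    have hl' : 1 ≤ cnt (S.erase i) y .pos := by rw [← cnt_erase_ne hiS hiy]; exact hl
    have e1 := cnt_erase (x := y) hiS t
    have e2 := cnt_erase (x := y) hiS t'
    have e3 := cnt_erase (x := y) hiS s
    have e4 := cnt_erase (x := y) hiS s'
    have hit : y.ty i = t ∨ y.ty i = t' := by
      have := ht.cases (y.ty i); tauto
    have hpi : p ≠ i := by rintro rfl; exact hiy hpp
    by_cases hb : ∃ b ∈ S, x.ty b = y.ty i ∧ b ≠ p
    · obtain ⟨b, hbS, hbt, hbp⟩ := hb
      obtain ⟨x', h1, h2, h3, -⟩ := key b hbS hbt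
      have h4 : x'.ty p = t := by
        have := h2 p (by simp [hbp.symm, hpi])
        rw [← hpt]; simp only [Cfg.ty, this.1, this.2]
      refine (h1.within.trans ((IH _ (hN ▸ hc) _ x' rfl h3 hm' hl').1 t t' ht
        ⟨p, Finset.mem_erase.2 ⟨hpi, hpS⟩, h4, hpp⟩)).mono ?_
      have := ht.ne
      rcases hit with hit | hit <;> simp [hit, this, this.symm] at e1 e2 <;> omega
    · push Not at hb
      have h5 : 1 ≤ cnt S x (y.ty i) := by rw [hG.cnt_eq]; exact one_le_cnt hiS rfl
      obtain ⟨b, hbS, hbt⟩ := exists_one h5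
      obtain rfl := hb b hbS hbt
      have hit' : y.ty i = t := by rw [← hbt, hpt]
      obtain ⟨x', h1, h2, h3, -⟩ := key b hbS hbt
      refine (h1.within.trans (IH _ (hN ▸ hc) _ x' rfl h3 hm' hl').2).mono ?_
      have h6 : cnt S y t = 1 := by
        rw [← hG.cnt_eq]
        have h7 := cnt_erase_self hbS hpt
        have h8 : cnt (S.erase b) x t = 0 := by
          by_contra hne
          obtain ⟨c, hc, hct⟩ := exists_one (Nat.one_le_iff_ne_zero.2 hne)
          rw [Finset.mem_erase] at hc
          exact hc.1 (hb c hc.2 (hct.trans hit'.symm))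
        omega
      have := ht.ne
      simp [hit', this] at e1 e2
      have h9 : (t = s ∧ t' = s') ∨ (t = s' ∧ t' = s) := by
        unfold Kind.Pair at ht hp; grind
      rcases h9 with ⟨rfl, rfl⟩ | ⟨rfl, rfl⟩ <;> omega
  intro S x hN hG hm hl
  have hmx : cnt S x .moved = 0 := by rw [hG.cnt_eq, hm]
  refine ⟨hres S x hN hG hm hl, ?_⟩
  by_cases hall : ∀ i ∈ S, y.ty i = .pos
  · rw [hG.eq_of_pos hall]; exact (Within.refl x).mono (by omega)
  by_cases hP : ∃ p ∈ S, x.ty p ≠ .pos ∧ y.ty p = .pos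
  · obtain ⟨p, hpS, hpx, hpy⟩ := hP
    have := not_moved_of_cnt hmx hpS
    rcases hp.cases (x.ty p) with h | h | h | h
    · exact absurd h this
    · exact (hres S x hN hG hm hl s s' hp ⟨p, hpS, h, hpy⟩).mono (by omega)
    · exact (hres S x hN hG hm hl s' s hp.symm ⟨p, hpS, h, hpy⟩).mono (by omega)
    · exact absurd h hpx
  push Not at hP
  obtain ⟨p, hpS, hpy⟩ := exists_one hl
  have hpx : x.ty p = .pos := by
    by_contra hc; exact hP p hpS hc hpy
  push Not at hall
  obtain ⟨i, hiS, hiy⟩ := hall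
  obtain ⟨b, hbS, hbt⟩ := exists_one (S := S) (x := x) (t := y.ty i)
    (by rw [hG.cnt_eq]; exact one_le_cnt hiS rfl)
  have him := not_moved_of_cnt hm hiS
  obtain ⟨hxb, hbk⟩ := fx_of_ty hbt him
  have hbp : b ≠ p := by rintro rfl; exact hiy (hbt ▸ hpx)
  obtain ⟨x', h1, h2, h3, h4⟩ := move_token hxb (fx_of_pos hpx) hbp hxb.sq rfl
  have hG' : Good S x' y := hG.step h1.within (h4.mono
    (by simp [Finset.insert_subset_iff, hbS, hpS]))
  have h5 : x'.ty p = y.ty i := by rw [h3.ty, ← hbk]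
  have h6 := one_le_cnt hiS (x := y) rfl
  have h7 : ∀ t t', t.Pair t' → y.ty i = t →
      Within (1 + (cnt S y t + cnt S y t' + min 1 (cnt S y t'))) x y := fun t t' ht hi =>
    h1.within.trans (hres S x' hN hG' hm hl t t' ht ⟨p, hpS, h5.trans hi, hpy⟩)
  rcases hp.cases (y.ty i) with h | h | h | h
  · exact absurd h him
  · exact (h7 s s' hp h).mono (by rw [h] at h6; omega)
  · exact (h7 s' s hp.symm h).mono (by rw [h] at h6; omega)
  · exact absurd h hiy

/-- Without 2-cycles, when some positive point has to become negative. -/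
lemma within_of_fixed_of_ne {t t' : Kind} (ht : t.Pair t') (hG : Good S x y)
    (hm : cnt S y .moved = 0) (hl : 1 ≤ cnt S y .pos) {p : Fin n} (hp : p ∈ S)
    (hpx : x.ty p = t) (hpy : y.ty p = .pos) :
    Within (cnt S y t + cnt S y t' + min 1 (cnt S y t')) x y :=
  (fixed_aux ht _ S x rfl hG hm hl).1 t t' ht ⟨p, hp, hpx, hpy⟩

lemma within_of_fixed {t t' : Kind} (ht : t.Pair t') (hG : Good S x y)
    (hm : cnt S y .moved = 0) (hl : 1 ≤ cnt S y .pos) :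
    Within (cnt S y t + cnt S y t' + min 1 (cnt S y t) + min 1 (cnt S y t')) x y :=
  (fixed_aux ht _ S x rfl hG hm hl).2

end Cfg

end AffineWeylC

namespace AffineWeylC

variable {n : ℕ}

namespace Aff

lemma exists_between (g h : Aff) :
    ∃ g' : Aff, g⁻¹ * g' * (g⁻¹ * g') = 1 ∧ g'⁻¹ * h * (g'⁻¹ * h) = 1 := by
  rcases Int.units_eq_one_or (g⁻¹ * h).s with h1 | h1
  · refine ⟨g * ⟨-1, 0⟩, by rw [inv_mul_cancel_left]; exact sq_of_s rfl, sq_of_s ?_⟩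
    have : g.s * h.s = 1 := by simpa using h1
    simp [this]
  · exact ⟨h, sq_of_s h1, by simp⟩

lemma sq_conj {a : Aff} (g : Aff) (h : a * a = 1) : g * a * g⁻¹ * (g * a * g⁻¹) = 1 := by
  calc _ = g * (a * a) * g⁻¹ := by group
    _ = 1 := by rw [h]; group

@[simp] lemma kind_conj' (g a : Aff) : (g * a * g⁻¹).kind = a.kind :=
  (kind_conj (w := g) (by group)).symm

lemma sq_inv_mul {g h : Aff} (hs : g⁻¹ * h * (g⁻¹ * h) = 1) : h⁻¹ * g * (h⁻¹ * g) = 1 := by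
  have := congrArg (·⁻¹) hs
  simpa [mul_assoc] using this

end Aff

namespace Cfg

variable {x y z : Cfg n} {S : Finset (Fin n)}

lemma Off.trans' (h : Off S x y) (h' : Off S y z) : Off S x z := by
  simpa using h.trans h'

lemma Off.refl (S : Finset (Fin n)) (x : Cfg n) : Off S x x := fun _ _ => ⟨rfl, rfl⟩

lemma edge_moved (hS : ∀ i ∈ S, x.p i ∈ S) {i j : Fin n} (hij : i ≠ j) (hi : i ∈ S) (hj : j ∈ S)
    (hxi : x.ty i = .moved) (hxj : x.ty j = .moved) (h : Aff) :
    ∃ x', Within 2 x x' ∧ x'.Ed i j h ∧ Off S x x' := by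
  have ei := ed_of_ty hxi
  have ej := ed_of_ty hxj
  by_cases hp : x.p i = j
  · rw [hp] at ei
    obtain ⟨g', h1, h2⟩ := Aff.exists_between (x.d i) h
    obtain ⟨u, a1, a2, a3⟩ := move_label ei h1
    obtain ⟨v, b1, b2, b3⟩ := move_label a2 h2
    exact ⟨v, a1.within.trans b1.within, b2,
      (a3.trans' b3).mono (by simp [Finset.insert_subset_iff, hi, hj])⟩
  · have : i ≠ x.p j := by rintro rfl; exact hp (x.pp j)
    obtain ⟨u, a1, a2, -, a3⟩ := move_cross ei ej hij this h
    exact ⟨u, a1.within.mono (by omega), a2,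
      a3.mono (by simp [Finset.insert_subset_iff, hi, hj, hS])⟩

lemma edge_same (hS : ∀ i ∈ S, x.p i ∈ S) {i j c : Fin n} (hij : i ≠ j) (hi : i ∈ S)
    (hj : j ∈ S) (hc : c ∈ S) {γ δ : Aff} (hxi : x.Fx i γ) (hxj : x.Fx j δ)
    (hk : γ.kind = δ.kind) (hxc : x.ty c = .moved) (h : Aff) :
    ∃ x', Within 2 x x' ∧ x'.Ed i j h ∧ Off S x x' := by
  obtain ⟨w, hw, hw'⟩ := Aff.exists_conj_sq h hxi.sq hxj.sq hk
  obtain ⟨u, a1, a2, -, -, a3⟩ := move_edge (ed_of_ty hxc) hxi hxj hij hw hxi.sq rfl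
  obtain ⟨v, b1, b2, b3⟩ := move_label a2 (Aff.sq_inv_mul hw')
  exact ⟨v, a1.within.trans b1.within, b2,
    (a3.mono (by simp [Finset.insert_subset_iff, hi, hj, hc, hS])).trans'
      (b3.mono (by simp [Finset.insert_subset_iff, hi, hj]))⟩

lemma edge_mixed (hS : ∀ i ∈ S, x.p i ∈ S) {i j q c : Fin n} (hi : i ∈ S)
    (hj : j ∈ S) (hq : q ∈ S) (hc : c ∈ S) {γ δ : Aff} (hxi : x.ty i = .moved) (hxj : x.Fx j γ)
    (hxq : x.Fx q δ) (hjq : j ≠ q) (hk : γ.kind = δ.kind) (hxc : x.ty c = .moved) (hci : c ≠ i)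
    (hcp : c ≠ x.p i) (h : Aff) :
    ∃ x', Within 2 x x' ∧ x'.Ed i j h ∧ Off S x x' := by
  obtain ⟨w, hw⟩ := Aff.exists_conj hxj.sq hxq.sq hk
  have ei := ed_of_ty hxi
  have ec := ed_of_ty hxc
  have hpc : i ≠ x.p c := by rintro rfl; exact hcp (x.pp c).symm
  have ei' := ei.symm
  have ec' := ec.symm
  obtain ⟨u, a1, a2, -, -, a3⟩ := move_edge ec hxj hxq hjq hw hxj.sq rfl
  have e1 := ei.off a3 (by simp only [Finset.mem_insert, Finset.mem_singleton]; grind [Fx, Ed])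
  obtain ⟨v, b1, b2, -, b3⟩ := move_cross e1 a2 (by grind [Fx, Ed]) (by grind [Fx, Ed]) h
  exact ⟨v, a1.within.trans b1.within, b2,
    (a3.mono (by simp [Finset.insert_subset_iff, hj, hq, hc, hS])).trans'
      (b3.mono (by simp [Finset.insert_subset_iff, hi, hj, hq, hS]))⟩

lemma edge_pos (hS : ∀ i ∈ S, x.p i ∈ S) {i j b c : Fin n} (hi : i ∈ S)
    (hj : j ∈ S) (hb : b ∈ S) (hc : c ∈ S) {γ δ : Aff} (hxi : x.Fx i γ) (hxj : x.Fx j 1)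
    (hxb : x.Fx b δ) (hbi : b ≠ i) (hij : i ≠ j) (hbj : b ≠ j) (hk : γ.kind = δ.kind)
    (hxc : x.ty c = .moved) (h : Aff) :
    ∃ x', Within 2 x x' ∧ x'.Ed i j h ∧ Off S x x' := by
  have ec := ed_of_ty hxc
  have ec' := ec.symm
  obtain ⟨u, a1, -, a2, a3⟩ := move_token hxb hxj hbj (b := h * γ * h⁻¹)
    (Aff.sq_conj h hxi.sq) (by simp [hk])
  have e1 := hxi.off a3 (by simp [hbi.symm, hij])
  have e2 := ec.off a3 (by simp only [Finset.mem_insert, Finset.mem_singleton]; grind [Fx, Ed])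
  obtain ⟨v, b1, b2, -, -, b3⟩ := move_edge e2 e1 a2 hij (w := h) (by group) e1.sq rfl
  exact ⟨v, a1.within.trans b1.within, b2,
    (a3.mono (by simp [Finset.insert_subset_iff, hj, hb])).trans'
      (b3.mono (by simp [Finset.insert_subset_iff, hi, hj, hc, hS]))⟩

lemma edge_diff (hS : ∀ i ∈ S, x.p i ∈ S) {i j b b' c c' : Fin n} (hi : i ∈ S)
    (hj : j ∈ S) (hb : b ∈ S) (hb' : b' ∈ S) (hc : c ∈ S) (hc' : c' ∈ S) {γ δ γ' δ' : Aff}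
    (hxi : x.Fx i γ) (hxb : x.Fx b γ') (hk : γ.kind = γ'.kind)
    (hxj : x.Fx j δ) (hxb' : x.Fx b' δ') (hk' : δ.kind = δ'.kind) (hne : γ.kind ≠ δ.kind)
    (hib : i ≠ b) (hjb : j ≠ b') (hxc : x.ty c = .moved) (hxc' : x.ty c' = .moved)
    (hcc : c' ≠ c) (hcp : c' ≠ x.p c) (h : Aff) :
    ∃ x', Within 2 x x' ∧ x'.Ed i j h ∧ Off S x x' := by
  obtain ⟨w, hw⟩ := Aff.exists_conj hxi.sq hxb.sq hk
  obtain ⟨w', hw'⟩ := Aff.exists_conj hxj.sq hxb'.sq hk'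
  have ec := ed_of_ty hxc
  have ec' := ed_of_ty hxc'
  have fc := ec.symm
  have fc' := ec'.symm
  have hpc : c ≠ x.p c' := by rintro rfl; exact hcp (x.pp c').symm
  have hpp : x.p c ≠ x.p c' := by rw [Ne, x.p_inj]; exact hcc.symm
  have hij : i ≠ j := by rintro rfl; exact hne (by rw [← hxi.2, ← hxj.2])
  have hij' : i ≠ b' := by rintro rfl; exact hne (by rw [hk', ← hxi.2, ← hxb'.2])
  have hbj' : b ≠ j := by rintro rfl; exact hne (by rw [hk, ← hxb.2, ← hxj.2])
  have hbb' : b ≠ b' := by rintro rfl; exact hne (by rw [hk, hk', ← hxb.2, ← hxb'.2])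
  obtain ⟨u, a1, a2, -, -, a3⟩ := move_edge ec hxi hxb hib hw hxi.sq rfl
  have e1 := ec'.off a3 (by simp only [Finset.mem_insert, Finset.mem_singleton]; grind [Fx, Ed])
  have e2 := hxj.off a3 (by simp only [Finset.mem_insert, Finset.mem_singleton]; grind [Fx, Ed])
  have e3 := hxb'.off a3 (by simp only [Finset.mem_insert, Finset.mem_singleton]; grind [Fx, Ed])
  obtain ⟨v, b1, b2, -, -, b3⟩ := move_edge e1 e2 e3 hjb hw' hxj.sq rfl
  have hs := a1.parallel b1 a3 b3
    (by simp [hxi.1, hxb.1, x.pp]) (by simp [hxj.1, hxb'.1, x.pp])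
    (by simp only [Finset.disjoint_left, Finset.mem_insert, Finset.mem_singleton]
        rintro k (rfl | rfl | rfl | rfl) <;> grind [Fx, Ed])
  have e4 := a2.off b3 (by simp only [Finset.mem_insert, Finset.mem_singleton]; grind [Fx, Ed])
  obtain ⟨v', c1, c2, -, c3⟩ := move_cross e4 b2 hij hij' h
  exact ⟨v', hs.within.trans c1.within, c2,
    ((a3.mono (by simp [Finset.insert_subset_iff, hi, hb, hc, hS])).trans'
      (b3.mono (by simp [Finset.insert_subset_iff, hj, hb', hc', hS]))).trans'
      (c3.mono (by simp [Finset.insert_subset_iff, hi, hb, hj, hb']))⟩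

/-- With at least two 2-cycles, any prescribed 2-cycle is reached in two steps, provided no kind
of fixed points is represented only once, except possibly for the positive ones. -/
lemma edge_step (hG : Good S x y) {i j : Fin n} {h : Aff} (hy : y.Ed i j h) (hi : i ∈ S)
    (hm : 3 ≤ cnt S y .moved) (he : cnt S y .even ≠ 1) (ho : cnt S y .odd ≠ 1)
    (hpi : x.ty i = .pos → x.ty j = .moved → 2 ≤ cnt S y .pos)
    (hpj : x.ty j = .pos → x.ty i = .moved → 2 ≤ cnt S y .pos) :
    ∃ x', Within 2 x x' ∧ x'.Ed i j h ∧ Off S x x' := by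
  have hj : j ∈ S := hy.2.1 ▸ hG.right i hi
  have hS := hG.left
  have hij := hy.1
  rw [← hG.cnt_eq] at hm he ho hpi hpj
  have flip : (∃ x', Within 2 x x' ∧ x'.Ed j i h⁻¹ ∧ Off S x x') →
      ∃ x', Within 2 x x' ∧ x'.Ed i j h ∧ Off S x x' := by
    rintro ⟨x', h1, h2, h3⟩
    exact ⟨x', h1, by simpa using h2.symm, h3⟩
  have hneg : ∀ k ∈ S, x.ty k ≠ .moved → x.ty k ≠ .pos → ∃ b ∈ S, x.ty b = x.ty k ∧ b ≠ k := by
    intro k hk h1 h2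
    have h3 := one_le_cnt hk (x := x) rfl
    refine exists_ne ?_ k
    cases h4 : x.ty k <;> rw [h4] at h3 <;> simp_all <;> omega
  obtain ⟨c, hcS, hc, -⟩ := exists_ne_ne hm i i
  have mixed : ∀ i j, i ∈ S → j ∈ S → x.ty i = .moved → x.ty j ≠ .moved →
      (x.ty j = .pos → 2 ≤ cnt S x .pos) → ∀ h, ∃ x', Within 2 x x' ∧ x'.Ed i j h ∧ Off S x x' := by
    intro i j hi hj hxi hxj hp h
    obtain ⟨q, hq, hqt, hqj⟩ : ∃ b ∈ S, x.ty b = x.ty j ∧ b ≠ j := by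
      by_cases hpos : x.ty j = .pos
      · rw [hpos]; exact exists_ne (hp hpos) j
      · exact hneg j hj hxj hpos
    obtain ⟨c, hcS, hc, hc1, hc2⟩ := exists_ne_ne hm i (x.p i)
    obtain ⟨f1, f2⟩ := fx_of_ty hqt hxj
    obtain ⟨f3, f4⟩ := fx_of_ty (x := x) (i := j) rfl hxj
    exact edge_mixed hS hi hj hq hcS hxi f3 f1 hqj.symm (by rw [f2, f4]) hc hc1 hc2 h
  have posc : ∀ i j, i ∈ S → j ∈ S → x.ty i ≠ .moved → x.ty i ≠ .pos → x.ty j = .pos →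
      ∀ h, ∃ x', Within 2 x x' ∧ x'.Ed i j h ∧ Off S x x' := by
    intro i j hi hj h1 h2 h3 h
    obtain ⟨b, hb, hbt, hbi⟩ := hneg i hi h1 h2
    obtain ⟨f1, f2⟩ := fx_of_ty hbt h1
    obtain ⟨f3, f4⟩ := fx_of_ty (x := x) (i := i) rfl h1
    exact edge_pos hS hi hj hb hcS f3 (fx_of_pos h3) f1 hbi (by rintro rfl; exact h2 h3)
      (by rintro rfl; exact h2 (hbt ▸ h3)) (by rw [f2, f4]) hc h
  by_cases hxi : x.ty i = .moved
  · by_cases hxj : x.ty j = .moved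
    · exact edge_moved hS hij hi hj hxi hxj h
    · exact mixed i j hi hj hxi hxj (fun hp => hpj hp hxi) h
  by_cases hxj : x.ty j = .moved
  · exact flip (mixed j i hj hi hxj hxi (fun hp => hpi hp hxj) h⁻¹)
  obtain ⟨fi, ki⟩ := fx_of_ty (x := x) (i := i) rfl hxi
  obtain ⟨fj, kj⟩ := fx_of_ty (x := x) (i := j) rfl hxj
  by_cases hk : x.ty i = x.ty j
  · exact edge_same hS hij hi hj hcS fi fj (by rw [ki, kj, hk]) hc h
  by_cases hpj' : x.ty j = .pos
  · exact posc i j hi hj hxi (by rw [← hpj']; exact hk) hpj' h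
  by_cases hpi' : x.ty i = .pos
  · exact flip (posc j i hj hi hxj hpj' hpi' h⁻¹)
  obtain ⟨b, hb, hbt, hbi⟩ := hneg i hi hxi hpi'
  obtain ⟨b', hb', hbt', hbi'⟩ := hneg j hj hxj hpj'
  obtain ⟨f1, f2⟩ := fx_of_ty hbt hxi
  obtain ⟨f3, f4⟩ := fx_of_ty hbt' hxj
  obtain ⟨c', hcS', hc', hc1, hc2⟩ := exists_ne_ne hm c (x.p c)
  exact edge_diff hS hi hj hb hb' hcS hcS' fi f1 (by rw [f2, ki]) fj f3 (by rw [f4, kj])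
    (by rw [ki, kj]; exact hk) hbi.symm hbi'.symm hc hc' hc1 hc2 h

/-- Removing a common 2-cycle from the active set. -/
lemma Good.remove_edge (hG : Good S x y) {i j : Fin n} {h : Aff} (hy : y.Ed i j h) (hi : i ∈ S)
    {k : ℕ} (hw : Within k x z) (hz : z.Ed i j h) (ho : Off S x z) :
    Good ((S.erase i).erase j) z y ∧ ((S.erase i).erase j).card < S.card ∧
      cnt S y .moved = cnt ((S.erase i).erase j) y .moved + 2 ∧
      ∀ t, t ≠ .moved → cnt S y t = cnt ((S.erase i).erase j) y t := by
  have hj : j ∈ S.erase i := Finset.mem_erase.2 ⟨hy.1.symm, hy.2.1 ▸ hG.right i hi⟩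
  refine ⟨(hG.step hw ho).erase_ed hz hy, ?_, ?_, fun t ht => ?_⟩
  · have := Finset.card_erase_lt_of_mem hi
    have := Finset.card_erase_lt_of_mem hj
    omega
  · rw [cnt_erase_self hi hy.ty, cnt_erase_self hj hy.symm.ty]
  · rw [cnt_erase_ne hi (by rw [hy.ty]; exact ht.symm),
      cnt_erase_ne hj (by rw [hy.symm.ty]; exact ht.symm)]

/-- Removing a common fixed point from the active set. -/
lemma Good.remove_point (hG : Good S x y) {i : Fin n} {a : Aff} (hy : y.Fx i a) (hi : i ∈ S)
    {k : ℕ} (hw : Within k x z) (hz : z.Fx i a) (ho : Off S x z) :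
    Good (S.erase i) z y ∧ (S.erase i).card < S.card ∧
      cnt S y a.kind = cnt (S.erase i) y a.kind + 1 ∧
      ∀ t, t ≠ a.kind → cnt S y t = cnt (S.erase i) y t :=
  ⟨(hG.step hw ho).erase hz hy, Finset.card_erase_lt_of_mem hi, cnt_erase_self hi hy.ty,
    fun t ht => cnt_erase_ne hi (by rw [hy.ty]; exact ht.symm)⟩

end Cfg

end AffineWeylC

namespace AffineWeylC

variable {n : ℕ}

namespace Cfg

section

variable {x y z : Cfg n} {S : Finset (Fin n)}

/-- Reachability within `k` steps, all of them together affecting only points of `S`. -/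
def Reach (S : Finset (Fin n)) (k : ℕ) (x y : Cfg n) : Prop := Within k x y ∧ Off S x y

lemma Reach.refl (S : Finset (Fin n)) (x : Cfg n) : Reach S 0 x x := ⟨.refl x, .refl S x⟩

lemma Reach.trans {k l : ℕ} (h : Reach S k x y) (h' : Reach S l y z) : Reach S (k + l) x z :=
  ⟨h.1.trans h'.1, h.2.trans' h'.2⟩

lemma Reach.mono {k l : ℕ} (h : Reach S k x y) (hkl : k ≤ l) : Reach S l x y :=
  ⟨h.1.mono hkl, h.2⟩

lemma Reach.subset {k : ℕ} {T : Finset (Fin n)} (h : Reach S k x y) (hST : S ⊆ T) :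
    Reach T k x y := ⟨h.1, h.2.mono hST⟩

lemma Good.reach {k : ℕ} (h : Good S x y) (hr : Reach S k x z) : Good S z y := h.step hr.1 hr.2

lemma reach_token {i j : Fin n} {a b : Aff} (hi : x.Fx i a) (hj : x.Fx j 1) (hij : i ≠ j)
    (hb : b * b = 1) (hk : b.kind = a.kind) (hiS : i ∈ S) (hjS : j ∈ S) :
    ∃ x' : Cfg n, Reach S 1 x x' ∧ x'.Fx i 1 ∧ x'.Fx j b ∧
      ∀ k, k ≠ i → k ≠ j → x'.p k = x.p k ∧ x'.d k = x.d k := by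
  obtain ⟨x', h1, h2, h3, h4⟩ := move_token hi hj hij hb hk
  exact ⟨x', ⟨h1.within, h4.mono (by simp [Finset.insert_subset_iff, *])⟩, h2, h3,
    fun k h h' => h4 k (by simp [h, h'])⟩

lemma reach_edge {a b c d : Fin n} {g γ δ : Aff} (w r : Aff) (hab : x.Ed a b g) (hc : x.Fx c γ)
    (hd : x.Fx d δ) (hcd : c ≠ d) (hw : w * γ = δ * w) (hr : r * r = 1) (hk : r.kind = γ.kind)
    (haS : a ∈ S) (hbS : b ∈ S) (hcS : c ∈ S) (hdS : d ∈ S) :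
    ∃ x' : Cfg n, Reach S 1 x x' ∧ x'.Ed c d w ∧ x'.Fx a r ∧ x'.Fx b (g * r * g⁻¹) ∧
      ∀ k, k ≠ a → k ≠ b → k ≠ c → k ≠ d → x'.p k = x.p k ∧ x'.d k = x.d k := by
  obtain ⟨x', h1, h2, h3, h4, h5⟩ := move_edge hab hc hd hcd hw hr hk
  exact ⟨x', ⟨h1.within, h5.mono (by simp [Finset.insert_subset_iff, *])⟩, h2, h3, h4,
    fun k h h' h'' h''' => h5 k (by simp [h, h', h'', h'''])⟩

lemma reach_label {a b : Fin n} {g g' : Aff} (hab : x.Ed a b g)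
    (h : g⁻¹ * g' * (g⁻¹ * g') = 1) (haS : a ∈ S) (hbS : b ∈ S) :
    ∃ x' : Cfg n, Reach S 1 x x' ∧ x'.Ed a b g' ∧
      ∀ k, k ≠ a → k ≠ b → x'.p k = x.p k ∧ x'.d k = x.d k := by
  obtain ⟨x', h1, h2, h3⟩ := move_label hab h
  exact ⟨x', ⟨h1.within, h3.mono (by simp [Finset.insert_subset_iff, *])⟩, h2,
    fun k h h' => h3 k (by simp [h, h'])⟩

lemma reach_cross {i a j b : Fin n} {g k : Aff} (hia : x.Ed i a g) (hjb : x.Ed j b k)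
    (hij : i ≠ j) (hib : i ≠ b) (h : Aff) (hiS : i ∈ S) (haS : a ∈ S) (hjS : j ∈ S)
    (hbS : b ∈ S) :
    ∃ x' : Cfg n, Reach S 1 x x' ∧ x'.Ed i j h ∧ x'.Ed a b (k * h * g⁻¹) ∧
      ∀ t, t ≠ i → t ≠ a → t ≠ j → t ≠ b → x'.p t = x.p t ∧ x'.d t = x.d t := by
  obtain ⟨x', h1, h2, h3, h4⟩ := move_cross hia hjb hij hib h
  exact ⟨x', ⟨h1.within, h4.mono (by simp [Finset.insert_subset_iff, *])⟩, h2, h3,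
    fun k h h' h'' h''' => h4 k (by simp [h, h', h'', h'''])⟩

lemma Reach.restore {k : ℕ} {c d : Fin n} {u : Aff} (h : Reach (insert c (insert d S)) k x z)
    (hx : x.Ed c d u) (hz : z.Ed c d u) : Reach S k x z := by
  refine ⟨h.1, fun i hi => ?_⟩
  have hx' := hx.symm
  have hz' := hz.symm
  by_cases hc : i = c
  · subst hc; exact ⟨hz.2.1.trans hx.2.1.symm, hz.2.2.trans hx.2.2.symm⟩
  by_cases hd : i = d
  · subst hd; exact ⟨hz'.2.1.trans hx'.2.1.symm, hz'.2.2.trans hx'.2.2.symm⟩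
  exact h.2 i (by simp [hc, hd, hi])

lemma Good.eq_of_cnt (hG : Good S x y) (hm : cnt S y .moved = 0) (he : cnt S y .even = 0)
    (ho : cnt S y .odd = 0) : y = x := by
  refine hG.eq_of_pos fun i hi => ?_
  have h := one_le_cnt hi (x := y) rfl
  cases hy : y.ty i <;> rw [hy] at h <;> first | rfl | omega

/-- Moving the last active 2-cycle with the help of an inactive one. -/
lemma within_of_helper (hG : Good S x y) {c d : Fin n} {u : Aff} (hx : x.Ed c d u) (hc : c ∉ S)
    (hd : d ∉ S) (hm : 1 ≤ cnt S y .moved) (hm' : cnt S y .moved ≤ 2) (hl : 2 ≤ cnt S y .pos)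
    (he : cnt S y .even = 0) (ho : cnt S y .odd = 0) : Within 3 x y := by
  obtain ⟨i, hi, hyi⟩ := exists_one hm
  have hj := hG.right i hi
  set h := y.d i
  have hy : y.Ed i (y.p i) h := ed_of_ty hyi
  obtain ⟨a₀, ha₀, hxa₀⟩ := exists_one (hG.cnt_eq .moved ▸ hm)
  have hlx := hG.cnt_eq .pos ▸ hl
  have main : ∀ {i j : Fin n} {h : Aff}, i ∈ S → j ∈ S → i ≠ j → x.ty i = .moved →
      x.ty j = .pos → ∃ x', Reach S 3 x x' ∧ x'.Ed i j h := by
    intro i j h hi hj hij hxi hxj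
    obtain ⟨q, hq, hxq, hqj⟩ := exists_ne hlx j
    have ei := ed_of_ty hxi
    have ei' := ei.symm
    have fj := fx_of_pos hxj
    have fq := fx_of_pos hxq
    have ha := hG.left i hi
    have hx' := hx.symm
    set T := insert c (insert d S)
    have hcT : c ∈ T := by simp [T]
    have hdT : d ∈ T := by simp [T]
    have hST : ∀ {k}, k ∈ S → k ∈ T := fun hk => by simp [T, hk]
    obtain ⟨u₁, r1, e1, f1, f2, o1⟩ := reach_edge (1 : Aff) 1 hx fj fq hqj.symm (by simp) (by simp) rfl
      hcT hdT (hST hj) (hST hq)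
    have e2 : u₁.Ed i (x.p i) (x.d i) := by grind [Fx, Ed]
    obtain ⟨u₂, r2, e3, e4, o2⟩ := reach_cross e2 e1 hij (by grind [Fx, Ed]) h (hST hi) (hST ha)
      (hST hj) (hST hq)
    have f3 : u₂.Fx c 1 := by grind [Fx, Ed]
    have f4 : u₂.Fx d 1 := by
      have : u * 1 * u⁻¹ = 1 := by simp
      rw [this] at f2
      grind [Fx, Ed]
    obtain ⟨u₃, r3, e5, -, -, o3⟩ := reach_edge u 1 e4 f3 f4 hx.1 (by simp) (by simp) rfl
      (hST ha) (hST hq) hcT hdT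
    exact ⟨u₃, ((r1.trans r2).trans r3).restore hx e5, by grind [Fx, Ed]⟩
  obtain ⟨x', r, e⟩ : ∃ x', Reach S 3 x x' ∧ x'.Ed i (y.p i) h := by
    have htype : ∀ k ∈ S, x.ty k = .moved ∨ x.ty k = .pos := by
      intro k hk
      have := one_le_cnt hk (x := x) rfl
      rw [hG.cnt_eq] at this
      cases hk : x.ty k <;> rw [hk] at this <;> first | omega | simp
    rcases htype i hi with h1 | h1 <;> rcases htype _ hj with h2 | h2
    · obtain ⟨x', h3, h4, h5⟩ := edge_moved hG.left hy.1 hi hj h1 h2 h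
      exact ⟨x', ⟨h3.mono (by omega), h5⟩, h4⟩
    · exact main hi hj hy.1 h1 h2
    · obtain ⟨x', h3, h4⟩ := main (h := h⁻¹) hj hi hy.1.symm h2 h1
      exact ⟨x', h3, by simpa using h4.symm⟩
    · obtain ⟨x', h3, h4, h5⟩ := edge_same hG.left hy.1 hi hj ha₀ (fx_of_pos h1) (fx_of_pos h2)
        rfl hxa₀ h
      exact ⟨x', ⟨h3.mono (by omega), h5⟩, h4⟩
  obtain ⟨h1, h2, h3, h4⟩ := hG.remove_edge hy hi r.1 e r.2
  rw [h1.eq_of_cnt (by omega) (by rw [← h4 _ (by simp)]; exact he)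
    (by rw [← h4 _ (by simp)]; exact ho)]
  exact r.1

/-- A fixed point is made positive, possibly in one step. -/
lemma exists_clear (hl : 2 ≤ cnt S x .pos) {i : Fin n} (hi : i ∈ S) (hxi : x.ty i ≠ .moved)
    (j : Fin n) : ∃ x', Reach S 1 x x' ∧ x'.Fx i 1 ∧ (x.ty j ≠ .moved → x'.ty j ≠ .moved) ∧
      (x.Fx j 1 → x'.Fx j 1) ∧ ∀ k, x.ty k = .moved → x'.p k = x.p k ∧ x'.d k = x.d k := by
  by_cases hp : x.ty i = .pos
  · exact ⟨x, (Reach.refl S x).mono (by omega), fx_of_pos hp, id, id, fun _ _ => ⟨rfl, rfl⟩⟩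
  obtain ⟨p, hpS, hxp, hpj⟩ := exists_ne hl j
  have fi := (fx_of_ty rfl hxi).1
  have fp := fx_of_pos hxp
  obtain ⟨x', r, f1, f2, o⟩ := reach_token fi fp (by rintro rfl; exact hp hxp) fi.sq rfl hi hpS
  refine ⟨x', r, f1, fun hj => ?_, fun hj => ?_, fun k hk => ?_⟩
  · rw [Ne, ty_eq_moved] at hj ⊢
    grind [Fx]
  · grind [Fx]
  · rw [ty_eq_moved] at hk
    grind [Fx]

/-- With two positive points and at least one further point, any prescribed 2-cycle is reached
in four steps. -/
lemma edge_four (hG : Good S x y) {i j : Fin n} {h : Aff} (hy : y.Ed i j h) (hi : i ∈ S)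
    (hl : 2 ≤ cnt S y .pos) (hk : 3 ≤ cnt S y .pos ∨ 1 ≤ cnt S y .even + cnt S y .odd) :
    ∃ x', Reach S 4 x x' ∧ x'.Ed i j h := by
  have hj : j ∈ S := hy.2.1 ▸ hG.right i hi
  have hS := hG.left
  have hij := hy.1
  obtain ⟨a₀, ha₀, hxa₀⟩ := exists_one (hG.cnt_eq .moved ▸ one_le_cnt hi hy.ty)
  rw [← hG.cnt_eq, ← hG.cnt_eq, ← hG.cnt_eq] at hk
  rw [← hG.cnt_eq] at hl
  have nonpos : ∀ {x : Cfg n} {i j : Fin n} {h : Aff}, (∀ i ∈ S, x.p i ∈ S) → i ∈ S → j ∈ S →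
      x.ty i = .moved → x.ty j ≠ .moved → x.ty j ≠ .pos → 2 ≤ cnt S x .pos →
      ∃ x', Reach S 3 x x' ∧ x'.Ed i j h := by
    intro x i j h hS hi hj hxi hxj hxj' hl
    obtain ⟨p, hp, hxp⟩ := exists_one (S := S) (x := x) (t := .pos) (by omega)
    obtain ⟨q, hq, hxq, hqp⟩ := exists_ne hl p
    have ei := ed_of_ty hxi
    have ei' := ei.symm
    have fj := (fx_of_ty rfl hxj).1
    have fp := fx_of_pos hxp
    have fq := fx_of_pos hxq
    have hjp : j ≠ p := by rintro rfl; exact hxj' hxp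
    have hjq : j ≠ q := by rintro rfl; exact hxj' hxq
    obtain ⟨u₁, r1, e1, f1, f2, o1⟩ := reach_edge (1 : Aff) 1 ei fp fq hqp.symm (by simp) (by simp) rfl
      hi (hS i hi) hp hq
    have f3 : u₁.Fx j (x.d j) := by grind [Fx, Ed]
    obtain ⟨u₂, r2, f4, f5, o2⟩ := reach_token f3 (j := x.p i) (by simpa using f2) (by grind [Fx, Ed])
      f3.sq rfl hj (hS i hi)
    have e2 : u₂.Ed p q 1 := by grind [Fx, Ed]
    have f6 : u₂.Fx i 1 := by grind [Fx, Ed]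
    obtain ⟨u₃, r3, e3, -⟩ := reach_edge h 1 e2 f6 f4 (by grind [Fx, Ed]) (by simp) (by simp) rfl
      hp hq hi hj
    exact ⟨u₃, (r1.trans r2).trans r3, e3⟩
  have mixed : ∀ {i j : Fin n} {h : Aff}, i ∈ S → j ∈ S → i ≠ j → x.ty i = .moved →
      x.ty j ≠ .moved → ∃ x', Reach S 4 x x' ∧ x'.Ed i j h := by
    intro i j h hi hj hij hxi hxj
    by_cases hxj' : x.ty j = .pos
    · have ei := ed_of_ty hxi
      have ei' := ei.symm
      have fj := fx_of_pos hxj'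
      rcases hk with hk | hk
      · obtain ⟨p, hp, hxp, hpj⟩ := exists_ne hl j
        obtain ⟨q, hq, hxq, hqj, hqp⟩ := exists_ne_ne hk j p
        have fp := fx_of_pos hxp
        have fq := fx_of_pos hxq
        obtain ⟨u₁, r1, e1, f1, f2, o1⟩ := reach_edge (1 : Aff) 1 ei fp fq hqp.symm (by simp) (by simp)
          rfl hi (hS i hi) hp hq
        have f3 : u₁.Fx j 1 := by grind [Fx, Ed]
        obtain ⟨u₃, r3, e3, -⟩ := reach_edge h 1 e1 f1 f3 hij (by simp) (by simp) rfl
          hp hq hi hj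
        exact ⟨u₃, (r1.trans r3).mono (by omega), e3⟩
      · obtain ⟨b, hb, hxb, hxb'⟩ : ∃ b ∈ S, x.ty b ≠ .moved ∧ x.ty b ≠ .pos := by
          by_cases he : 1 ≤ cnt S x .even
          · obtain ⟨b, hb, hxb⟩ := exists_one he
            exact ⟨b, hb, by simp [hxb], by simp [hxb]⟩
          · obtain ⟨b, hb, hxb⟩ := exists_one (S := S) (x := x) (t := .odd) (by omega)
            exact ⟨b, hb, by simp [hxb], by simp [hxb]⟩
        have fb := (fx_of_ty rfl hxb).1
        obtain ⟨u, r, f1, f2, o⟩ := reach_token fb fj (by rintro rfl; exact hxb' hxj') fb.sq rfl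
          hb hj
        have hG' := hG.reach r
        have e1 : u.Ed i (x.p i) (x.d i) := by grind [Fx, Ed]
        have h1 := f2.ty.trans fb.ty.symm
        obtain ⟨v, h2, h3⟩ := nonpos (h := h) hG'.left hi hj e1.ty (by rw [h1]; exact hxb)
          (by rw [h1]; exact hxb') (by rw [hG'.cnt_eq, ← hG.cnt_eq]; exact hl)
        exact ⟨v, (r.trans h2), h3⟩
    · obtain ⟨v, h2, h3⟩ := nonpos (h := h) hS hi hj hxi hxj hxj' hl
      exact ⟨v, h2.mono (by omega), h3⟩
  by_cases hxi : x.ty i = .moved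
  · by_cases hxj : x.ty j = .moved
    · obtain ⟨x', h3, h4, h5⟩ := edge_moved hS hij hi hj hxi hxj h
      exact ⟨x', ⟨h3.mono (by omega), h5⟩, h4⟩
    · exact mixed hi hj hij hxi hxj
  by_cases hxj : x.ty j = .moved
  · obtain ⟨x', h3, h4⟩ := mixed (h := h⁻¹) hj hi hij.symm hxj hxi
    exact ⟨x', h3, by simpa using h4.symm⟩
  obtain ⟨u, r1, f1, h1, -, o1⟩ := exists_clear hl hi hxi j
  have hG' := hG.reach r1
  obtain ⟨v, r2, f2, -, h2, o2⟩ := exists_clear (S := S) (x := u)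
    (by rw [hG'.cnt_eq, ← hG.cnt_eq]; exact hl) hj (h1 hxj) i
  have ea := ed_of_ty hxa₀
  have ea' : u.Ed a₀ (x.p a₀) (x.d a₀) := ⟨ea.1, (o1 _ hxa₀).1, (o1 _ hxa₀).2⟩
  have ea'' : v.Ed a₀ (x.p a₀) (x.d a₀) :=
    ⟨ea.1, (o2 _ ea'.ty).1.trans ea'.2.1, (o2 _ ea'.ty).2.trans ea'.2.2⟩
  obtain ⟨w, r3, e3, -⟩ := reach_edge h 1 ea'' (h2 f1) f2 hij (by simp) (by simp) rfl
    ha₀ (hS _ ha₀) hi hj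
  exact ⟨w, ((r1.trans r2).trans r3).mono (by omega), e3⟩

/-- The only negative point of some kind is placed in two steps. -/
lemma place_single (hG : Good S x y) (hl : 2 ≤ cnt S y .pos) {i : Fin n} (hi : i ∈ S)
    (hyi : y.ty i ≠ .moved) (hyi' : y.ty i ≠ .pos) :
    ∃ x', Reach S 2 x x' ∧ x'.Fx i (y.d i) := by
  have hS := hG.left
  rw [← hG.cnt_eq] at hl
  have hyf := (fx_of_ty rfl hyi).1
  obtain ⟨j, hj, hxj⟩ := exists_one (hG.cnt_eq (y.ty i) ▸ one_le_cnt hi rfl)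
  obtain ⟨fj, kj⟩ := fx_of_ty hxj hyi
  obtain ⟨u, k, c, r, f, hk, hki, fk, hkc⟩ : ∃ u k c, Reach S 1 x u ∧ u.Fx i 1 ∧ k ∈ S ∧ k ≠ i ∧
      u.Fx k c ∧ c.kind = y.ty i := by
    have hjp : ∀ {p}, x.ty p = .pos → j ≠ p := by
      rintro p hp rfl; exact hyi' (hxj.symm.trans hp)
    by_cases hji : j = i
    · subst hji
      obtain ⟨p, hp, hxp, hpj⟩ := exists_ne hl j
      obtain ⟨u, r, f1, f2, -⟩ := reach_token fj (fx_of_pos hxp) hpj.symm fj.sq rfl hj hp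
      exact ⟨u, p, _, r, f1, hp, hpj, f2, kj⟩
    by_cases hxi : x.ty i = .moved
    · obtain ⟨p, hp, hxp⟩ := exists_one (S := S) (x := x) (t := .pos) (by omega)
      obtain ⟨q, hq, hxq, hqp⟩ := exists_ne hl p
      have ei := ed_of_ty hxi
      have ei' := ei.symm
      have := hjp hxp
      have := hjp hxq
      obtain ⟨u₁, r1, e1, f1, f2, o1⟩ := reach_edge (1 : Aff) 1 ei (fx_of_pos hxp) (fx_of_pos hxq) hqp.symm
        (by simp) (by simp) rfl hi (hS i hi) hp hq
      exact ⟨u₁, j, _, r1, f1, hj, hji, (show u₁.Fx j (x.d j) by grind [Fx, Ed]), kj⟩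
    obtain ⟨p, hp, hxp, hpi⟩ := exists_ne hl i
    by_cases hxi' : x.ty i = .pos
    · exact ⟨x, j, _, (Reach.refl S x).mono (by omega), fx_of_pos hxi', hj, hji, fj, kj⟩
    obtain ⟨fi, -⟩ := fx_of_ty (x := x) (i := i) rfl hxi
    have := hjp hxp
    obtain ⟨u, r, f1, f2, o⟩ := reach_token fi (fx_of_pos hxp) hpi.symm fi.sq rfl hi hp
    exact ⟨u, j, _, r, f1, hj, hji, (show u.Fx j (x.d j) by grind [Fx]), kj⟩
  obtain ⟨v, r', -, h, -⟩ := reach_token fk f hki hyf.sq (by rw [hkc, hyf.ty]) hk hi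
  exact ⟨v, r.trans r', h⟩

/-- The case of at least two positive points. -/
lemma within_of_two_pos (N : ℕ) : ∀ (S : Finset (Fin n)) (x : Cfg n), S.card = N → Good S x y →
    2 ≤ cnt S y .pos → (cnt S y .moved = 0 ∨ 3 ≤ cnt S y .moved ∨ 3 ≤ cnt S y .pos ∨
      1 ≤ cnt S y .even + cnt S y .odd) →
    Within (cnt S y .moved + 2 + cnt S y .even + cnt S y .odd + min 1 (cnt S y .even)
      + min 1 (cnt S y .odd)) x y := by
  induction N using Nat.strong_induction_on with
  | _ N IH =>
  rintro S x rfl hG hl hc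
  have hp : Kind.Pair .even .odd := Or.inl ⟨rfl, rfl⟩
  by_cases h0 : cnt S y .moved = 0
  · exact (within_of_fixed hp hG h0 (by omega)).mono (by omega)
  obtain ⟨i, hi, hyi⟩ := exists_one (S := S) (x := y) (t := .moved) (by omega)
  have ey := ed_of_ty hyi
  by_cases h3 : 3 ≤ cnt S y .moved
  · have single : ∀ t t', Kind.Pair t t' → cnt S y t = 1 →
        Within (cnt S y .moved + 2 + cnt S y t + cnt S y t' + min 1 (cnt S y t)
      + min 1 (cnt S y t')) x y := by
      intro t t' ht h1
      obtain ⟨k, hk, hyk⟩ := exists_one (S := S) (x := y) (t := t) (by omega)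
      obtain ⟨fk, kk⟩ := fx_of_ty hyk ht.ne_moved
      obtain ⟨x', r, f⟩ := place_single hG hl hk (by rw [hyk]; exact ht.ne_moved)
        (by rw [hyk]; exact ht.ne_pos)
      obtain ⟨a1, a2, a3, a4⟩ := hG.remove_point fk hk r.1 f r.2
      rw [kk] at a3 a4
      have b1 := a4 .moved ht.ne_moved.symm
      have b2 := a4 .pos ht.ne_pos.symm
      have b3 := a4 t' ht.ne.symm
      refine (r.1.trans (IH _ a2 _ x' rfl a1 (by omega) (by omega))).mono ?_
      rcases ht with ⟨rfl, rfl⟩ | ⟨rfl, rfl⟩ <;> omega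
    by_cases he : cnt S y .even = 1
    · exact single _ _ hp he
    by_cases ho : cnt S y .odd = 1
    · exact (single _ _ hp.symm ho).mono (by omega)
    obtain ⟨x', h1, h2, h4⟩ := edge_step hG ey hi h3 he ho (fun _ _ => hl) (fun _ _ => hl)
    obtain ⟨a1, a2, a3, a4⟩ := hG.remove_edge ey hi h1 h2 h4
    have b1 := a4 .even (by simp)
    have b2 := a4 .pos (by simp)
    have b3 := a4 .odd (by simp)
    set S' := (S.erase i).erase (y.p i) with hS'
    by_cases hc' : cnt S' y .moved = 0 ∨ 3 ≤ cnt S' y .moved ∨ 3 ≤ cnt S' y .pos ∨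
      1 ≤ cnt S' y .even + cnt S' y .odd
    · exact (h1.trans (IH _ a2 _ x' rfl a1 (by omega) hc')).mono (by omega)
    · refine (h1.trans (within_of_helper a1 h2 (by simp [hS']) (by simp [hS']) (by omega) (by omega)
        (by omega) (by omega) (by omega))).mono (by omega)
  · obtain ⟨x', r, e⟩ := edge_four hG ey hi hl (by omega)
    obtain ⟨a1, a2, a3, a4⟩ := hG.remove_edge ey hi r.1 e r.2
    have b1 := a4 .even (by simp)
    have b2 := a4 .pos (by simp)
    have b3 := a4 .odd (by simp)
    exact (r.1.trans (within_of_fixed hp a1 (by omega) (by omega))).mono (by omega)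

end

section

variable {x y z : Cfg n} {S : Finset (Fin n)}

lemma eq_of_cnt_le_one {t : Kind} (h : cnt S x t ≤ 1) {i j : Fin n} (hi : i ∈ S) (hj : j ∈ S)
    (hxi : x.ty i = t) (hxj : x.ty j = t) : i = j := by
  by_contra hij
  have := two_le_cnt hi hj hij hxi hxj
  omega

lemma Ed.eq_of_moved {i j k : Fin n} {g : Aff} (hx : x.Ed i j g) (h : cnt S x .moved ≤ 2)
    (hi : i ∈ S) (hj : j ∈ S) (hk : k ∈ S) (hxk : x.ty k = .moved) : k = i ∨ k = j := by
  by_contra! hc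
  have := three_le_cnt hi hj hk hx.1 hc.1.symm hc.2.symm hx.ty hx.symm.ty hxk
  omega

lemma Ed.not_moved {i j k : Fin n} {g : Aff} (hx : x.Ed i j g) (h : cnt S x .moved ≤ 2)
    (hi : i ∈ S) (hj : j ∈ S) (hk : k ∈ S) (hki : k ≠ i) (hkj : k ≠ j) : x.ty k ≠ .moved := by
  intro hxk
  rcases hx.eq_of_moved h hi hj hk hxk with h1 | h1
  · exact hki h1
  · exact hkj h1

/-- Exchanging one end of a 2-cycle with a positive point, with the help of two points of the
same negative kind. -/
lemma reach_mix {i a j p q : Fin n} {g γ δ ρ : Aff} (hx : x.Ed i a g) (hj : x.Fx j 1)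
    (hp : x.Fx p γ) (hq : x.Fx q δ) (hpq : p ≠ q) (hk : γ.kind = δ.kind) (hγ : γ.kind ≠ .pos)
    (hρ : ρ * ρ = 1) (hρk : ρ.kind = γ.kind) (h : Aff)
    (hiS : i ∈ S) (haS : a ∈ S) (hjS : j ∈ S) (hpS : p ∈ S) (hqS : q ∈ S) :
    ∃ x', Reach S 3 x x' ∧ x'.Ed i j h ∧ x'.Fx a 1 ∧ x'.Fx p ρ := by
  obtain ⟨w, hw⟩ := Aff.exists_conj hp.sq hq.sq hk
  have hx' := hx.symm
  have hjp : j ≠ p := by rintro rfl; exact hγ (by rw [← hp.ty, hj.ty]; rfl)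
  have hjq : j ≠ q := by rintro rfl; exact hγ (by rw [hk, ← hq.ty, hj.ty]; rfl)
  obtain ⟨u, r1, e1, f1, f2, o1⟩ := reach_edge w γ hx hp hq hpq hw hp.sq rfl hiS haS hpS hqS
  have f3 : u.Fx j 1 := by grind [Fx, Ed]
  obtain ⟨v, r2, f4, f5, o2⟩ := reach_token (b := h * γ * h⁻¹) f2 f3 (by grind [Fx, Ed])
    (Aff.sq_conj h hp.sq) (by simp) haS hjS
  have e2 : v.Ed p q w := by grind [Fx, Ed]
  have f6 : v.Fx i γ := by grind [Fx, Ed]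
  obtain ⟨v', r3, e3, f7, -, o3⟩ := reach_edge h ρ e2 f6 f5 (by grind [Fx, Ed]) (by group) hρ hρk
    hpS hqS hiS hjS
  exact ⟨v', (r1.trans r2).trans r3, e3, by grind [Fx, Ed], f7⟩

lemma mixed_of_pos {t t' : Kind} (ht : t.Pair t') (hG : Good S x y) {i a j : Fin n}
    {g h : Aff} (hx : x.Ed i a g) (hy : y.Ed i j h) (hi : i ∈ S) (hj : x.Fx j 1)
    (hm : cnt S y .moved = 2) (hl : cnt S y .pos = 1) (h2 : 2 ≤ cnt S y t) :
    Within (cnt S y t + cnt S y t' + 2 * min 1 (cnt S y t') + 3) x y := by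
  have haS : a ∈ S := hx.2.1 ▸ hG.left i hi
  have hjS : j ∈ S := hy.2.1 ▸ hG.right i hi
  obtain ⟨p₀, hp₀, hyp₀⟩ := exists_one (S := S) (x := y) (t := .pos) (by omega)
  obtain ⟨p, hpS, hxp, hp⟩ := exists_ne (hG.cnt_eq t ▸ h2) p₀
  obtain ⟨q, hqS, hxq, hqp⟩ := exists_ne (hG.cnt_eq t ▸ h2) p
  obtain ⟨fp, kp⟩ := fx_of_ty hxp ht.ne_moved
  obtain ⟨fq, kq⟩ := fx_of_ty hxq ht.ne_moved
  have hpi : p ≠ i := by rintro rfl; exact ht.ne_moved (hxp.symm.trans hx.ty)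
  have hpj : p ≠ j := by rintro rfl; exact ht.ne_pos (hxp.symm.trans hj.ty)
  have hypm := hy.not_moved hm.le hi hjS hpS hpi hpj
  have hypp : y.ty p ≠ .pos := fun h => hp (eq_of_cnt_le_one hl.le hpS hp₀ h hyp₀)
  by_cases h0 : cnt S y t' = 0
  · have hyp : y.ty p = t := by
      rcases ht.cases (y.ty p) with h | h | h | h
      · exact absurd h hypm
      · exact h
      · have := one_le_cnt hpS h; omega
      · exact absurd h hypp
    obtain ⟨gp, lp⟩ := fx_of_ty hyp ht.ne_moved
    obtain ⟨x', r, e, -, f⟩ := reach_mix hx hj fp fq hqp.symm (by rw [kp, kq])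
      (by rw [kp]; exact ht.ne_pos) gp.sq (by rw [lp, kp]) h hi haS hjS hpS hqS
    obtain ⟨a1, a2, a3, a4⟩ := hG.remove_edge hy hi r.1 e r.2
    obtain ⟨b1, b2, b3, b4⟩ := a1.remove_point gp (by simp [hpi, hpj, hpS]) (Within.refl _) f
      (Off.refl _ _)
    rw [lp] at b3 b4
    have := a4 t ht.ne_moved
    have := a4 t' ht.symm.ne_moved
    have := a4 .pos (by simp)
    have := b4 t' ht.ne.symm
    have := b4 .pos ht.ne_pos.symm
    have := b4 .moved ht.ne_moved.symm
    exact (r.1.trans (within_of_fixed ht b1 (by omega) (by omega))).mono (by omega)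
  · obtain ⟨x', r, e, -, -⟩ := reach_mix hx hj fp fq hqp.symm (by rw [kp, kq])
      (by rw [kp]; exact ht.ne_pos) fp.sq rfl h hi haS hjS hpS hqS
    obtain ⟨a1, a2, a3, a4⟩ := hG.remove_edge hy hi r.1 e r.2
    have := a4 t ht.ne_moved
    have := a4 t' ht.symm.ne_moved
    have := a4 .pos (by simp)
    exact (r.1.trans (within_of_fixed ht a1 (by omega) (by omega))).mono (by omega)

lemma mixed {t t' : Kind} (ht : t.Pair t') (hG : Good S x y) {i a j : Fin n}
    {g h : Aff} (hx : x.Ed i a g) (hy : y.Ed i j h) (hi : i ∈ S) (hxj : x.ty j ≠ .moved)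
    (hm : cnt S y .moved = 2) (hl : cnt S y .pos = 1) (h2 : 2 ≤ cnt S y t) :
    Within (cnt S y t + cnt S y t' + 2 * min 1 (cnt S y t') + 3) x y := by
  by_cases hxj' : x.ty j = .pos
  · exact mixed_of_pos ht hG hx hy hi (fx_of_pos hxj') hm hl h2
  by_cases hya : y.ty a = .pos
  · have := (mixed_of_pos ht hG.symm hy hx hi (fx_of_pos hya) (by rw [hG.cnt_eq, hm])
      (by rw [hG.cnt_eq, hl]) (by rw [hG.cnt_eq]; exact h2)).symm
    simpa only [hG.cnt_eq] using this
  have haS : a ∈ S := hx.2.1 ▸ hG.left i hi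
  have hjS : j ∈ S := hy.2.1 ▸ hG.right i hi
  obtain ⟨r, hr, hxr⟩ := exists_one (S := S) (x := x) (t := .pos) (by rw [hG.cnt_eq]; omega)
  obtain ⟨fj, -⟩ := fx_of_ty (x := x) (i := j) rfl hxj
  have fr := fx_of_pos hxr
  obtain ⟨u, r0, f0, -, o0⟩ := reach_token fj fr (by rintro rfl; exact hxj' hxr) fj.sq rfl hjS hr
  have hx' := hx.symm
  have hxu : u.Ed i a g := by grind [Fx, Ed]
  have hG' := hG.reach r0
  obtain ⟨p₀, hp₀, hyp₀⟩ := exists_one (S := S) (x := y) (t := .pos) (by omega)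
  obtain ⟨p, hpS, hxp, hp⟩ := exists_ne (hG'.cnt_eq t ▸ h2) p₀
  obtain ⟨q, hqS, hxq, hqp⟩ := exists_ne (hG'.cnt_eq t ▸ h2) p
  obtain ⟨fp, kp⟩ := fx_of_ty hxp ht.ne_moved
  obtain ⟨fq, kq⟩ := fx_of_ty hxq ht.ne_moved
  have hpi : p ≠ i := by rintro rfl; exact ht.ne_moved (hxp.symm.trans hxu.ty)
  have hpj : p ≠ j := by rintro rfl; exact ht.ne_pos (hxp.symm.trans f0.ty)
  have hypm := hy.not_moved hm.le hi hjS hpS hpi hpj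
  have hypp : y.ty p ≠ .pos := fun h => hp (eq_of_cnt_le_one hl.le hpS hp₀ h hyp₀)
  have hi₀ : p₀ ≠ i := by rintro rfl; simp [hy.ty] at hyp₀
  have hj₀ : p₀ ≠ j := by rintro rfl; simp [hy.symm.ty] at hyp₀
  obtain ⟨ρ, hρ, hρk, hρy⟩ : ∃ ρ : Aff, ρ * ρ = 1 ∧ ρ.kind = t ∧
      (cnt S y t' = 0 → y.Fx p ρ) := by
    by_cases h0 : cnt S y t' = 0
    · have hyp : y.ty p = t := by
        rcases ht.cases (y.ty p) with h | h | h | h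
        · exact absurd h hypm
        · exact h
        · have := one_le_cnt hpS h; omega
        · exact absurd h hypp
      obtain ⟨gp, lp⟩ := fx_of_ty hyp ht.ne_moved
      exact ⟨_, gp.sq, lp, fun _ => gp⟩
    · exact ⟨_, fp.sq, kp, fun h => absurd h h0⟩
  obtain ⟨v, r1, e, fa, f⟩ := reach_mix hxu f0 fp fq hqp.symm (by rw [kp, kq])
      (by rw [kp]; exact ht.ne_pos) hρ (by rw [hρk, kp]) h hi haS hjS hpS hqS
  have hG'' := hG'.reach r1
  have hvm := e.not_moved (by rw [hG''.cnt_eq, hm]) hi hjS hp₀ hi₀ hj₀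
  have hvp : v.ty p₀ ≠ .pos := by
    intro hv
    have : p₀ = a := eq_of_cnt_le_one (by rw [hG''.cnt_eq, hl]) hp₀ haS hv fa.ty
    exact hya (this ▸ hyp₀)
  obtain ⟨a1, a2, a3, a4⟩ := hG''.remove_edge hy hi (Within.refl _) e (Off.refl _ _)
  have c1 := a4 t ht.ne_moved
  have c2 := a4 t' ht.symm.ne_moved
  have c3 := a4 .pos (by simp)
  have hp₀' : p₀ ∈ (S.erase i).erase j := by simp [hi₀, hj₀, hp₀]
  by_cases h0 : cnt S y t' = 0
  · have hvt : v.ty p₀ = t := by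
      rcases ht.cases (v.ty p₀) with h | h | h | h
      · exact absurd h hvm
      · exact h
      · have := one_le_cnt hp₀ h
        rw [hG''.cnt_eq] at this
        omega
      · exact absurd h hvp
    obtain ⟨b1, b2, b3, b4⟩ := a1.remove_point (hρy h0) (by simp [hpi, hpj, hpS]) (Within.refl _) f
      (Off.refl _ _)
    rw [hρk] at b3 b4
    have := b4 t' ht.ne.symm
    have := b4 .pos ht.ne_pos.symm
    have := b4 .moved ht.ne_moved.symm
    exact ((r0.1.trans r1.1).trans (within_of_fixed_of_ne ht b1 (by omega) (by omega)
      (Finset.mem_erase.2 ⟨hp.symm, hp₀'⟩) hvt hyp₀)).mono (by omega)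
  · rcases ht.cases (v.ty p₀) with h | h | h | h
    · exact absurd h hvm
    · exact ((r0.1.trans r1.1).trans (within_of_fixed_of_ne ht a1 (by omega) (by omega)
        hp₀' h hyp₀)).mono (by omega)
    · exact ((r0.1.trans r1.1).trans (within_of_fixed_of_ne ht.symm a1 (by omega) (by omega)
        hp₀' h hyp₀)).mono (by omega)
    · exact absurd h hvp

/-- The case of a single positive point. -/
lemma within_of_one_pos {t t' : Kind} (ht : t.Pair t') (N : ℕ) :
    ∀ (S : Finset (Fin n)) (x : Cfg n), S.card = N → Good S x y →
    cnt S y .pos = 1 → 2 ≤ cnt S y t → cnt S y t' ≠ 1 →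
    Within (cnt S y .moved + cnt S y t + cnt S y t' + 2 * min 1 (cnt S y t') + 1) x y := by
  induction N using Nat.strong_induction_on with
  | _ N IH =>
  rintro S x rfl hG hl h2 h2'
  by_cases h0 : cnt S y .moved = 0
  · exact (within_of_fixed ht hG h0 (by omega)).mono (by omega)
  obtain ⟨r, hr, hxr⟩ := exists_one (S := S) (x := x) (t := .pos) (by rw [hG.cnt_eq]; omega)
  have he : cnt S y .even ≠ 1 := by rcases ht with ⟨rfl, rfl⟩ | ⟨rfl, rfl⟩ <;> omega
  have ho : cnt S y .odd ≠ 1 := by rcases ht with ⟨rfl, rfl⟩ | ⟨rfl, rfl⟩ <;> omega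
  by_cases h3 : 3 ≤ cnt S y .moved
  · obtain ⟨i, hi, hyi, hir, hir'⟩ := exists_ne_ne h3 r (y.p r)
    have ey := ed_of_ty hyi
    have hj := hG.right i hi
    have hl' : cnt S x .pos ≤ 1 := by rw [hG.cnt_eq, hl]
    obtain ⟨x', h1, h2, h4⟩ := edge_step hG ey hi h3 he ho
      (fun h _ => absurd (eq_of_cnt_le_one hl' hi hr h hxr) hir)
      (fun h _ => absurd (eq_of_cnt_le_one hl' hj hr h hxr)
        (by rintro h; rw [← h, y.pp] at hir'; exact hir' rfl))
    obtain ⟨a1, a2, a3, a4⟩ := hG.remove_edge ey hi h1 h2 h4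
    have b1 := a4 t ht.ne_moved
    have b2 := a4 .pos (by simp)
    have b3 := a4 t' ht.symm.ne_moved
    exact (h1.trans (IH _ a2 _ x' rfl a1 (by omega) (by omega) (by omega))).mono (by omega)
  obtain ⟨i, hi, hyi⟩ := exists_one (S := S) (x := y) (t := .moved) (by omega)
  have ey := ed_of_ty hyi
  have hj := hG.right i hi
  have hm := two_le_cnt hi hj ey.1 ey.ty ey.symm.ty
  have hm' : cnt S y .moved = 2 := by omega
  obtain ⟨c, hc, hxc⟩ := exists_one (S := S) (x := x) (t := .moved) (by rw [hG.cnt_eq]; omega)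
  by_cases hxi : x.ty i = .moved
  · by_cases hxj : x.ty (y.p i) = .moved
    · obtain ⟨x', h1, h2, h4⟩ := edge_moved hG.left ey.1 hi hj hxi hxj (y.d i)
      obtain ⟨a1, a2, a3, a4⟩ := hG.remove_edge ey hi h1 h2 h4
      have := a4 t ht.ne_moved
      have := a4 t' ht.symm.ne_moved
      have := a4 .pos (by simp)
      exact (h1.trans (within_of_fixed ht a1 (by omega) (by omega))).mono (by omega)
    · exact (mixed ht hG (ed_of_ty hxi) ey hi hxj hm' hl h2).mono (by omega)
  by_cases hxj : x.ty (y.p i) = .moved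
  · exact (mixed ht hG (ed_of_ty hxj) ey.symm hj hxi hm' hl h2).mono (by omega)
  obtain ⟨fi, ki⟩ := fx_of_ty (x := x) (i := i) rfl hxi
  obtain ⟨fj, kj⟩ := fx_of_ty (x := x) (i := y.p i) rfl hxj
  have hneg : ∀ k ∈ S, x.ty k ≠ .moved → x.ty k ≠ .pos → ∃ b ∈ S, x.ty b = x.ty k ∧ b ≠ k := by
    intro k hk h1 h2
    have h3 := one_le_cnt hk (x := x) rfl
    refine exists_ne ?_ k
    rw [hG.cnt_eq] at h3 ⊢
    cases h4 : x.ty k <;> rw [h4] at h3 <;> simp_all <;> omega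
  have posc : ∀ {x : Cfg n} {i j b : Fin n}, (∀ i ∈ S, x.p i ∈ S) → c ∈ S → x.ty c = .moved →
      i ∈ S → j ∈ S → b ∈ S → x.ty i ≠ .moved →
      x.ty i ≠ .pos → x.ty j = .pos → x.ty b = x.ty i → b ≠ i →
      ∀ h, ∃ x', Within 2 x x' ∧ x'.Ed i j h ∧ Off S x x' := by
    intro x i j b hS hc hxc hi hj hb h1 h2 h3 hbt hbi h
    obtain ⟨f1, f2⟩ := fx_of_ty hbt h1
    obtain ⟨f3, f4⟩ := fx_of_ty (x := x) (i := i) rfl h1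
    exact edge_pos hS hi hj hb hc f3 (fx_of_pos h3) f1 hbi (by rintro rfl; exact h2 h3)
      (by rintro rfl; exact h2 (hbt ▸ h3)) (by rw [f2, f4]) hxc h
  by_cases hxi' : x.ty i = .pos <;> by_cases hxj' : x.ty (y.p i) = .pos
  · exact absurd (eq_of_cnt_le_one (by rw [hG.cnt_eq, hl]) hi hj hxi' hxj') ey.1
  · obtain ⟨b, hb, hbt, hbi⟩ := hneg _ hj hxj hxj'
    obtain ⟨x', h1, h2, h4⟩ := posc hG.left hc hxc hj hi hb hxj hxj' hxi' hbt hbi (y.d i)⁻¹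
    obtain ⟨a1, a2, a3, a4⟩ := hG.remove_edge ey.symm hj h1 h2 h4
    have := a4 t ht.ne_moved
    have := a4 t' ht.symm.ne_moved
    have := a4 .pos (by simp)
    exact (h1.trans (within_of_fixed ht a1 (by omega) (by omega))).mono (by omega)
  · obtain ⟨b, hb, hbt, hbi⟩ := hneg _ hi hxi hxi'
    obtain ⟨x', h1, h2, h4⟩ := posc hG.left hc hxc hi hj hb hxi hxi' hxj' hbt hbi (y.d i)
    obtain ⟨a1, a2, a3, a4⟩ := hG.remove_edge ey hi h1 h2 h4
    have := a4 t ht.ne_moved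
    have := a4 t' ht.symm.ne_moved
    have := a4 .pos (by simp)
    exact (h1.trans (within_of_fixed ht a1 (by omega) (by omega))).mono (by omega)
  by_cases hk : x.ty i = x.ty (y.p i)
  · obtain ⟨x', h1, h2, h4⟩ := edge_same hG.left ey.1 hi hj hc fi fj (by rw [ki, kj, hk]) hxc (y.d i)
    obtain ⟨a1, a2, a3, a4⟩ := hG.remove_edge ey hi h1 h2 h4
    have := a4 t ht.ne_moved
    have := a4 t' ht.symm.ne_moved
    have := a4 .pos (by simp)
    exact (h1.trans (within_of_fixed ht a1 (by omega) (by omega))).mono (by omega)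
  have ht' : 1 ≤ cnt S y t' := by
    rw [← hG.cnt_eq]
    rcases ht.cases (x.ty i) with h1 | h1 | h1 | h1
    · exact absurd h1 hxi
    · rcases ht.cases (x.ty (y.p i)) with h2 | h2 | h2 | h2
      · exact absurd h2 hxj
      · exact absurd (h1.trans h2.symm) hk
      · exact one_le_cnt hj h2
      · exact absurd h2 hxj'
    · exact one_le_cnt hi h1
    · exact absurd h1 hxi'
  obtain ⟨b, hb, hbt, hbi⟩ := hneg _ hi hxi hxi'
  have fb := (fx_of_ty (x := x) rfl (by rw [hbt]; exact hxi)).1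
  have fr := fx_of_pos hxr
  obtain ⟨u, r0, f0, -, o0⟩ := reach_token fj fr (by rintro h; exact hxj' (h ▸ hxr)) fj.sq rfl hj hr
  have hG' := hG.reach r0
  have hkp : ∀ k, x.ty k ≠ .pos → x.ty k ≠ x.ty (y.p i) → u.ty k = x.ty k := by
    intro k h1 h2
    have h3 := o0 k (by rintro rfl; exact h2 rfl) (by rintro rfl; exact h1 hxr)
    simp only [Cfg.ty, h3.1, h3.2]
  have ui := hkp i hxi' hk
  have ub := hkp b (by rw [hbt]; exact hxi') (by rw [hbt]; exact hk)
  obtain ⟨x', h1, h2, h4⟩ := posc hG'.left hc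
    ((hkp c (by simp [hxc]) (by rw [hxc]; exact fun h => hxj h.symm)).trans hxc) hi hj hb
    (by rw [ui]; exact hxi) (by rw [ui]; exact hxi') f0.ty (by rw [ub, ui, hbt]) hbi (y.d i)
  obtain ⟨a1, a2, a3, a4⟩ := hG'.remove_edge ey hi h1 h2 h4
  have := a4 t ht.ne_moved
  have := a4 t' ht.symm.ne_moved
  have := a4 .pos (by simp)
  exact ((r0.1.trans h1).trans (within_of_fixed ht a1 (by omega) (by omega))).mono (by omega)

/-- With one positive point, the only point of its kind is placed in three steps. -/
lemma place_single_of_one_pos {t t' : Kind} (ht : t.Pair t') (hG : Good S x y)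
    (hl : 1 ≤ cnt S y .pos) (h2 : 2 ≤ cnt S y t) {i : Fin n} (hi : i ∈ S) (hyi : y.ty i = t') :
    ∃ x', Reach S 3 x x' ∧ x'.Fx i (y.d i) := by
  have hS := hG.left
  rw [← hG.cnt_eq] at hl h2
  have hyf := (fx_of_ty hyi ht.symm.ne_moved).1
  obtain ⟨j, hj, hxj⟩ := exists_one (hG.cnt_eq t' ▸ one_le_cnt hi hyi)
  obtain ⟨r, hr, hxr⟩ := exists_one hl
  have main : ∀ {x : Cfg n} {r : Fin n}, x.ty i ≠ .moved → x.ty j = t' → r ∈ S → x.ty r = .pos →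
      ∃ x', Reach S 2 x x' ∧ x'.Fx i (y.d i) := by
    intro x r hxi hxj hr hxr
    obtain ⟨fj, kj⟩ := fx_of_ty hxj ht.symm.ne_moved
    obtain ⟨fi, -⟩ := fx_of_ty (x := x) (i := i) rfl hxi
    have fr := fx_of_pos hxr
    have hjr : j ≠ r := by rintro rfl; exact ht.symm.ne_pos (hxj.symm.trans hxr)
    by_cases hji : j = i
    · subst hji
      obtain ⟨u, r1, f1, f2, -⟩ := reach_token fj fr hjr fj.sq rfl hj hr
      obtain ⟨v, r2, -, f3, -⟩ := reach_token f2 f1 hjr.symm hyf.sq (by rw [kj, ← hyf.ty, hyi]) hr hj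
      exact ⟨v, r1.trans r2, f3⟩
    by_cases hxi' : x.ty i = .pos
    · obtain ⟨u, r1, f1, f2, -⟩ := reach_token fj (fx_of_pos hxi') hji hyf.sq
        (by rw [kj, ← hyf.ty, hyi]) hj hi
      exact ⟨u, r1.mono (by omega), f2⟩
    obtain ⟨u, r1, f1, f2, o⟩ := reach_token fi fr (by rintro rfl; exact hxi' hxr) fi.sq rfl hi hr
    obtain ⟨v, r2, -, f3, -⟩ := reach_token (show u.Fx j (x.d j) by grind [Fx]) f1 hji hyf.sq
        (by rw [kj, ← hyf.ty, hyi]) hj hi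
    exact ⟨v, r1.trans r2, f3⟩
  by_cases hxi : x.ty i = .moved
  · obtain ⟨p, hp, hxp⟩ := exists_one (S := S) (x := x) (t := t) (by omega)
    obtain ⟨q, hq, hxq, hqp⟩ := exists_ne h2 p
    have ei := ed_of_ty hxi
    obtain ⟨fp, kp⟩ := fx_of_ty hxp ht.ne_moved
    obtain ⟨fq, kq⟩ := fx_of_ty hxq ht.ne_moved
    obtain ⟨w, hw⟩ := Aff.exists_conj fp.sq fq.sq (by rw [kp, kq])
    obtain ⟨u, r1, -, f1, f2, o⟩ := reach_edge w _ ei fp fq hqp.symm hw fp.sq rfl hi (hS i hi) hp hq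
    have keep : ∀ k, x.ty k ≠ .moved → x.ty k ≠ t → u.ty k = x.ty k := by
      intro k h1 h2
      have h3 := o k (by rintro rfl; exact h1 hxi) (by rintro rfl; exact h1 ei.symm.ty)
        (by rintro rfl; exact h2 hxp) (by rintro rfl; exact h2 hxq)
      simp only [Cfg.ty, h3.1, h3.2]
    obtain ⟨v, r2, f⟩ := main (x := u) (r := r)
      (by rw [f1.ty, kp]; exact ht.ne_moved)
      ((keep j (by rw [hxj]; exact ht.symm.ne_moved) (by rw [hxj]; exact ht.ne.symm)).trans hxj) hr
      ((keep r (by simp [hxr]) (by rw [hxr]; exact ht.ne_pos.symm)).trans hxr)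
    exact ⟨v, r1.trans r2, f⟩
  · obtain ⟨v, r2, f⟩ := main hxi hxj hr hxr
    exact ⟨v, r2.mono (by omega), f⟩

lemma within_of_one_pos_of_single {t t' : Kind} (ht : t.Pair t') (hG : Good S x y)
    (hl : cnt S y .pos = 1) (h2 : 2 ≤ cnt S y t) (h1 : cnt S y t' = 1) :
    Within (cnt S y .moved + cnt S y t + 4) x y := by
  obtain ⟨i, hi, hyi⟩ := exists_one (S := S) (x := y) (t := t') (by omega)
  obtain ⟨fi, ki⟩ := fx_of_ty hyi ht.symm.ne_moved
  obtain ⟨x', r, f⟩ := place_single_of_one_pos ht hG hl.ge h2 hi hyi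
  obtain ⟨a1, a2, a3, a4⟩ := hG.remove_point fi hi r.1 f r.2
  rw [ki] at a3 a4
  have b1 := a4 .moved ht.symm.ne_moved.symm
  have b2 := a4 .pos ht.symm.ne_pos.symm
  have b3 := a4 t ht.ne
  exact (r.1.trans (within_of_one_pos ht _ _ x' rfl a1 (by omega) (by omega) (by omega))).mono
    (by omega)

end

section

variable {x y z : Cfg n} {S : Finset (Fin n)} {t t' : Kind}

lemma Good.drop_point (hG : Good S x y) (ht : t.Pair t') {i : Fin n} {a : Aff} (hx : x.Fx i a)
    (hy : y.Fx i a) (hi : i ∈ S) (hk : a.kind = t) :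
    Good (S.erase i) x y ∧ (S.erase i).card < S.card ∧
      cnt S y .moved = cnt (S.erase i) y .moved ∧ cnt S y t = cnt (S.erase i) y t + 1 ∧
      cnt S y t' = cnt (S.erase i) y t' ∧ cnt S y .pos = cnt (S.erase i) y .pos := by
  obtain ⟨a1, a2, a3, a4⟩ := hG.remove_point hy hi (Within.refl x) hx (Off.refl S x)
  rw [hk] at a3 a4
  exact ⟨a1, a2, a4 _ ht.ne_moved.symm, a3, a4 _ ht.ne.symm, a4 _ ht.ne_pos.symm⟩

lemma Good.drop_edge (hG : Good S x y) (ht : t.Pair t') {i j : Fin n} {h : Aff} (hx : x.Ed i j h)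
    (hy : y.Ed i j h) (hi : i ∈ S) :
    Good ((S.erase i).erase j) x y ∧ ((S.erase i).erase j).card < S.card ∧
      cnt S y .moved = cnt ((S.erase i).erase j) y .moved + 2 ∧
      cnt S y t = cnt ((S.erase i).erase j) y t ∧
      cnt S y t' = cnt ((S.erase i).erase j) y t' ∧
      cnt S y .pos = cnt ((S.erase i).erase j) y .pos := by
  obtain ⟨a1, a2, a3, a4⟩ := hG.remove_edge hy hi (Within.refl x) hx (Off.refl S x)
  exact ⟨a1, a2, a3, a4 _ ht.ne_moved, a4 _ ht.symm.ne_moved, a4 _ (by simp)⟩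

lemma Good.eq_of_cnt_pair (hG : Good S x y) (ht : t.Pair t') (hm : cnt S y .moved = 0)
    (h : cnt S y t = 0) (h' : cnt S y t' = 0) : y = x := by
  rcases ht with ⟨rfl, rfl⟩ | ⟨rfl, rfl⟩
  · exact hG.eq_of_cnt hm h h'
  · exact hG.eq_of_cnt hm h' h

lemma ty_of_pure (ht : t.Pair t') (h : cnt S x t' = 0) (hp : cnt S x .pos = 0) {k : Fin n}
    (hk : k ∈ S) (hm : x.ty k ≠ .moved) : x.ty k = t := by
  rcases ht.cases (x.ty k) with h1 | h1 | h1 | h1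
  · exact absurd h1 hm
  · exact h1
  · have := one_le_cnt hk h1; omega
  · have := one_le_cnt hk h1; omega

/-- A 2-cycle moves onto two fixed points, leaving prescribed labels. -/
lemma reach_swap {a b c d : Fin n} {g γ δ ρ ρ' : Aff} (w : Aff) (hab : x.Ed a b g)
    (hc : x.Fx c γ) (hd : x.Fx d δ) (hcd : c ≠ d) (hw : w * γ = δ * w) (hρ : ρ * ρ = 1)
    (hρ' : ρ' * ρ' = 1) (hk : ρ.kind = γ.kind) (hk' : ρ'.kind = γ.kind)
    (haS : a ∈ S) (hbS : b ∈ S) (hcS : c ∈ S) (hdS : d ∈ S) :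
    ∃ x' : Cfg n, Reach S 2 x x' ∧ x'.Ed c d w ∧ x'.Fx a ρ ∧ x'.Fx b ρ' ∧
      ∀ k, k ≠ a → k ≠ b → k ≠ c → k ≠ d → x'.p k = x.p k ∧ x'.d k = x.d k := by
  obtain ⟨g', h1, h2⟩ := Aff.exists_conj_sq g hρ hρ' (hk.trans hk'.symm)
  obtain ⟨u, r1, e1, o1⟩ := reach_label hab h2 haS hbS
  have hab' := hab.symm
  have e2 : u.Fx c γ := by grind [Fx, Ed]
  have e3 : u.Fx d δ := by grind [Fx, Ed]
  obtain ⟨v, r2, e4, f1, f2, o2⟩ := reach_edge w ρ e1 e2 e3 hcd hw hρ hk haS hbS hcS hdS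
  have h3 : g' * ρ * g'⁻¹ = ρ' := by rw [h1]; group
  rw [h3] at f2
  refine ⟨v, r1.trans r2, e4, f1, f2, fun k k1 k2 k3 k4 => ?_⟩
  rw [(o2 k k1 k2 k3 k4).1, (o2 k k1 k2 k3 k4).2]
  exact o1 k k1 k2

/-- A 2-cycle and two fixed points exchange places, with prescribed labels. -/
lemma reach_swap_label {a b c d : Fin n} {g γ δ ρ ρ' : Aff} (h : Aff) (hab : x.Ed a b g)
    (hc : x.Fx c γ) (hd : x.Fx d δ) (hcd : c ≠ d) (hγ : γ.kind = δ.kind) (hρ : ρ * ρ = 1)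
    (hρ' : ρ' * ρ' = 1) (hk : ρ.kind = γ.kind) (hk' : ρ'.kind = γ.kind)
    (haS : a ∈ S) (hbS : b ∈ S) (hcS : c ∈ S) (hdS : d ∈ S) :
    ∃ x' : Cfg n, Reach S 3 x x' ∧ x'.Ed c d h ∧ x'.Fx a ρ ∧ x'.Fx b ρ' ∧
      ∀ k, k ≠ a → k ≠ b → k ≠ c → k ≠ d → x'.p k = x.p k ∧ x'.d k = x.d k := by
  obtain ⟨w, h1, h2⟩ := Aff.exists_conj_sq h hc.sq hd.sq hγ
  have hab' := hab.symm
  have hcp := hc.1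
  have hdp := hd.1
  obtain ⟨u, r1, e1, f1, f2, o1⟩ := reach_swap w hab hc hd hcd h1 hρ hρ' hk hk' haS hbS hcS hdS
  have e1' := e1.symm
  obtain ⟨v, r2, e2, o2⟩ := reach_label e1 (Aff.sq_inv_mul h2) hcS hdS
  refine ⟨v, r1.trans r2, e2, by grind [Fx, Ed], by grind [Fx, Ed], fun k k1 k2 k3 k4 => ?_⟩
  rw [(o2 k k3 k4).1, (o2 k k3 k4).2]
  exact o1 k k1 k2 k3 k4

/-- A 2-cycle and two fixed points get new labels. -/
lemma reach_loop {a b c d : Fin n} {g γ δ ρ ρ' : Aff} (h : Aff) (hab : x.Ed a b g)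
    (hc : x.Fx c γ) (hd : x.Fx d δ) (hcd : c ≠ d) (hγ : γ.kind = δ.kind) (hρ : ρ * ρ = 1)
    (hρ' : ρ' * ρ' = 1) (hk : ρ.kind = γ.kind) (hk' : ρ'.kind = γ.kind)
    (haS : a ∈ S) (hbS : b ∈ S) (hcS : c ∈ S) (hdS : d ∈ S) :
    ∃ x' : Cfg n, Reach S 4 x x' ∧ x'.Ed a b h ∧ x'.Fx c ρ ∧ x'.Fx d ρ' ∧
      ∀ k, k ≠ a → k ≠ b → k ≠ c → k ≠ d → x'.p k = x.p k ∧ x'.d k = x.d k := by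
  obtain ⟨w, hw⟩ := Aff.exists_conj hc.sq hd.sq hγ
  obtain ⟨u, r1, e1, f1, f2, o1⟩ := reach_swap (ρ := γ) (ρ' := h * γ * h⁻¹) w hab hc hd hcd hw
    hc.sq (Aff.sq_conj h hc.sq) rfl (by simp) haS hbS hcS hdS
  obtain ⟨v, r2, e2, f3, f4, o2⟩ := reach_swap h e1 f1 f2 hab.1 (by group) hρ hρ'
    hk hk' hcS hdS haS hbS
  refine ⟨v, r1.trans r2, e2, f3, f4, fun k k1 k2 k3 k4 => ?_⟩
  rw [(o2 k k3 k4 k1 k2).1, (o2 k k3 k4 k1 k2).2]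
  exact o1 k k1 k2 k3 k4

/-- Two fixed points and a 2-cycle, trading places. -/
lemma pure_two_disjoint (ht : t.Pair t') (hG : Good S x y) (hm : cnt S y .moved = 2)
    (hk : cnt S y t = 2) (ht' : cnt S y t' = 0) (hp : cnt S y .pos = 0) {i a j b : Fin n}
    {g h : Aff} (hx : x.Ed i a g) (hy : y.Ed j b h) (hi : i ∈ S) (hj : j ∈ S)
    (hyi : y.ty i ≠ .moved) (hya : y.ty a ≠ .moved) : Within 3 x y := by
  have haS : a ∈ S := hx.2.1 ▸ hG.left i hi
  have hbS : b ∈ S := hy.2.1 ▸ hG.right j hj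
  have hm' : cnt S x .moved ≤ 2 := by rw [hG.cnt_eq]; omega
  have hij : i ≠ j := by rintro rfl; exact hyi hy.ty
  have hib : i ≠ b := by rintro rfl; exact hyi hy.symm.ty
  have haj : a ≠ j := by rintro rfl; exact hya hy.ty
  have hab : a ≠ b := by rintro rfl; exact hya hy.symm.ty
  have pure := fun k (hk : k ∈ S) => ty_of_pure ht ht' hp hk
  have pure' := fun k (hk : k ∈ S) => ty_of_pure (x := x) ht (by rw [hG.cnt_eq, ht'])
    (by rw [hG.cnt_eq, hp]) hk
  obtain ⟨fi, ki⟩ := fx_of_ty (pure i hi hyi) ht.ne_moved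
  obtain ⟨fa, ka⟩ := fx_of_ty (pure a haS hya) ht.ne_moved
  obtain ⟨fj, kj⟩ := fx_of_ty (pure' j hj (hx.not_moved hm' hi haS hj hij.symm haj.symm)) ht.ne_moved
  obtain ⟨fb, kb⟩ := fx_of_ty (pure' b hbS (hx.not_moved hm' hi haS hbS hib.symm hab.symm))
    ht.ne_moved
  obtain ⟨u, r, e, f1, f2, -⟩ := reach_swap_label h hx fj fb hy.1 (by rw [kj, kb]) fi.sq fa.sq
    (by rw [kj, ki]) (by rw [kj, ka]) hi haS hj hbS
  obtain ⟨a1, -, b1, b2, b3, b4⟩ := (hG.reach r).drop_edge ht e hy hj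
  obtain ⟨a2, -, c1, c2, c3, c4⟩ := a1.drop_point ht f1 fi (by simp [hi, hij, hib]) ki
  obtain ⟨a3, -, d1, d2, d3, d4⟩ := a2.drop_point ht f2 fa (by simp [haS, haj, hab, hx.1.symm]) ka
  rw [a3.eq_of_cnt_pair ht (by omega) (by omega) (by omega)]
  exact r.1

/-- Three fixed points and a 2-cycle which moves one of its ends. -/
lemma pure_three_shared (ht : t.Pair t') (hG : Good S x y) (hm : cnt S y .moved = 2)
    (hk : cnt S y t = 3) (ht' : cnt S y t' = 0) (hp : cnt S y .pos = 0) {i a j : Fin n}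
    {g h : Aff} (hx : x.Ed i a g) (hy : y.Ed i j h) (hi : i ∈ S) (haj : a ≠ j) :
    Within 4 x y := by
  have haS : a ∈ S := hx.2.1 ▸ hG.left i hi
  have hjS : j ∈ S := hy.2.1 ▸ hG.right i hi
  have hm' : cnt S x .moved ≤ 2 := by rw [hG.cnt_eq]; omega
  have pure := fun k (hk : k ∈ S) => ty_of_pure ht ht' hp hk
  have pure' := fun k (hk : k ∈ S) => ty_of_pure (x := x) ht (by rw [hG.cnt_eq, ht'])
    (by rw [hG.cnt_eq, hp]) hk
  obtain ⟨ga, la⟩ := fx_of_ty (pure a haS (hy.not_moved hm.le hi hjS haS hx.1.symm haj)) ht.ne_moved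
  obtain ⟨fj, kj⟩ := fx_of_ty (pure' j hjS (hx.not_moved hm' hi haS hjS hy.1.symm haj.symm))
    ht.ne_moved
  obtain ⟨p, hpS, hxp, hpj⟩ := exists_ne (S := S) (x := x) (t := t) (by rw [hG.cnt_eq]; omega) j
  obtain ⟨q, hqS, hxq, hqj, hqp⟩ := exists_ne_ne (S := S) (x := x) (t := t)
    (by rw [hG.cnt_eq]; omega) j p
  obtain ⟨fp, kp⟩ := fx_of_ty hxp ht.ne_moved
  obtain ⟨fq, kq⟩ := fx_of_ty hxq ht.ne_moved
  have hpi : p ≠ i := by rintro rfl; exact ht.ne_moved (hxp.symm.trans hx.ty)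
  have hqi : q ≠ i := by rintro rfl; exact ht.ne_moved (hxq.symm.trans hx.ty)
  have hpa : p ≠ a := by rintro rfl; exact ht.ne_moved (hxp.symm.trans hx.symm.ty)
  have hqa : q ≠ a := by rintro rfl; exact ht.ne_moved (hxq.symm.trans hx.symm.ty)
  obtain ⟨gp, lp⟩ := fx_of_ty (pure p hpS (hy.not_moved hm.le hi hjS hpS hpi hpj)) ht.ne_moved
  obtain ⟨gq, lq⟩ := fx_of_ty (pure q hqS (hy.not_moved hm.le hi hjS hqS hqi hqj)) ht.ne_moved
  obtain ⟨w, hw⟩ := Aff.exists_conj fp.sq fq.sq (by rw [kp, kq])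
  have hc : (h⁻¹ * x.d j * h).kind = t := by
    have := Aff.kind_conj' h⁻¹ (x.d j)
    rw [inv_inv] at this
    rw [this, kj]
  obtain ⟨u, r1, e1, f1, f2, o1⟩ := reach_swap (ρ := h⁻¹ * x.d j * h) w hx fp fq hqp.symm hw
    (by have := Aff.sq_conj h⁻¹ fj.sq; rwa [inv_inv] at this) ga.sq
    (by rw [hc, kp]) (by rw [la, kp]) hi haS hpS hqS
  have e2 : u.Fx j (x.d j) := by grind [Fx, Ed]
  obtain ⟨v, r2, e3, f3, f4, o2⟩ := reach_swap h e1 f1 e2 hy.1 (by group) gp.sq gq.sq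
    (by rw [hc, lp]) (by rw [hc, lq]) hpS hqS hi hjS
  have r := r1.trans r2
  obtain ⟨a1, -, b1, b2, b3, b4⟩ := (hG.reach r).drop_edge ht e3 hy hi
  obtain ⟨a2, -, c1, c2, c3, c4⟩ := a1.drop_point ht f3 gp (by simp [hpi, hpj, hpS]) lp
  obtain ⟨a3, -, d1, d2, d3, d4⟩ := a2.drop_point ht f4 gq (by simp [hqi, hqj, hqp, hqS]) lq
  obtain ⟨a4, -, e1, e2, e3, e4⟩ := a3.drop_point ht (show v.Fx a (y.d a) by grind [Fx, Ed]) ga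
    (by simp [haS, haj, hx.1.symm, hpa.symm, hqa.symm]) la
  rw [a4.eq_of_cnt_pair ht (by omega) (by omega) (by omega)]
  exact r.1

lemma pure_of_ne (ht : t.Pair t') (N : ℕ) : ∀ (S : Finset (Fin n)) (x : Cfg n), S.card = N →
    Good S x y → cnt S y .moved = 2 → 3 ≤ cnt S y t → cnt S y t' = 0 → cnt S y .pos = 0 →
    (∃ i ∈ S, x.ty i = .moved ∧ y.ty i ≠ .moved) → Within (cnt S y t + 2) x y := by
  induction N using Nat.strong_induction_on with
  | _ N IH =>
  rintro S x rfl hG hm hk ht' hp ⟨i, hi, hxi, hyi⟩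
  have ei := ed_of_ty hxi
  have ha := hG.left i hi
  have hm' : cnt S x .moved ≤ 2 := by rw [hG.cnt_eq]; omega
  obtain ⟨j, hj, hyj⟩ := exists_one (S := S) (x := y) (t := .moved) (by omega)
  have hyj := ed_of_ty hyj
  have hj' := hG.right j hj
  have pure := fun k (hk : k ∈ S) => ty_of_pure ht ht' hp hk
  obtain ⟨fi, ki⟩ := fx_of_ty (pure i hi hyi) ht.ne_moved
  by_cases h4 : 4 ≤ cnt S y t
  · obtain ⟨b, hb, hxb, hbj, hbj'⟩ := exists_ne_ne (S := S) (x := x) (t := t)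
      (by rw [hG.cnt_eq]; omega) j (y.p j)
    obtain ⟨c, hc, hxc, hcb⟩ := exists_ne (S := S) (x := x) (t := t) (by rw [hG.cnt_eq]; omega) b
    obtain ⟨fb, kb⟩ := fx_of_ty hxb ht.ne_moved
    obtain ⟨fc, kc⟩ := fx_of_ty hxc ht.ne_moved
    obtain ⟨w, hw⟩ := Aff.exists_conj fb.sq fc.sq (by rw [kb, kc])
    obtain ⟨u, r, e, f, -⟩ := reach_edge w (y.d i) ei fb fc hcb.symm hw fi.sq (by rw [ki, kb]) hi ha
      hb hc
    have hbi : b ≠ i := by rintro rfl; exact ht.ne_moved (hxb.symm.trans hxi)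
    obtain ⟨a1, a2, b1, b2, b3, b4⟩ := (hG.reach r).drop_point ht f fi hi ki
    exact (r.1.trans (IH _ a2 _ u rfl a1 (by omega) (by omega) (by omega) (by omega)
      ⟨b, by simp [hbi, hb], e.ty, hyj.not_moved hm.le hj hj' hb hbj hbj'⟩)).mono (by omega)
  by_cases hya : y.ty (x.p i) = .moved
  · refine (pure_three_shared ht hG hm (by omega) ht' hp ei.symm (ed_of_ty hya) ha ?_).mono
      (by omega)
    rintro h
    exact hyi (h ▸ (ed_of_ty hya).symm.ty)
  · have hij : j ≠ i := by rintro rfl; exact hyi hyj.ty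
    have haj : j ≠ x.p i := by rintro h; exact hya (h ▸ hyj.ty)
    have hxj := ty_of_pure (x := x) ht (by rw [hG.cnt_eq, ht'])
      (by rw [hG.cnt_eq, hp]) hj (ei.not_moved hm' hi ha hj hij haj)
    obtain ⟨q, hq, hxq, hqj, hqj'⟩ := exists_ne_ne (S := S) (x := x) (t := t)
      (by rw [hG.cnt_eq]; omega) j (y.p j)
    obtain ⟨fj, kj⟩ := fx_of_ty hxj ht.ne_moved
    obtain ⟨fq, kq⟩ := fx_of_ty hxq ht.ne_moved
    obtain ⟨w, hw⟩ := Aff.exists_conj fj.sq fq.sq (by rw [kj, kq])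
    obtain ⟨u, r, e, -⟩ := reach_edge w _ ei fj fq hqj.symm hw fj.sq rfl hi ha hj hq
    exact (r.1.trans (pure_three_shared ht (hG.reach r) hm (by omega) ht' hp e hyj hj hqj')).mono
      (by omega)

lemma exists_leave (hG : Good S x y) (ht : t.Pair t') (h : 2 ≤ cnt S y t)
    (hm : cnt S y .moved = 2) {i : Fin n} (hi : i ∈ S) (hxi : x.ty i = .moved)
    (hyi : y.ty i = .moved) (hya : y.ty (x.p i) = .moved) :
    ∃ u, Reach S 1 x u ∧ ∃ i ∈ S, u.ty i = .moved ∧ y.ty i ≠ .moved := by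
  obtain ⟨p, hp, hxp⟩ := exists_one (S := S) (x := x) (t := t) (by rw [hG.cnt_eq]; omega)
  obtain ⟨q, hq, hxq, hqp⟩ := exists_ne (S := S) (x := x) (t := t) (by rw [hG.cnt_eq]; omega) p
  obtain ⟨fp, kp⟩ := fx_of_ty hxp ht.ne_moved
  obtain ⟨fq, kq⟩ := fx_of_ty hxq ht.ne_moved
  obtain ⟨w, hw⟩ := Aff.exists_conj fp.sq fq.sq (by rw [kp, kq])
  have ei := ed_of_ty hxi
  have ha := hG.left i hi
  obtain ⟨u, r, e, -⟩ := reach_edge w _ ei fp fq hqp.symm hw fp.sq rfl hi ha hp hq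
  refine ⟨u, r, p, hp, e.ty, fun hyp => ?_⟩
  have := three_le_cnt hp hi ha (by rintro rfl; exact ht.ne_moved (hxp.symm.trans hxi))
    (by rintro h; exact ht.ne_moved (hxp.symm.trans (h ▸ ei.symm.ty))) ei.1 hyp hyi hya
  omega

lemma within_of_leave (hG : Good S x y) (ht : t.Pair t') (h : 2 ≤ cnt S y t)
    (hm : cnt S y .moved = 2) {k : ℕ} (H : ∀ u : Cfg n, Good S u y →
      (∃ i ∈ S, u.ty i = .moved ∧ y.ty i ≠ .moved) → Within k u y) : Within (k + 1) x y := by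
  obtain ⟨i, hi, hxi⟩ := exists_one (S := S) (x := x) (t := .moved) (by rw [hG.cnt_eq]; omega)
  by_cases hyi : y.ty i = .moved
  · by_cases hya : y.ty (x.p i) = .moved
    · obtain ⟨u, r, hu⟩ := exists_leave hG ht h hm hi hxi hyi hya
      exact (r.1.trans (H u (hG.reach r) hu)).mono (by omega)
    · exact (H x hG ⟨_, hG.left i hi, (ed_of_ty hxi).symm.ty, hya⟩).mono (by omega)
  · exact (H x hG ⟨i, hi, hxi, hyi⟩).mono (by omega)

lemma pure_three (ht : t.Pair t') (hG : Good S x y) (hm : cnt S y .moved = 2)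
    (hk : 3 ≤ cnt S y t) (ht' : cnt S y t' = 0) (hp : cnt S y .pos = 0) :
    Within (cnt S y t + 3) x y :=
  within_of_leave hG ht (by omega) hm fun u hu hne => pure_of_ne ht _ S u rfl hu hm hk ht' hp hne

end

section

variable {x y z : Cfg n} {S : Finset (Fin n)} {t t' : Kind}

lemma ty_cases (ht : t.Pair t') (hp : cnt S x .pos = 0) {k : Fin n} (hk : k ∈ S) :
    x.ty k = .moved ∨ x.ty k = t ∨ x.ty k = t' := by
  rcases ht.cases (x.ty k) with h | h | h | h
  · exact .inl h
  · exact .inr (.inl h)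
  · exact .inr (.inr h)
  · have := one_le_cnt hk h; omega

lemma eq_or_eq_of_cnt_le_two {u : Kind} (h : cnt S x u ≤ 2) {i j k : Fin n} (hi : i ∈ S)
    (hj : j ∈ S) (hk : k ∈ S) (hij : i ≠ j) (hxi : x.ty i = u) (hxj : x.ty j = u)
    (hxk : x.ty k = u) : k = i ∨ k = j := by
  by_contra! hc
  have := three_le_cnt hi hj hk hij hc.1.symm hc.2.symm hxi hxj hxk
  omega

/-- The only two points of type `t'` are in place, but the 2-cycle is not. -/
lemma within_of_two_fixed_of_ne (ht : t.Pair t') (hG : Good S x y) (hm : cnt S y .moved = 2)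
    (hk : 3 ≤ cnt S y t) (ht' : cnt S y t' = 2) (hp : cnt S y .pos = 0) {p q : Fin n}
    {α β : Aff} (hpq : p ≠ q) (hxp : x.Fx p α) (hyp : y.Fx p α) (hα : α.kind = t')
    (hxq : x.Fx q β) (hyq : y.Fx q β) (hβ : β.kind = t') (hpS : p ∈ S) (hqS : q ∈ S)
    (hne : ∃ i ∈ S, x.ty i = .moved ∧ y.ty i ≠ .moved) : Within (cnt S y t + 2) x y := by
  obtain ⟨a1, -, b1, b2, b3, b4⟩ := hG.drop_point ht.symm hxp hyp hpS hα
  obtain ⟨a2, -, c1, c2, c3, c4⟩ := a1.drop_point ht.symm hxq hyq (by simp [hqS, hpq.symm]) hβ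
  obtain ⟨i, hi, hxi, hyi⟩ := hne
  have h1 := ht.symm.ne_moved
  have h2 := hxp.ty
  have h3 := hxq.ty
  refine (pure_of_ne ht _ _ x rfl a2 (by omega) (by omega) (by omega) (by omega)
    ⟨i, by grind, hxi, hyi⟩).mono (by omega)

/-- The only two points of type `t'` are in place. -/
lemma within_of_two_fixed (ht : t.Pair t') (hG : Good S x y) (hm : cnt S y .moved = 2)
    (hk : 3 ≤ cnt S y t) (ht' : cnt S y t' = 2) (hp : cnt S y .pos = 0) {p q : Fin n}
    {α β : Aff} (hpq : p ≠ q) (hxp : x.Fx p α) (hyp : y.Fx p α) (hα : α.kind = t')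
    (hxq : x.Fx q β) (hyq : y.Fx q β) (hβ : β.kind = t') (hpS : p ∈ S) (hqS : q ∈ S) :
    Within (cnt S y t + 3) x y := by
  obtain ⟨a1, -, b1, b2, b3, b4⟩ := hG.drop_point ht.symm hxp hyp hpS hα
  obtain ⟨a2, -, c1, c2, c3, c4⟩ := a1.drop_point ht.symm hxq hyq (by simp [hqS, hpq.symm]) hβ
  exact (pure_three ht a2 (by omega) (by omega) (by omega) (by omega)).mono (by omega)

/-- The 2-cycle of `x` moves the two points that are of type `t'` in `y`. -/
lemma two_two_of_moved (ht : t.Pair t') (hG : Good S x y) (hm : cnt S y .moved = 2)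
    (hk : 3 ≤ cnt S y t) (ht' : cnt S y t' = 2) (hp : cnt S y .pos = 0) {a b : Fin n}
    {g : Aff} (hab : x.Ed a b g) (ha : a ∈ S) (hya : y.ty a = t') (hyb : y.ty b = t') :
    Within (cnt S y t + 5) x y := by
  have hb : b ∈ S := hab.2.1 ▸ hG.left a ha
  obtain ⟨c, hc, hxc⟩ := exists_one (S := S) (x := x) (t := t') (by rw [hG.cnt_eq]; omega)
  obtain ⟨d, hd, hxd, hdc⟩ := exists_ne (S := S) (x := x) (t := t') (by rw [hG.cnt_eq]; omega) c
  obtain ⟨fc, kc⟩ := fx_of_ty hxc ht.symm.ne_moved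
  obtain ⟨fd, kd⟩ := fx_of_ty hxd ht.symm.ne_moved
  obtain ⟨fa, ka⟩ := fx_of_ty hya ht.symm.ne_moved
  obtain ⟨fb, kb⟩ := fx_of_ty hyb ht.symm.ne_moved
  obtain ⟨w, hw⟩ := Aff.exists_conj fc.sq fd.sq (by rw [kc, kd])
  obtain ⟨u, r, e, f1, f2, -⟩ := reach_swap w hab fc fd hdc.symm hw fa.sq fb.sq (by rw [ka, kc])
    (by rw [kb, kc]) ha hb hc hd
  exact (r.1.trans (within_of_two_fixed ht (hG.reach r) hm hk ht' hp hab.1 f1 fa ka f2 fb kb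
    ha hb)).mono (by omega)

/-- The points of type `t'` are the same for `x` and `y`. -/
lemma two_two_of_same (ht : t.Pair t') (hG : Good S x y) (hm : cnt S y .moved = 2)
    (hk : 3 ≤ cnt S y t) (ht' : cnt S y t' = 2) (hp : cnt S y .pos = 0) {c d : Fin n}
    (hcd : c ≠ d) (hc : c ∈ S) (hd : d ∈ S) (hxc : x.ty c = t') (hxd : x.ty d = t')
    (hyc : y.ty c = t') (hyd : y.ty d = t')
    (hne : ∃ i ∈ S, x.ty i = .moved ∧ y.ty i ≠ .moved) : Within (cnt S y t + 5) x y := by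
  obtain ⟨a, ha, hxa, hya⟩ := hne
  have hab := ed_of_ty hxa
  have hb := hG.left a ha
  obtain ⟨fc, kc⟩ := fx_of_ty hxc ht.symm.ne_moved
  obtain ⟨fd, kd⟩ := fx_of_ty hxd ht.symm.ne_moved
  obtain ⟨gc, lc⟩ := fx_of_ty hyc ht.symm.ne_moved
  obtain ⟨gd, ld⟩ := fx_of_ty hyd ht.symm.ne_moved
  obtain ⟨w, hw⟩ := Aff.exists_conj fc.sq fd.sq (by rw [kc, kd])
  obtain ⟨u, r1, e1, f1, f2, -⟩ := reach_edge w _ hab fc fd hcd hw fc.sq rfl ha hb hc hd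
  obtain ⟨v, r2, e2, f3, f4, -⟩ := reach_swap (x.d a) e1 f1 f2 hab.1 (by group) gc.sq gd.sq
    (by rw [lc, kc]) (by rw [ld, kc]) hc hd ha hb
  have r := r1.trans r2
  exact (r.1.trans (within_of_two_fixed_of_ne ht (hG.reach r) hm hk ht' hp hcd f3 gc lc f4 gd ld
    hc hd ⟨a, ha, e2.ty, hya⟩)).mono (by omega)

/-- The points of type `t'` are different for `x` and `y`. -/
lemma two_two_of_disjoint (ht : t.Pair t') (hG : Good S x y) (hm : cnt S y .moved = 2)
    (hk : 3 ≤ cnt S y t) (ht' : cnt S y t' = 2) (hp : cnt S y .pos = 0) {c d p q : Fin n}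
    (hcd : c ≠ d) (hc : c ∈ S) (hd : d ∈ S) (hxc : x.ty c = t') (hxd : x.ty d = t')
    (hpq : p ≠ q) (hpS : p ∈ S) (hqS : q ∈ S) (hyp : y.ty p = t') (hyq : y.ty q = t')
    (hxp : x.ty p ≠ t') (hxq : x.ty q ≠ t') : Within (cnt S y t + 5) x y := by
  obtain ⟨fc, kc⟩ := fx_of_ty hxc ht.symm.ne_moved
  obtain ⟨fd, kd⟩ := fx_of_ty hxd ht.symm.ne_moved
  obtain ⟨gp, lp⟩ := fx_of_ty hyp ht.symm.ne_moved
  obtain ⟨gq, lq⟩ := fx_of_ty hyq ht.symm.ne_moved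
  have h1 := ht.ne_moved
  have h2 := ht.symm.ne_moved
  have h3 := ht.ne
  have hp' : cnt S x .pos = 0 := by rw [hG.cnt_eq, hp]
  by_cases hT : y.ty c = .moved ∧ y.ty d = .moved
  · have hG' := hG.symm
    have := two_two_of_moved ht hG' (by rwa [hG.cnt_eq]) (by rwa [hG.cnt_eq]) (by rwa [hG.cnt_eq])
      hp' (ed_of_ty hT.1) hc hxc (by
        have := (ed_of_ty hT.1).eq_of_moved hm.le hc (hG.right c hc) hd hT.2
        rcases this with h | h
        · exact absurd h hcd.symm
        · exact h ▸ hxd)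
    rw [hG.cnt_eq] at this
    exact this.symm
  have hne : ∀ {u : Cfg n}, u.ty c = .moved → u.ty d = .moved →
      ∃ i ∈ S, u.ty i = .moved ∧ y.ty i ≠ .moved := by grind
  obtain ⟨a, ha, hxa⟩ := exists_one (S := S) (x := x) (t := .moved) (by rw [hG.cnt_eq]; omega)
  have hab := ed_of_ty hxa
  have hb := hG.left a ha
  have hxb := hab.symm.ty
  have single : ∀ {p q : Fin n}, p ∈ S → q ∈ S → p ≠ q → y.ty p = t' → y.ty q = t' →
      x.ty p = .moved → x.ty q = t → Within (cnt S y t + 5) x y := by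
    intro p q hpS hqS hpq hyp hyq hxp hxq
    obtain ⟨gp, lp⟩ := fx_of_ty hyp ht.symm.ne_moved
    obtain ⟨gq, lq⟩ := fx_of_ty hyq ht.symm.ne_moved
    obtain ⟨fq, kq⟩ := fx_of_ty hxq h1
    have epb := ed_of_ty hxp
    have hb := hG.left p hpS
    have hxb := epb.symm.ty
    obtain ⟨e, he, hxe, heq⟩ := exists_ne (S := S) (x := x) (t := t)
      (by rw [hG.cnt_eq]; omega) q
    obtain ⟨e', he', hxe', heq', hee'⟩ := exists_ne_ne (S := S) (x := x) (t := t)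
      (by rw [hG.cnt_eq]; omega) q e
    obtain ⟨fe, ke⟩ := fx_of_ty hxe h1
    obtain ⟨fe', ke'⟩ := fx_of_ty hxe' h1
    obtain ⟨v, hv⟩ := Aff.exists_conj fe.sq fe'.sq (by rw [ke, ke'])
    obtain ⟨w, hw⟩ := Aff.exists_conj gp.sq gq.sq (by rw [lp, lq])
    obtain ⟨s, hs⟩ := Aff.exists_conj fc.sq fd.sq (by rw [kc, kd])
    obtain ⟨u1, r1, e1, f1, -, o1⟩ := reach_edge v (w⁻¹ * x.d q * w⁻¹⁻¹) epb fe fe' hee'.symm hv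
      (Aff.sq_conj _ fq.sq) (by rw [Aff.kind_conj', kq, ke]) hpS hb he he'
    have f2 : u1.Fx q (x.d q) := by grind [Fx, Ed]
    have f3 : u1.Fx c (x.d c) := by grind [Fx, Ed]
    have f4 : u1.Fx d (x.d d) := by grind [Fx, Ed]
    obtain ⟨u2, r2, e2, -, -, o2⟩ := reach_edge w _ e1 f1 f2 hpq (by group) f1.sq rfl he he' hpS hqS
    have f5 : u2.Fx c (x.d c) := by grind [Fx, Ed]
    have f6 : u2.Fx d (x.d d) := by grind [Fx, Ed]
    obtain ⟨u3, r3, e3, f7, f8, -⟩ := reach_edge s (y.d p) e2 f5 f6 hcd hs gp.sq (by rw [lp, kc])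
      hpS hqS hc hd
    have : w * y.d p * w⁻¹ = y.d q := by rw [hw]; group
    rw [this] at f8
    have r := (r1.trans r2).trans r3
    exact (r.1.trans (within_of_two_fixed_of_ne ht (hG.reach r) hm hk ht' hp hpq f7 gp lp f8 gq lq
      hpS hqS (hne e3.ty e3.symm.ty))).mono (by omega)
  rcases ty_cases ht hp' hpS with h | h | h <;> rcases ty_cases ht hp' hqS with h' | h' | h' <;>
    try contradiction
  · have := (ed_of_ty h).eq_of_moved (by rw [hG.cnt_eq]; omega) hpS (hG.left p hpS) hqS h'
    exact two_two_of_moved ht hG hm hk ht' hp (ed_of_ty h) hpS hyp (by grind)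
  · exact single hpS hqS hpq hyp hyq h h'
  · exact single hqS hpS hpq.symm hyq hyp h' h
  · obtain ⟨fp, kp⟩ := fx_of_ty h h1
    obtain ⟨fq, kq⟩ := fx_of_ty h' h1
    obtain ⟨w, hw⟩ := Aff.exists_conj fp.sq fq.sq (by rw [kp, kq])
    obtain ⟨s, hs⟩ := Aff.exists_conj fc.sq fd.sq (by rw [kc, kd])
    obtain ⟨u1, r1, e1, -, -, o1⟩ := reach_edge w _ hab fp fq hpq hw fp.sq rfl ha hb hpS hqS
    have f3 : u1.Fx c (x.d c) := by grind [Fx, Ed]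
    have f4 : u1.Fx d (x.d d) := by grind [Fx, Ed]
    obtain ⟨u2, r2, e2, f5, f6, -⟩ := reach_swap s e1 f3 f4 hcd hs gp.sq gq.sq
      (by rw [lp, kc]) (by rw [lq, kc]) hpS hqS hc hd
    have r := r1.trans r2
    exact (r.1.trans (within_of_two_fixed_of_ne ht (hG.reach r) hm hk ht' hp hpq f5 gp lp f6 gq lq
      hpS hqS (hne e2.ty e2.symm.ty))).mono (by omega)

end

section

variable {x y z : Cfg n} {S : Finset (Fin n)} {t t' : Kind}

/-- A 2-cycle makes a round trip over three pairs of fixed points, which turns a point of one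
kind into a point of the other. -/
lemma reach_relay {a b o o' p r r' : Fin n} {g γ δ κ κ₁ κ₂ α β ρ : Aff} (hab : x.Ed a b g)
    (fo : x.Fx o γ) (fo' : x.Fx o' δ) (fp : x.Fx p κ) (fr : x.Fx r κ₁) (fr' : x.Fx r' κ₂)
    (hoo' : o ≠ o') (hpr : p ≠ r) (hpr' : p ≠ r') (hrr' : r ≠ r') (hδ : γ.kind = δ.kind)
    (h₁ : κ₁.kind = κ.kind) (h₂ : κ₂.kind = κ.kind) (hκ : κ.kind ≠ γ.kind) (hα : α * α = 1)
    (hβ : β * β = 1) (hρ : ρ * ρ = 1) (kα : α.kind = γ.kind) (kβ : β.kind = γ.kind)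
    (kρ : ρ.kind = κ.kind) (haS : a ∈ S) (hbS : b ∈ S) (hoS : o ∈ S) (hoS' : o' ∈ S)
    (hpS : p ∈ S) (hrS : r ∈ S) (hrS' : r' ∈ S) :
    ∃ x' : Cfg n, Reach S 4 x x' ∧ x'.Ed a b g ∧ x'.Fx o α ∧ x'.Fx p β ∧ x'.Fx r ρ := by
  have t1 := fo.ty
  have t2 := fo'.ty
  have t3 := fp.ty
  have t4 := fr.ty
  have t5 := fr'.ty
  obtain ⟨u, hu⟩ := Aff.exists_conj fo.sq fo'.sq hδ
  obtain ⟨v, hv⟩ := Aff.exists_conj fr.sq fr'.sq (by rw [h₁, h₂])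
  obtain ⟨w, hw⟩ := Aff.exists_conj hα hβ (by rw [kα, kβ])
  have hop : o ≠ p := by grind
  have hor : o ≠ r := by grind
  have hor' : o ≠ r' := by grind
  have hpo' : p ≠ o' := by grind
  have hro' : r ≠ o' := by grind
  have hro'' : r' ≠ o' := by grind
  have hab' := hab.symm
  obtain ⟨u1, r1, e1, f1, f2, o1⟩ := reach_edge u γ hab fo fo' hoo' hu fo.sq rfl haS hbS hoS hoS'
  have fr1 : u1.Fx r κ₁ := by grind [Fx, Ed]
  have fr1' : u1.Fx r' κ₂ := by grind [Fx, Ed]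
  have fp1 : u1.Fx p κ := by grind [Fx, Ed]
  obtain ⟨u2, r2, e2, f3, f4, o2⟩ := reach_edge v (w⁻¹ * κ * w⁻¹⁻¹) e1 fr1 fr1' hrr' hv
    (Aff.sq_conj _ fp.sq) (by rw [Aff.kind_conj', h₁]) hoS hoS' hrS hrS'
  have fp2 : u2.Fx p κ := by grind [Fx, Ed]
  have f5 : u2.Fx a γ := by grind [Fx, Ed]
  have f6 : u2.Fx b (g * γ * g⁻¹) := by grind [Fx, Ed]
  obtain ⟨u3, r3, e3, f7, -, o3⟩ := reach_edge w ρ e2 f3 fp2 hop (by group) hρ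
    (by rw [Aff.kind_conj', kρ]) hrS hrS' hoS hpS
  have f8 : u3.Fx a γ := by grind [Fx, Ed]
  have f9 : u3.Fx b (g * γ * g⁻¹) := by grind [Fx, Ed]
  obtain ⟨u4, r4, e4, f10, f11, o4⟩ := reach_edge g α e3 f8 f9 hab.1 (by group) hα kα hoS hpS haS hbS
  have : w * α * w⁻¹ = β := by rw [hw]; group
  rw [this] at f11
  exact ⟨u4, ((r1.trans r2).trans r3).trans r4, e4, f10, f11, by grind [Fx, Ed]⟩

/-- A variant of `reach_relay` which prescribes the label of another point. -/
lemma reach_relay' {a b o o' p r r' : Fin n} {g γ δ κ κ₁ κ₂ α β η : Aff} (hab : x.Ed a b g)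
    (fo : x.Fx o γ) (fo' : x.Fx o' δ) (fp : x.Fx p κ) (fr : x.Fx r κ₁) (fr' : x.Fx r' κ₂)
    (hoo' : o ≠ o') (hpr : p ≠ r) (hpr' : p ≠ r') (hrr' : r ≠ r') (hδ : γ.kind = δ.kind)
    (h₁ : κ₁.kind = κ.kind) (h₂ : κ₂.kind = κ.kind) (hκ : κ.kind ≠ γ.kind) (hα : α * α = 1)
    (hβ : β * β = 1) (hη : η * η = 1) (kα : α.kind = γ.kind) (kβ : β.kind = γ.kind)
    (kη : η.kind = κ.kind) (haS : a ∈ S) (hbS : b ∈ S) (hoS : o ∈ S) (hoS' : o' ∈ S)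
    (hpS : p ∈ S) (hrS : r ∈ S) (hrS' : r' ∈ S) :
    ∃ x' : Cfg n, Reach S 5 x x' ∧ x'.Ed a b g ∧ x'.Fx o α ∧ x'.Fx p β ∧ x'.Fx o' η := by
  have t1 := fo.ty
  have t2 := fo'.ty
  have t3 := fp.ty
  have t4 := fr.ty
  have t5 := fr'.ty
  obtain ⟨u, hu⟩ := Aff.exists_conj fo.sq fo'.sq hδ
  obtain ⟨v, hv⟩ := Aff.exists_conj fr.sq fr'.sq (by rw [h₁, h₂])
  obtain ⟨w, hw⟩ := Aff.exists_conj hα hβ (by rw [kα, kβ])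
  have hop : o ≠ p := by grind
  have hor : o ≠ r := by grind
  have hor' : o ≠ r' := by grind
  have hpo' : p ≠ o' := by grind
  have hro' : r ≠ o' := by grind
  have hro'' : r' ≠ o' := by grind
  have hab' := hab.symm
  obtain ⟨u1, r1, e1, f1, f2, o1⟩ := reach_edge u γ hab fo fo' hoo' hu fo.sq rfl haS hbS hoS hoS'
  have fr1 : u1.Fx r κ₁ := by grind [Fx, Ed]
  have fr1' : u1.Fx r' κ₂ := by grind [Fx, Ed]
  have fp1 : u1.Fx p κ := by grind [Fx, Ed]
  obtain ⟨u2, r2, e2, f3, f4, o2⟩ := reach_swap (ρ := w⁻¹ * κ * w⁻¹⁻¹) v e1 fr1 fr1' hrr' hv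
    (Aff.sq_conj _ fp.sq) hη (by rw [Aff.kind_conj', h₁]) (by rw [kη, h₁]) hoS hoS' hrS hrS'
  have fp2 : u2.Fx p κ := by grind [Fx, Ed]
  have f5 : u2.Fx a γ := by grind [Fx, Ed]
  have f6 : u2.Fx b (g * γ * g⁻¹) := by grind [Fx, Ed]
  obtain ⟨u3, r3, e3, -, -, o3⟩ := reach_edge w _ e2 f3 fp2 hop (by group) f3.sq rfl
    hrS hrS' hoS hpS
  have f8 : u3.Fx a γ := by grind [Fx, Ed]
  have f9 : u3.Fx b (g * γ * g⁻¹) := by grind [Fx, Ed]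
  have f7 : u3.Fx o' η := by grind [Fx, Ed]
  obtain ⟨u4, r4, e4, f10, f11, o4⟩ := reach_edge g α e3 f8 f9 hab.1 (by group) hα kα hoS hpS haS hbS
  have : w * α * w⁻¹ = β := by rw [hw]; group
  rw [this] at f11
  exact ⟨u4, ((r1.trans r2).trans r3).trans r4, e4, f10, f11, by grind [Fx, Ed]⟩

section

variable {o o' p : Fin n}

lemma two_two_of_shared (ht : t.Pair t') (hG : Good S x y) (hm : cnt S y .moved = 2)
    (hk : cnt S y t = 3) (ht' : cnt S y t' = 2) (hp : cnt S y .pos = 0) (hoo' : o ≠ o')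
    (hop : o ≠ p) (ho : o ∈ S) (ho' : o' ∈ S) (hpS : p ∈ S) (hxo : x.ty o = t')
    (hxo' : x.ty o' = t') (hyo : y.ty o = t') (hyp : y.ty p = t') (hxp : x.ty p = t)
    {i a j : Fin n} {g h : Aff} (hx : x.Ed i a g) (hy : y.Ed i j h) (hi : i ∈ S) (haj : a ≠ j) :
    Within 8 x y := by
  have h1 := ht.ne_moved
  have h2 := ht.symm.ne_moved
  have haS : a ∈ S := hx.2.1 ▸ hG.left i hi
  have hxi := hx.ty
  have hxa := hx.symm.ty
  obtain ⟨r, hr, hxr, hrp⟩ := exists_ne (S := S) (x := x) (t := t) (by rw [hG.cnt_eq]; omega) p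
  obtain ⟨r', hr', hxr', hrp', hrr'⟩ := exists_ne_ne (S := S) (x := x) (t := t)
    (by rw [hG.cnt_eq]; omega) p r
  obtain ⟨fo, ko⟩ := fx_of_ty hxo h2
  obtain ⟨fo', ko'⟩ := fx_of_ty hxo' h2
  obtain ⟨fp, kp⟩ := fx_of_ty hxp h1
  obtain ⟨fr, kr⟩ := fx_of_ty hxr h1
  obtain ⟨fr', kr'⟩ := fx_of_ty hxr' h1
  obtain ⟨go, lo⟩ := fx_of_ty hyo h2
  obtain ⟨gp, lp⟩ := fx_of_ty hyp h2
  obtain ⟨u, r, e, f1, f2, -⟩ := reach_relay hx fo fo' fp fr fr' hoo' hrp.symm hrp'.symm hrr'.symm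
    (by rw [ko, ko']) (by rw [kr, kp]) (by rw [kr', kp]) (by rw [ko, kp]; exact ht.ne) go.sq gp.sq
    fr.sq (by rw [lo, ko]) (by rw [lp, ko]) (by rw [kr, kp]) hi haS ho ho' hpS hr hr'
  obtain ⟨a1, -, b1, b2, b3, b4⟩ := (hG.reach r).drop_point ht.symm f1 go ho lo
  obtain ⟨a2, -, c1, c2, c3, c4⟩ := a1.drop_point ht.symm f2 gp (by grind) lp
  exact r.1.trans (pure_three_shared ht a2 (by omega) (by omega) (by omega) (by omega) e hy
    (by grind) haj)

lemma two_two_of_disjoint_of_ty (ht : t.Pair t') (hG : Good S x y) (hm : cnt S y .moved = 2)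
    (hk : cnt S y t = 3) (ht' : cnt S y t' = 2) (hp : cnt S y .pos = 0) (hoo' : o ≠ o')
    (hop : o ≠ p) (ho : o ∈ S) (ho' : o' ∈ S) (hpS : p ∈ S) (hxo : x.ty o = t')
    (hxo' : x.ty o' = t') (hyo : y.ty o = t') (hyp : y.ty p = t') (hxp : x.ty p = t)
    (hyo' : y.ty o' = t) (hd : ∀ i ∈ S, x.ty i = .moved → y.ty i ≠ .moved) :
    Within 8 x y := by
  have h1 := ht.ne_moved
  have h2 := ht.symm.ne_moved
  have h3 := ht.ne
  obtain ⟨a, ha, hxa⟩ := exists_one (S := S) (x := x) (t := .moved) (by rw [hG.cnt_eq]; omega)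
  obtain ⟨s, hs, hys⟩ := exists_one (S := S) (x := y) (t := .moved) (by omega)
  have hx := ed_of_ty hxa
  have hy := ed_of_ty hys
  have hys' := hy.symm.ty
  have hs' := hG.right s hs
  have hb := hG.left a ha
  have hxb := hx.symm.ty
  obtain ⟨r, hr, hxr, hrp⟩ := exists_ne (S := S) (x := x) (t := t) (by rw [hG.cnt_eq]; omega) p
  obtain ⟨r', hr', hxr', hrp', hrr'⟩ := exists_ne_ne (S := S) (x := x) (t := t)
    (by rw [hG.cnt_eq]; omega) p r
  obtain ⟨fo, ko⟩ := fx_of_ty hxo h2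
  obtain ⟨fo', ko'⟩ := fx_of_ty hxo' h2
  obtain ⟨fp, kp⟩ := fx_of_ty hxp h1
  obtain ⟨fr, kr⟩ := fx_of_ty hxr h1
  obtain ⟨fr', kr'⟩ := fx_of_ty hxr' h1
  obtain ⟨go, lo⟩ := fx_of_ty hyo h2
  obtain ⟨go', lo'⟩ := fx_of_ty hyo' h1
  obtain ⟨gp, lp⟩ := fx_of_ty hyp h2
  obtain ⟨u, r, e, f1, f2, f3⟩ := reach_relay' hx fo fo' fp fr fr' hoo' hrp.symm hrp'.symm
    hrr'.symm (by rw [ko, ko']) (by rw [kr, kp]) (by rw [kr', kp]) (by rw [ko, kp]; exact ht.ne)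
    go.sq gp.sq go'.sq (by rw [lo, ko]) (by rw [lp, ko]) (by rw [lo', kp])
    ha hb ho ho' hpS hr hr'
  obtain ⟨a1, -, b1, b2, b3, b4⟩ := (hG.reach r).drop_point ht.symm f1 go ho lo
  obtain ⟨a2, -, c1, c2, c3, c4⟩ := a1.drop_point ht.symm f2 gp (by grind) lp
  obtain ⟨a3, -, d1, d2, d3, d4⟩ := a2.drop_point ht f3 go' (by grind) lo'
  exact r.1.trans (pure_two_disjoint ht a3 (by omega) (by omega) (by omega) (by omega) e hy
    (by grind) (by grind) (hd _ ha hxa) (hd _ hb hxb))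

lemma two_two_of_disjoint_of_moved (ht : t.Pair t') (N : ℕ) : ∀ (S : Finset (Fin n)) (x : Cfg n),
    S.card = N → Good S x y → cnt S y .moved = 2 → 3 ≤ cnt S y t → cnt S y t' = 2 →
    cnt S y .pos = 0 → o ≠ o' → o ≠ p → o ∈ S → o' ∈ S → p ∈ S → x.ty o = t' → x.ty o' = t' →
    y.ty o = t' → y.ty p = t' → x.ty p = t → y.ty o' = .moved →
    (∀ i ∈ S, x.ty i = .moved → y.ty i ≠ .moved) → Within (cnt S y t + 4) x y := by
  induction N using Nat.strong_induction_on with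
  | _ N IH =>
  rintro S x rfl hG hm hk ht' hp hoo' hop ho ho' hpS hxo hxo' hyo hyp hxp hyo' hd
  have h1 := ht.ne_moved
  have h2 := ht.symm.ne_moved
  have h3 := ht.ne
  obtain ⟨a, ha, hxa⟩ := exists_one (S := S) (x := x) (t := .moved) (by rw [hG.cnt_eq]; omega)
  have hx := ed_of_ty hxa
  have hy := ed_of_ty hyo'
  have hys := hy.symm.ty
  have hs := hG.right o' ho'
  have hb := hG.left a ha
  have hxb := hx.symm.ty
  have hyt : ∀ k ∈ S, y.ty k ≠ .moved → k ≠ o → k ≠ p → y.ty k = t := fun k hk k1 k2 k3 => by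
    rcases ty_cases ht hp hk with h | h | h
    · exact absurd h k1
    · exact h
    · rcases eq_or_eq_of_cnt_le_two ht'.le ho hpS hk hop hyo hyp h with h | h <;> contradiction
  obtain ⟨fo, ko⟩ := fx_of_ty hxo h2
  obtain ⟨fo', ko'⟩ := fx_of_ty hxo' h2
  obtain ⟨fp, kp⟩ := fx_of_ty hxp h1
  obtain ⟨go, lo⟩ := fx_of_ty hyo h2
  obtain ⟨gp, lp⟩ := fx_of_ty hyp h2
  by_cases h4 : 4 ≤ cnt S y t
  · obtain ⟨ga, la⟩ := fx_of_ty (hyt a ha (hd a ha hxa) (by grind) (by grind)) h1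
    obtain ⟨e1, he1, hxe1, k1, k2⟩ := exists_ne_ne (S := S) (x := x) (t := t)
      (by rw [hG.cnt_eq]; omega) p (y.p o')
    obtain ⟨e2, he2, hxe2, h5⟩ := exists_of_cnt (S := S) (x := x) (t := t) (B := {p, y.p o', e1})
      (by rw [hG.cnt_eq]; exact lt_of_le_of_lt Finset.card_le_three h4)
    simp only [Finset.mem_insert, Finset.mem_singleton, not_or] at h5
    obtain ⟨k3, k4, k5⟩ := h5
    obtain ⟨f1, m1⟩ := fx_of_ty hxe1 h1
    obtain ⟨f2, m2⟩ := fx_of_ty hxe2 h1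
    obtain ⟨w, hw⟩ := Aff.exists_conj f1.sq f2.sq (by rw [m1, m2])
    have hG' := hG
    obtain ⟨u, r, e, f3, -, o1⟩ := reach_edge w (y.d a) hx f1 f2 (Ne.symm k5) hw ga.sq
      (by rw [la, m1]) ha hb he1 he2
    have fo1 : u.Fx o (x.d o) := by grind [Fx, Ed]
    have fo1' : u.Fx o' (x.d o') := by grind [Fx, Ed]
    have fp1 : u.Fx p (x.d p) := by grind [Fx, Ed]
    have hGu := hG.reach r
    obtain ⟨a1, a2, b1, b2, b3, b4⟩ := hGu.drop_point ht f3 ga ha la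
    refine (r.1.trans (IH _ a2 _ u rfl a1 (by omega) (by omega) (by omega) (by omega) hoo' hop
      (by grind) (by grind) (by grind) (by rw [fo1.ty, ko]) (by rw [fo1'.ty, ko']) hyo hyp
      (by rw [fp1.ty, kp]) hyo' fun i hi hui => ?_)).mono (by omega)
    have hi' := Finset.mem_of_mem_erase hi
    rcases e.eq_of_moved (by rw [hGu.cnt_eq]; omega) he1 he2 hi' hui with rfl | rfl
    · exact hy.not_moved hm.le ho' hs he1 (by grind) k2
    · exact hy.not_moved hm.le ho' hs he2 (by grind) k4
  obtain ⟨r, hr, hxr, hrp, hrs⟩ := exists_ne_ne (S := S) (x := x) (t := t)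
    (by rw [hG.cnt_eq]; omega) p (y.p o')
  obtain ⟨r', hr', hxr', hrp', hrr'⟩ := exists_ne_ne (S := S) (x := x) (t := t)
    (by rw [hG.cnt_eq]; omega) p r
  have hyr := hyt r hr (hy.not_moved hm.le ho' hs hr (by grind) hrs) (by grind) hrp
  obtain ⟨fr, kr⟩ := fx_of_ty hxr h1
  obtain ⟨fr', kr'⟩ := fx_of_ty hxr' h1
  obtain ⟨gr, lr⟩ := fx_of_ty hyr h1
  obtain ⟨u, r, e, f1, f2, f3⟩ := reach_relay hx fo fo' fp fr fr' hoo' hrp.symm hrp'.symm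
    hrr'.symm (by rw [ko, ko']) (by rw [kr, kp]) (by rw [kr', kp]) (by rw [ko, kp]; exact ht.ne)
    go.sq gp.sq gr.sq (by rw [lo, ko]) (by rw [lp, ko]) (by rw [lr, kp]) ha hb ho ho' hpS hr hr'
  obtain ⟨a1, -, b1, b2, b3, b4⟩ := (hG.reach r).drop_point ht.symm f1 go ho lo
  obtain ⟨a2, -, c1, c2, c3, c4⟩ := a1.drop_point ht.symm f2 gp (by grind) lp
  obtain ⟨a3, -, d1, d2, d3, d4⟩ := a2.drop_point ht f3 gr (by grind) lr
  exact (r.1.trans (pure_two_disjoint ht a3 (by omega) (by omega) (by omega) (by omega) e hy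
    (by grind) (by grind) (hd _ ha hxa) (hd _ hb hxb))).mono (by omega)

end

end

section

variable {x y z : Cfg n} {S : Finset (Fin n)} {t t' : Kind}

section

variable {o o' p : Fin n}

/-- The 2-cycle of `x` moves `p` and that of `y` moves `o'`. -/
lemma two_two_of_moved_of_moved (ht : t.Pair t') (hG : Good S x y) (hm : cnt S y .moved = 2)
    (hk : 3 ≤ cnt S y t) (ht' : cnt S y t' = 2) (hp : cnt S y .pos = 0) (hoo' : o ≠ o')
    (hop : o ≠ p) (ho : o ∈ S) (ho' : o' ∈ S) (hpS : p ∈ S) (hxo : x.ty o = t')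
    (hxo' : x.ty o' = t') (hyo : y.ty o = t') (hyp : y.ty p = t') (hxp : x.ty p = .moved)
    (hyo' : y.ty o' = .moved) : Within (cnt S y t + 5) x y := by
  have h1 := ht.ne_moved
  have h2 := ht.symm.ne_moved
  have h3 := ht.ne
  have hx := ed_of_ty hxp
  have hy := ed_of_ty hyo'
  have hs := hG.right o' ho'
  have ha := hG.left p hpS
  have hx' := hx.symm
  obtain ⟨e1, he1, hxe1, k1⟩ := exists_ne (S := S) (x := x) (t := t)
      (by rw [hG.cnt_eq]; omega) (y.p o')
  obtain ⟨e2, he2, hxe2, k2, k3⟩ := exists_ne_ne (S := S) (x := x) (t := t)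
      (by rw [hG.cnt_eq]; omega) (y.p o') e1
  obtain ⟨fo, ko⟩ := fx_of_ty hxo h2
  obtain ⟨fo', ko'⟩ := fx_of_ty hxo' h2
  obtain ⟨f1, m1⟩ := fx_of_ty hxe1 h1
  obtain ⟨f2, m2⟩ := fx_of_ty hxe2 h1
  obtain ⟨w, hw⟩ := Aff.exists_conj f1.sq f2.sq (by rw [m1, m2])
  obtain ⟨u, r, e, f3, -, o1⟩ := reach_edge w _ hx f1 f2 (Ne.symm k3) hw f1.sq rfl hpS ha he1 he2
  have fo1 : u.Fx o (x.d o) := by grind [Fx, Ed]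
  have fo1' : u.Fx o' (x.d o') := by grind [Fx, Ed]
  have hGu := hG.reach r
  refine (r.1.trans (two_two_of_disjoint_of_moved ht _ S u rfl hGu hm hk ht' hp hoo' hop
    ho ho' hpS (by rw [fo1.ty, ko]) (by rw [fo1'.ty, ko']) hyo hyp (by rw [f3.ty, m1])
    hyo' fun i hi hui => ?_)).mono (by omega)
  rcases e.eq_of_moved (by rw [hGu.cnt_eq]; omega) he1 he2 hi hui with rfl | rfl
  · exact hy.not_moved hm.le ho' hs he1 (by grind) k1
  · exact hy.not_moved hm.le ho' hs he2 (by grind) k2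

lemma two_two_of_ty (ht : t.Pair t') (hG : Good S x y) (hm : cnt S y .moved = 2)
    (hk : cnt S y t = 3) (ht' : cnt S y t' = 2) (hp : cnt S y .pos = 0) (hoo' : o ≠ o')
    (hop : o ≠ p) (ho : o ∈ S) (ho' : o' ∈ S) (hpS : p ∈ S) (hxo : x.ty o = t')
    (hxo' : x.ty o' = t') (hyo : y.ty o = t') (hyp : y.ty p = t') (hxp : x.ty p = t)
    (hyo' : y.ty o' ≠ t')
    (hne : ∃ i ∈ S, x.ty i = .moved ∧ y.ty i ≠ .moved) : Within (cnt S y t + 5) x y := by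
  rw [hk]
  by_cases hd : ∀ i ∈ S, x.ty i = .moved → y.ty i ≠ .moved
  · rcases ty_cases ht hp ho' with h | h | h
    · exact (two_two_of_disjoint_of_moved ht _ S x rfl hG hm hk.ge ht' hp hoo' hop ho ho' hpS hxo
        hxo' hyo hyp hxp h hd).mono (by omega)
    · exact two_two_of_disjoint_of_ty ht hG hm hk ht' hp hoo' hop ho ho' hpS hxo hxo' hyo hyp hxp
        h hd
    · exact absurd h hyo'
  push Not at hd
  obtain ⟨i, hi, hxi, hyi⟩ := hd
  refine two_two_of_shared ht hG hm hk ht' hp hoo' hop ho ho' hpS hxo hxo' hyo hyp hxp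
    (ed_of_ty hxi) (ed_of_ty hyi) hi fun h => ?_
  obtain ⟨k, hk, hxk, hyk⟩ := hne
  rcases (ed_of_ty hxi).eq_of_moved (by rw [hG.cnt_eq, hm]) hi (hG.left i hi) hk hxk with rfl | rfl
  · exact hyk hyi
  · rw [h] at hyk
    exact hyk (ed_of_ty hyi).symm.ty

end

lemma exists_moved_right (hG : Good S x y)
    (hne : ∃ i ∈ S, x.ty i = .moved ∧ y.ty i ≠ .moved) :
    ∃ i ∈ S, y.ty i = .moved ∧ x.ty i ≠ .moved := by
  by_contra! hc
  obtain ⟨i, hi, hxi, hyi⟩ := hne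
  have h1 := cnt_erase (x := x) hi .moved
  have h2 := cnt_erase (x := y) hi .moved
  rw [if_pos hxi] at h1
  rw [if_neg hyi] at h2
  have h3 := hG.cnt_eq .moved
  have h4 : cnt (S.erase i) y .moved ≤ cnt (S.erase i) x .moved := by
    refine Finset.card_le_card fun k hk => ?_
    simp only [Finset.mem_filter, Finset.mem_erase] at hk ⊢
    exact ⟨hk.1, hc k hk.1.2 hk.2⟩
  omega

/-- One of the kinds occurs twice, and no fixed point of the other kind can be settled at once. -/
lemma two_two (ht : t.Pair t') (hG : Good S x y) (hm : cnt S y .moved = 2)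
    (hk : 3 ≤ cnt S y t) (ht' : cnt S y t' = 2) (hp : cnt S y .pos = 0)
    (hne : ∃ i ∈ S, x.ty i = .moved ∧ y.ty i ≠ .moved)
    (hl : 4 ≤ cnt S y t → ∀ i ∈ S, x.ty i = .moved → y.ty i ≠ t)
    (hr : 4 ≤ cnt S y t → ∀ i ∈ S, y.ty i = .moved → x.ty i ≠ t) :
    Within (cnt S y t + 5) x y := by
  have hp' : cnt S x .pos = 0 := by rw [hG.cnt_eq, hp]
  have hx' : cnt S x t' = 2 := by rw [hG.cnt_eq, ht']
  obtain ⟨c, hc, hxc⟩ := exists_one (S := S) (x := x) (t := t') (by omega)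
  obtain ⟨d, hd, hxd, hdc⟩ := exists_ne (S := S) (x := x) (t := t') (by omega) c
  obtain ⟨p, hpS, hyp⟩ := exists_one (S := S) (x := y) (t := t') (by omega)
  obtain ⟨q, hqS, hyq, hqp⟩ := exists_ne (S := S) (x := y) (t := t') (by omega) p
  have one : ∀ {o o' p : Fin n}, o ≠ o' → o ≠ p → o ∈ S → o' ∈ S → p ∈ S → x.ty o = t' →
      x.ty o' = t' → y.ty o = t' → y.ty p = t' → x.ty p ≠ t' → y.ty o' ≠ t' →
      Within (cnt S y t + 5) x y := by
    intro o o' p hoo' hop ho ho' hpS hxo hxo' hyo hyp hxp hyo'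
    by_cases h4 : 4 ≤ cnt S y t
    · obtain ⟨i, hi, hyi, hxi⟩ := exists_moved_right hG hne
      obtain ⟨j, hj, hxj, hyj⟩ := hne
      have h2 := ht.symm.ne_moved
      have h6 := hl h4 j hj hxj
      have h7 := hr h4 i hi hyi
      have h8 : j = o ∨ j = p := by
        rcases ty_cases ht hp hj with h | h | h
        · contradiction
        · contradiction
        · exact eq_or_eq_of_cnt_le_two ht'.le ho hpS hj hop hyo hyp h
      have h9 : i = o ∨ i = o' := by
        rcases ty_cases ht hp' hi with h | h | h
        · contradiction
        · contradiction
        · exact eq_or_eq_of_cnt_le_two hx'.le ho ho' hi hoo' hxo hxo' h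
      exact two_two_of_moved_of_moved ht hG hm hk ht' hp hoo' hop ho ho' hpS hxo hxo' hyo hyp
        (by grind) (by grind)
    rcases ty_cases ht hp' hpS with h | h | h
    · rcases ty_cases ht hp ho' with h' | h' | h'
      · exact two_two_of_moved_of_moved ht hG hm hk ht' hp hoo' hop ho ho' hpS hxo hxo' hyo hyp h h'
      · have := two_two_of_ty ht hG.symm (by rwa [hG.cnt_eq]) (by rw [hG.cnt_eq]; omega) hx' hp'
          hop hoo' ho hpS ho' hyo hyp hxo hxo' h' hxp (exists_moved_right hG hne)
        rw [hG.cnt_eq] at this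
        exact this.symm
      · contradiction
    · exact two_two_of_ty ht hG hm (by omega) ht' hp hoo' hop ho ho' hpS hxo hxo' hyo hyp h hyo' hne
    · contradiction
  by_cases h1 : x.ty p = t' <;> by_cases h2 : x.ty q = t'
  · exact two_two_of_same ht hG hm hk ht' hp hqp.symm hpS hqS h1 h2 hyp hyq hne
  · obtain ⟨o', ho', hxo', hop⟩ := exists_ne (S := S) (x := x) (t := t') (by omega) p
    refine one hop.symm hqp.symm hpS ho' hqS h1 hxo' hyp hyq h2 fun h => ?_
    rcases eq_or_eq_of_cnt_le_two ht'.le hpS hqS ho' hqp.symm hyp hyq h with rfl | rfl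
    · exact hop rfl
    · exact h2 hxo'
  · obtain ⟨o', ho', hxo', hop⟩ := exists_ne (S := S) (x := x) (t := t') (by omega) q
    refine one hop.symm hqp hqS ho' hpS h2 hxo' hyq hyp h1 fun h => ?_
    rcases eq_or_eq_of_cnt_le_two ht'.le hqS hpS ho' hqp hyq hyp h with rfl | rfl
    · exact hop rfl
    · exact h1 hxo'
  · exact two_two_of_disjoint ht hG hm hk ht' hp hdc.symm hc hd hxc hxd hqp.symm hpS hqS hyp hyq
      h1 h2

/-- A fixed point is settled by the 2-cycle leaving it. -/
lemma exists_settle (ht : t.Pair t') (hG : Good S x y) (hm : cnt S y .moved = 2)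
    (hk : 3 ≤ cnt S y t) {i : Fin n} (hi : i ∈ S) (hxi : x.ty i = .moved) (hyi : y.ty i = t) :
    ∃ u, Within 1 x u ∧ Good (S.erase i) u y ∧ (S.erase i).card < S.card ∧
      cnt S y .moved = cnt (S.erase i) y .moved ∧ cnt S y t = cnt (S.erase i) y t + 1 ∧
      cnt S y t' = cnt (S.erase i) y t' ∧ cnt S y .pos = cnt (S.erase i) y .pos ∧
      ∃ j ∈ S.erase i, u.ty j = .moved ∧ y.ty j ≠ .moved := by
  have ei := ed_of_ty hxi
  have ha := hG.left i hi
  have h1 := ht.ne_moved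
  obtain ⟨j, hj, hyj⟩ := exists_one (S := S) (x := y) (t := .moved) (by omega)
  have hyj := ed_of_ty hyj
  obtain ⟨fi, ki⟩ := fx_of_ty hyi h1
  obtain ⟨b, hb, hxb, hbj, hbj'⟩ := exists_ne_ne (S := S) (x := x) (t := t)
    (by rw [hG.cnt_eq]; omega) j (y.p j)
  obtain ⟨c, hc, hxc, hcb⟩ := exists_ne (S := S) (x := x) (t := t) (by rw [hG.cnt_eq]; omega) b
  obtain ⟨fb, kb⟩ := fx_of_ty hxb h1
  obtain ⟨fc, kc⟩ := fx_of_ty hxc h1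
  obtain ⟨w, hw⟩ := Aff.exists_conj fb.sq fc.sq (by rw [kb, kc])
  obtain ⟨u, r, e, f, -⟩ := reach_edge w (y.d i) ei fb fc hcb.symm hw fi.sq (by rw [ki, kb]) hi ha
    hb hc
  obtain ⟨a1, a2, b1, b2, b3, b4⟩ := (hG.reach r).drop_point ht f fi hi ki
  exact ⟨u, r.1, a1, a2, b1, b2, b3, b4, b, by grind, e.ty,
    hyj.not_moved hm.le hj (hG.right j hj) hb hbj hbj'⟩

lemma within_of_two_moved_of_ne (N : ℕ) : ∀ (S : Finset (Fin n)) (x y : Cfg n), S.card = N →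
    Good S x y → cnt S y .moved = 2 → 2 ≤ cnt S y .even → 2 ≤ cnt S y .odd →
    3 ≤ cnt S y .even ∨ 3 ≤ cnt S y .odd → cnt S y .pos = 0 →
    (∃ i ∈ S, x.ty i = .moved ∧ y.ty i ≠ .moved) →
    Within (cnt S y .even + cnt S y .odd + 3) x y := by
  induction N using Nat.strong_induction_on with
  | _ N IH =>
  rintro S x y rfl hG hm he ho h3 hp hne
  have settle : ∀ {t t' : Kind} {x y : Cfg n}, t.Pair t' → Good S x y → cnt S y .moved = 2 →
      3 ≤ cnt S y t → 2 ≤ cnt S y t' → 4 ≤ cnt S y t ∨ 3 ≤ cnt S y t' → cnt S y .pos = 0 →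
      (∃ i ∈ S, x.ty i = .moved ∧ y.ty i = t) →
      Within (cnt S y .even + cnt S y .odd + 3) x y := by
    rintro t t' x y ht hG hm h1 h2 h3 hp ⟨i, hi, hxi, hyi⟩
    obtain ⟨u, r, a1, a2, b1, b2, b3, b4, hne⟩ := exists_settle ht hG hm h1 hi hxi hyi
    rcases ht with ⟨rfl, rfl⟩ | ⟨rfl, rfl⟩
    · exact (r.trans (IH _ a2 _ u y rfl a1 (by omega) (by omega) (by omega) (by omega) (by omega)
        hne)).mono (by omega)
    · exact (r.trans (IH _ a2 _ u y rfl a1 (by omega) (by omega) (by omega) (by omega) (by omega)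
        hne)).mono (by omega)
  have main : ∀ {t t' : Kind}, t.Pair t' → 3 ≤ cnt S y t → cnt S y t' = 2 →
      Within (cnt S y .even + cnt S y .odd + 3) x y := by
    intro t t' ht h1 h2
    have hsum : cnt S y .even + cnt S y .odd + 3 = cnt S y t + 5 := by
      rcases ht with ⟨rfl, rfl⟩ | ⟨rfl, rfl⟩ <;> omega
    by_cases hl : 4 ≤ cnt S y t ∧ ∃ i ∈ S, x.ty i = .moved ∧ y.ty i = t
    · exact settle ht hG hm h1 (by omega) (by omega) hp hl.2
    by_cases hr : 4 ≤ cnt S y t ∧ ∃ i ∈ S, y.ty i = .moved ∧ x.ty i = t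
    · have := settle ht hG.symm (by rwa [hG.cnt_eq]) (by rwa [hG.cnt_eq])
        (by rw [hG.cnt_eq]; omega) (by rw [hG.cnt_eq]; omega) (by rw [hG.cnt_eq]; omega) hr.2
      rw [hG.cnt_eq, hG.cnt_eq] at this
      exact this.symm
    rw [hsum]
    exact two_two ht hG hm h1 h2 hp hne (fun h i hi hxi hyi => hl ⟨h, i, hi, hxi, hyi⟩)
      (fun h i hi hxi hyi => hr ⟨h, i, hi, hxi, hyi⟩)
  by_cases h1 : cnt S y .odd = 2
  · exact main (t := .even) (by simp [Kind.Pair]) (by omega) h1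
  by_cases h2 : cnt S y .even = 2
  · exact main (t := .odd) (by simp [Kind.Pair]) (by omega) h2
  obtain ⟨i, hi, hxi, hyi⟩ := hne
  rcases ty_cases (t := .even) (t' := .odd) (by simp [Kind.Pair]) hp hi with h | h | h
  · contradiction
  · exact settle (t := .even) (t' := .odd) (by simp [Kind.Pair]) hG hm (by omega) (by omega)
      (by omega) hp ⟨i, hi, hxi, h⟩
  · exact settle (t := .odd) (t' := .even) (by simp [Kind.Pair]) hG hm (by omega) (by omega)
      (by omega) hp ⟨i, hi, hxi, h⟩

end

section

variable {x y z : Cfg n} {S : Finset (Fin n)} {t t' : Kind}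

/-- Without positive points, a 2-cycle of `y` can be created in two steps. -/
lemma exists_edge (hG : Good S x y) (hm : 3 ≤ cnt S y .moved) (he : cnt S y .even ≠ 1)
    (ho : cnt S y .odd ≠ 1) (hp : cnt S y .pos = 0) :
    ∃ (T : Finset (Fin n)) (c d : Fin n) (u : Aff) (z : Cfg n), Within 2 x z ∧ T ⊆ S ∧ Off S x z ∧
      z.Ed c d u ∧ c ∉ T ∧ d ∉ T ∧ Good T z y ∧ T.card < S.card ∧
      cnt S y .moved = cnt T y .moved + 2 ∧ cnt S y .even = cnt T y .even ∧
      cnt S y .odd = cnt T y .odd ∧ cnt S y .pos = cnt T y .pos := by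
  obtain ⟨i, hi, hyi⟩ := exists_one (S := S) (x := y) (t := .moved) (by omega)
  have ey := ed_of_ty hyi
  have hp' : ∀ k ∈ S, x.ty k ≠ .pos := fun k hk h => by
    have := one_le_cnt hk h
    rw [hG.cnt_eq] at this
    omega
  obtain ⟨z, h1, h2, h3⟩ := edge_step hG ey hi hm he ho (fun h _ => absurd h (hp' i hi))
    (fun h _ => absurd h (hp' _ (hG.right i hi)))
  obtain ⟨a1, a2, a3, a4⟩ := hG.remove_edge ey hi h1 h2 h3
  exact ⟨(S.erase i).erase (y.p i), i, y.p i, y.d i, z, h1,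
    (Finset.erase_subset _ _).trans (Finset.erase_subset _ _), h3, h2, by simp, by simp, a1, a2,
    a3, a4 _ (by simp), a4 _ (by simp), a4 _ (by simp)⟩

lemma within_of_moved (N : ℕ) : ∀ (S : Finset (Fin n)) (x : Cfg n), S.card = N → Good S x y →
    cnt S y .even = 0 → cnt S y .odd = 0 → cnt S y .pos = 0 → Within (cnt S y .moved) x y := by
  induction N using Nat.strong_induction_on with
  | _ N IH =>
  rintro S x rfl hG he ho hp
  by_cases h0 : cnt S y .moved = 0
  · rw [hG.eq_of_cnt h0 he ho]
    exact (Within.refl x).mono (by omega)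
  obtain ⟨i, hi, hyi⟩ := exists_one (S := S) (x := y) (t := .moved) (by omega)
  have ey := ed_of_ty hyi
  have hall : ∀ k ∈ S, x.ty k = .moved := fun k hk => by
    have := one_le_cnt hk (x := x) rfl
    rw [hG.cnt_eq] at this
    cases h : x.ty k <;> rw [h] at this <;> first | rfl | omega
  obtain ⟨z, h1, h2, h3⟩ := edge_moved hG.left ey.1 hi (hG.right i hi) (hall i hi)
    (hall _ (hG.right i hi)) (y.d i)
  obtain ⟨a1, a2, a3, a4⟩ := hG.remove_edge ey hi h1 h2 h3
  have b1 := a4 .even (by simp)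
  have b2 := a4 .odd (by simp)
  have b3 := a4 .pos (by simp)
  exact (h1.trans (IH _ a2 _ z rfl a1 (by omega) (by omega) (by omega))).mono (by omega)

lemma one_lt_cnt_moved (hG : Good S x y) (h : 1 ≤ cnt S y .moved) : 2 ≤ cnt S y .moved := by
  obtain ⟨i, hi, hyi⟩ := exists_one h
  have ey := ed_of_ty hyi
  exact two_le_cnt hi (hG.right i hi) ey.1 ey.ty ey.symm.ty

lemma within_of_no_pos (N : ℕ) : ∀ (S : Finset (Fin n)) (x : Cfg n), S.card = N → Good S x y →
    1 ≤ cnt S y .moved → cnt S y .even ≠ 1 → cnt S y .odd ≠ 1 →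
    3 ≤ cnt S y .even ∨ 3 ≤ cnt S y .odd → cnt S y .pos = 0 →
    Within (cnt S y .moved + cnt S y .even + cnt S y .odd + 2) x y := by
  induction N using Nat.strong_induction_on with
  | _ N IH =>
  rintro S x rfl hG hm he ho h3 hp
  have hm2 := one_lt_cnt_moved hG hm
  by_cases hm3 : 3 ≤ cnt S y .moved
  · obtain ⟨T, c, d, u, z, h1, -, -, -, -, -, a1, a2, a3, a4, a5, a6⟩ := exists_edge hG hm3 he ho hp
    exact (h1.trans (IH _ a2 _ z rfl a1 (by omega) (by omega) (by omega) (by omega)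
      (by omega))).mono (by omega)
  by_cases h1 : cnt S y .odd = 0
  · exact (pure_three (t := .even) (t' := .odd) (by simp [Kind.Pair]) hG (by omega) (by omega) h1
      hp).mono (by omega)
  by_cases h2 : cnt S y .even = 0
  · exact (pure_three (t := .odd) (t' := .even) (by simp [Kind.Pair]) hG (by omega) (by omega) h2
      hp).mono (by omega)
  exact (within_of_leave (t := .even) (t' := .odd) hG (by simp [Kind.Pair]) (by omega) (by omega)
    fun v hv hne => within_of_two_moved_of_ne _ S v y rfl hv (by omega) (by omega) (by omega) h3 hp
      hne).mono (by omega)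

/-- One end of a 2-cycle moves to a fixed point, with the help of another 2-cycle. -/
lemma reach_helper {a b p q c d : Fin n} {g γ δ u β β' : Aff} (h : Aff) (hab : x.Ed a b g)
    (hp : x.Fx p γ) (hq : x.Fx q δ) (hcd : x.Ed c d u) (hpq : p ≠ q) (hγ : γ.kind = δ.kind)
    (hca : c ≠ a) (hcb : c ≠ b) (hβ : β * β = 1) (hβ' : β' * β' = 1) (kβ : β.kind = γ.kind)
    (kβ' : β'.kind = γ.kind) (haS : a ∈ S) (hbS : b ∈ S) (hpS : p ∈ S) (hqS : q ∈ S) (hcS : c ∈ S)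
    (hdS : d ∈ S) :
    ∃ x' : Cfg n, Reach S 4 x x' ∧ x'.Ed c d u ∧ x'.Ed a p h ∧ x'.Fx b β ∧ x'.Fx q β' := by
  obtain ⟨w, hw⟩ := Aff.exists_conj hp.sq hq.sq hγ
  have hab' := hab.symm
  have hcd' := hcd.symm
  have hda : d ≠ a := by grind [Ed]
  have hdb : d ≠ b := by grind [Ed]
  obtain ⟨u1, r1, e1, f1, f2, o1⟩ := reach_edge w γ hcd hp hq hpq hw hp.sq rfl hcS hdS hpS hqS
  have e2 : u1.Ed a b g := by grind [Fx, Ed]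
  obtain ⟨u2, r2, e3, e4, o2⟩ := reach_cross e2 e1 (by grind [Fx, Ed]) (by grind [Fx, Ed]) h
    haS hbS hpS hqS
  have f3 : u2.Fx c γ := by grind [Fx, Ed]
  have f4 : u2.Fx d (u * γ * u⁻¹) := by grind [Fx, Ed]
  have e3' := e3.symm
  obtain ⟨u3, r3, e5, f5, f6, o3⟩ := reach_swap u e4 f3 f4 hcd.1 (by group) hβ hβ' kβ kβ'
    hbS hqS hcS hdS
  exact ⟨u3, (r1.trans r2).trans r3, e5, by grind [Fx, Ed], f5, f6⟩

/-- A 2-cycle and a fixed point become two fixed points, with the help of another 2-cycle. -/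
lemma reach_helper_same {p b q r c d : Fin n} {g γ δ u α β : Aff} (hpb : x.Ed p b g)
    (hq : x.Fx q γ) (hr : x.Fx r δ) (hcd : x.Ed c d u) (hqr : q ≠ r) (hγ : γ.kind = δ.kind)
    (hcp : c ≠ p) (hcb : c ≠ b) (hα : α * α = 1) (hβ : β * β = 1) (kα : α.kind = γ.kind)
    (kβ : β.kind = γ.kind) (hpS : p ∈ S) (hbS : b ∈ S) (hqS : q ∈ S) (hrS : r ∈ S) (hcS : c ∈ S)
    (hdS : d ∈ S) :
    ∃ x' : Cfg n, Reach S 3 x x' ∧ x'.Ed c d u ∧ x'.Fx p α ∧ x'.Fx q β := by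
  obtain ⟨w, hw⟩ := Aff.exists_conj hq.sq hr.sq hγ
  obtain ⟨h, hh⟩ := Aff.exists_conj hα hβ (by rw [kα, kβ])
  have hpb' := hpb.symm
  have hcd' := hcd.symm
  have hdp : d ≠ p := by grind [Ed]
  have hdb : d ≠ b := by grind [Ed]
  obtain ⟨u1, r1, e1, f1, f2, o1⟩ := reach_edge w γ hcd hq hr hqr hw hq.sq rfl hcS hdS hqS hrS
  have e2 : u1.Ed p b g := by grind [Fx, Ed]
  obtain ⟨u2, r2, e3, e4, o2⟩ := reach_cross e2 e1 (by grind [Fx, Ed]) (by grind [Fx, Ed]) h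
    hpS hbS hqS hrS
  have f3 : u2.Fx c γ := by grind [Fx, Ed]
  have f4 : u2.Fx d (u * γ * u⁻¹) := by grind [Fx, Ed]
  obtain ⟨u3, r3, e5, f5, f6, -⟩ := reach_edge u α e3 f3 f4 hcd.1 (by group) hα kα
    hpS hqS hcS hdS
  have : h * α * h⁻¹ = β := by rw [hh]; group
  rw [this] at f6
  exact ⟨u3, (r1.trans r2).trans r3, e5, f5, f6⟩

/-- A 2-cycle and a fixed point become two fixed points of the other kind, with the help of
another 2-cycle. -/
lemma reach_helper_diff {p b q r o o' c d : Fin n} {g κ κ' γ δ u α β : Aff} (hpb : x.Ed p b g)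
    (hq : x.Fx q κ) (hr : x.Fx r κ') (ho : x.Fx o γ) (ho' : x.Fx o' δ) (hcd : x.Ed c d u)
    (hqr : q ≠ r) (hoo' : o ≠ o') (hκ : κ.kind = κ'.kind) (hγ : γ.kind = δ.kind)
    (hne : κ.kind ≠ γ.kind) (hcp : c ≠ p) (hcb : c ≠ b) (hα : α * α = 1) (hβ : β * β = 1)
    (kα : α.kind = γ.kind) (kβ : β.kind = γ.kind) (hpS : p ∈ S) (hbS : b ∈ S) (hqS : q ∈ S)
    (hrS : r ∈ S) (hoS : o ∈ S) (hoS' : o' ∈ S) (hcS : c ∈ S) (hdS : d ∈ S) :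
    ∃ x' : Cfg n, Reach S 4 x x' ∧ x'.Ed c d u ∧ x'.Fx p α ∧ x'.Fx q β := by
  have t1 := hq.ty
  have t2 := hr.ty
  have t3 := ho.ty
  have t4 := ho'.ty
  have hqo : q ≠ o := by grind
  have hqo' : q ≠ o' := by grind
  have hro : r ≠ o := by grind
  have hro' : r ≠ o' := by grind
  obtain ⟨w, hw⟩ := Aff.exists_conj hq.sq hr.sq hκ
  obtain ⟨s, hs⟩ := Aff.exists_conj ho.sq ho'.sq hγ
  obtain ⟨h, hh⟩ := Aff.exists_conj hα hβ (by rw [kα, kβ])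
  have hpb' := hpb.symm
  have hcd' := hcd.symm
  have hdp : d ≠ p := by grind [Ed]
  have hdb : d ≠ b := by grind [Ed]
  obtain ⟨u1, r1, e1, f1, f2, o1⟩ := reach_edge w κ hcd hq hr hqr hw hq.sq rfl hcS hdS hqS hrS
  have e2 : u1.Ed p b g := by grind [Fx, Ed]
  have g1 : u1.Fx o γ := by grind [Fx, Ed]
  have g2 : u1.Fx o' δ := by grind [Fx, Ed]
  obtain ⟨u2, r2, e3, e4, o2⟩ := reach_cross e2 e1 (by grind [Fx, Ed]) (by grind [Fx, Ed]) h
    hpS hbS hqS hrS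
  have f3 : u2.Fx c κ := by grind [Fx, Ed]
  have f4 : u2.Fx d (u * κ * u⁻¹) := by grind [Fx, Ed]
  have g3 : u2.Fx o γ := by grind [Fx, Ed]
  have g4 : u2.Fx o' δ := by grind [Fx, Ed]
  have e4' := e4.symm
  have e3' := e3.symm
  obtain ⟨u3, r3, e5, f5, f6, o3⟩ := reach_edge s α e3 g3 g4 hoo' hs hα kα hpS hqS hoS hoS'
  have : h * α * h⁻¹ = β := by rw [hh]; group
  rw [this] at f6
  have f7 : u3.Fx c κ := by grind [Fx, Ed]
  have f8 : u3.Fx d (u * κ * u⁻¹) := by grind [Fx, Ed]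
  have e6 : u3.Ed b r (w * h * g⁻¹) := by grind [Fx, Ed]
  have e6' := e6.symm
  obtain ⟨u4, r4, e7, -, -, o4⟩ := reach_edge u κ e6 f7 f8 hcd.1 (by group) hq.sq rfl
    hbS hrS hcS hdS
  exact ⟨u4, ((r1.trans r2).trans r3).trans r4, e7, by grind [Fx, Ed], by grind [Fx, Ed]⟩

end

section

variable {x y z : Cfg n} {S : Finset (Fin n)} {t t' : Kind}

lemma Ed.of_eq {i j : Fin n} {g : Aff} (h : x.Ed i j g) (hz : z.p i = x.p i ∧ z.d i = x.d i) :
    z.Ed i j g :=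
  ⟨h.1, hz.1.trans h.2.1, hz.2.trans h.2.2⟩

lemma Fx.of_eq {i : Fin n} {g : Aff} (h : x.Fx i g) (hz : z.p i = x.p i ∧ z.d i = x.d i) :
    z.Fx i g :=
  ⟨hz.1.trans h.1, hz.2.trans h.2⟩

lemma ne_of_ty {i j : Fin n} {s t : Kind} (hi : x.ty i = s) (hj : x.ty j = t) (h : s ≠ t) :
    i ≠ j := by
  rintro rfl
  exact h (hi.symm.trans hj)

lemma Good.not_mem (hG : Good S x y) {a b c : Fin n} {g : Aff} (hab : x.Ed a b g)
    (ha : a ∈ S) (hc : c ∉ S) : c ≠ a ∧ c ≠ b :=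
  ⟨by rintro rfl; exact hc ha, by rintro rfl; exact hc (hab.2.1 ▸ hG.left a ha)⟩

/-- With the help of a 2-cycle outside `S`, two points of the same kind are put in place. -/
lemma exists_place_two (ht : t.Pair t') (hG : Good S x y) (hm : cnt S y .moved = 2)
    (hk : cnt S y t = 2) (ht' : cnt S y t' = 2) (hpos : cnt S y .pos = 0) {p q c d : Fin n}
    {α β u : Aff} (hcd : x.Ed c d u) (hc : c ∉ S) (hd : d ∉ S) (hpq : p ≠ q) (hp : p ∈ S)
    (hq : q ∈ S) (hα : α * α = 1) (hβ : β * β = 1) (kα : α.kind = t') (kβ : β.kind = t') :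
    ∃ z, Reach S 4 x z ∧ z.Ed c d u ∧ z.Fx p α ∧ z.Fx q β := by
  have h1 := ht.ne_moved
  have h2 := ht.symm.ne_moved
  have h3 := ht.ne
  rw [← hG.cnt_eq] at hm hk ht' hpos
  set T := insert c (insert d S) with hT
  have hST : ∀ {k}, k ∈ S → k ∈ T := fun hk => by simp [T, hk]
  have hcT : c ∈ T := by simp [T]
  have hdT : d ∈ T := by simp [T]
  have hcd' := hcd.symm
  have up : ∀ {k}, k ≤ 4 → (∃ z, Reach T k x z ∧ z.Ed c d u ∧ z.Fx p α ∧ z.Fx q β) →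
      ∃ z, Reach S 4 x z ∧ z.Ed c d u ∧ z.Fx p α ∧ z.Fx q β := by
    rintro k hk ⟨z, r, e, f⟩
    exact ⟨z, (r.mono hk).restore hcd e, e, f⟩
  obtain ⟨a, ha, hxa⟩ := exists_one (S := S) (x := x) (t := .moved) (by omega)
  have hab := ed_of_ty hxa
  have hb := hG.left a ha
  have hab' := hab.symm
  have hxb := hab'.ty
  obtain ⟨hca, hcb⟩ := hG.not_mem hab ha hc
  obtain ⟨hda, hdb⟩ := hG.not_mem hab ha hd
  obtain ⟨o, ho, hxo⟩ := exists_one (S := S) (x := x) (t := t') (by omega)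
  obtain ⟨o', ho', hxo', hoo'⟩ := exists_ne (S := S) (x := x) (t := t') (by omega) o
  obtain ⟨fo, ko⟩ := fx_of_ty hxo h2
  obtain ⟨fo', ko'⟩ := fx_of_ty hxo' h2
  obtain ⟨s, hs⟩ := Aff.exists_conj fo.sq fo'.sq (by rw [ko, ko'])
  have fixed : ∀ {p}, p ∈ S → x.ty p = t → c ≠ p ∧ d ≠ p ∧ x.Fx p (x.d p) ∧ (x.d p).kind = t :=
    fun hp h => ⟨by rintro rfl; exact hc hp, by rintro rfl; exact hd hp, fx_of_ty h h1⟩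
  have fixed' : ∀ {p}, p ∈ S → x.ty p = t' → c ≠ p ∧ d ≠ p ∧ x.Fx p (x.d p) ∧ (x.d p).kind = t' :=
    fun hp h => ⟨by rintro rfl; exact hc hp, by rintro rfl; exact hd hp, fx_of_ty h h2⟩
  have diff : ∀ {p q : Fin n} {α β : Aff}, p ∈ S → q ∈ S → α * α = 1 → β * β = 1 →
      α.kind = t' → β.kind = t' → x.ty p = .moved → x.ty q = t →
      ∃ z, Reach T 4 x z ∧ z.Ed c d u ∧ z.Fx p α ∧ z.Fx q β := by
    intro p q α β hp hq hα hβ kα kβ hxp hxq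
    obtain ⟨-, -, fq, kq⟩ := fixed hq hxq
    obtain ⟨e, he, hxe, heq⟩ := exists_ne (S := S) (x := x) (t := t) (by omega) q
    obtain ⟨-, -, fe, ke⟩ := fixed he hxe
    have hpb := ed_of_ty hxp
    obtain ⟨k1, k2⟩ := hG.not_mem hpb hp hc
    exact reach_helper_diff hpb fq fe fo fo' hcd heq.symm hoo'.symm (by rw [kq, ke])
      (by rw [ko, ko']) (by rwa [kq, ko]) k1 k2 hα hβ (by rw [kα, ko]) (by rw [kβ, ko])
      (hST hp) (hST (hG.left p hp)) (hST hq) (hST he) (hST ho) (hST ho') hcT hdT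
  have same : ∀ {x : Cfg n} {p b q : Fin n} {α β g : Aff}, p ∈ S → b ∈ S → q ∈ S → x.Ed c d u →
      α * α = 1 → β * β = 1 → α.kind = t' → β.kind = t' → x.Ed p b g → 2 ≤ cnt S x t' →
      x.ty q = t' → ∃ z, Reach T 3 x z ∧ z.Ed c d u ∧ z.Fx p α ∧ z.Fx q β := by
    intro x p b q α β g hp hb hq hcd hα hβ kα kβ hpb h hxq
    obtain ⟨r, hr, hxr, hrq⟩ := exists_ne h q
    obtain ⟨fq, kq⟩ := fx_of_ty hxq h2
    obtain ⟨fr, kr⟩ := fx_of_ty hxr h2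
    exact reach_helper_same hpb fq fr hcd hrq.symm (by rw [kq, kr])
      (by rintro rfl; exact hc hp) (by rintro rfl; exact hc hb) hα hβ (by rw [kα, kq])
      (by rw [kβ, kq]) (hST hp) (hST hb) (hST hq) (hST hr) hcT hdT
  have mixed : ∀ {p q : Fin n} {α β : Aff}, p ∈ S → q ∈ S → α * α = 1 → β * β = 1 →
      α.kind = t' → β.kind = t' → x.ty p = t → x.ty q = t' →
      ∃ z, Reach T 4 x z ∧ z.Ed c d u ∧ z.Fx p α ∧ z.Fx q β := by
    intro p q α β hp hq hα hβ kα kβ hxp hxq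
    obtain ⟨k1, k2, fp, kp⟩ := fixed hp hxp
    obtain ⟨k3, k4, fq, kq⟩ := fixed' hq hxq
    obtain ⟨e, he, hxe, hep⟩ := exists_ne (S := S) (x := x) (t := t) (by omega) p
    obtain ⟨k5, k6, fe, ke⟩ := fixed he hxe
    obtain ⟨w, hw⟩ := Aff.exists_conj fp.sq fe.sq (by rw [kp, ke])
    obtain ⟨v, r1, e1, -, -, o1⟩ := reach_edge w _ hab fp fe hep.symm hw fp.sq rfl ha hb hp he
    have e2 : v.Ed c d u := hcd.of_eq (o1 c hca hcb k1 k5)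
    have hqe : q ≠ e := ne_of_ty hxq hxe h3.symm
    have hqp : q ≠ p := ne_of_ty hxq hxp h3.symm
    have f1 : v.Fx q (x.d q) :=
      fq.of_eq (o1 q (ne_of_ty hxq hxa h2) (ne_of_ty hxq hxb h2) hqp hqe)
    have hv : cnt S v t' = 2 := by
      rw [(hG.reach r1).cnt_eq, ← hG.cnt_eq, ht']
    obtain ⟨z, r2, h⟩ := same hp he hq e2 hα hβ kα kβ e1 hv.ge (by rw [f1.ty, kq])
    exact ⟨z, (r1.subset fun _ => hST).trans r2, h⟩
  have flip : (∃ z, Reach S 4 x z ∧ z.Ed c d u ∧ z.Fx q β ∧ z.Fx p α) →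
      ∃ z, Reach S 4 x z ∧ z.Ed c d u ∧ z.Fx p α ∧ z.Fx q β :=
    fun ⟨z, h1, h2, h3, h4⟩ => ⟨z, h1, h2, h4, h3⟩
  have up' : ∀ {k}, k ≤ 4 → (∃ z, Reach T k x z ∧ z.Ed c d u ∧ z.Fx q β ∧ z.Fx p α) →
      ∃ z, Reach S 4 x z ∧ z.Ed c d u ∧ z.Fx p α ∧ z.Fx q β := by
    rintro k hk ⟨z, r, e, h, h'⟩
    exact ⟨z, (r.mono hk).restore hcd e, e, h', h⟩
  rcases ty_cases ht hpos hp with h | h | h <;> rcases ty_cases ht hpos hq with h' | h' | h'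
  · have hpb := ed_of_ty h
    have hq' : q = x.p p := by
      rcases hpb.eq_of_moved hm.le hp (hG.left p hp) hq h' with h | h
      · exact absurd h.symm hpq
      · exact h
    rw [← hq'] at hpb
    obtain ⟨k1, k2⟩ := hG.not_mem hpb hp hc
    obtain ⟨k5, -⟩ := fixed' ho hxo
    obtain ⟨k7, -⟩ := fixed' ho' hxo'
    obtain ⟨z, r, e, f1, f2, o1⟩ := reach_swap s hpb fo fo' hoo'.symm hs hα hβ (by rw [kα, ko])
      (by rw [kβ, ko]) hp hq ho ho'
    exact up (k := 2) (by omega) ⟨z, r.subset fun _ => hST, hcd.of_eq (o1 c k1 k2 k5 k7), f1, f2⟩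
  · exact up le_rfl (diff hp hq hα hβ kα kβ h h')
  · exact up (by omega) (same hp (hG.left p hp) hq hcd hα hβ kα kβ (ed_of_ty h) ht'.ge h')
  · exact up' le_rfl (diff hq hp hβ hα kβ kα h' h)
  · obtain ⟨k1, k2, fp, kp⟩ := fixed hp h
    obtain ⟨k3, k4, fq, kq⟩ := fixed hq h'
    obtain ⟨k5, k6, -⟩ := fixed' ho hxo
    obtain ⟨k7, k8, -⟩ := fixed' ho' hxo'
    obtain ⟨w, hw⟩ := Aff.exists_conj fp.sq fq.sq (by rw [kp, kq])
    obtain ⟨v, r1, e1, -, -, o1⟩ := reach_edge w _ hab fp fq hpq hw fp.sq rfl ha hb hp hq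
    have f1 : v.Fx o (x.d o) := fo.of_eq (o1 o (ne_of_ty hxo hxa h2) (ne_of_ty hxo hxb h2)
      (ne_of_ty hxo h h3.symm) (ne_of_ty hxo h' h3.symm))
    have f2 : v.Fx o' (x.d o') := fo'.of_eq (o1 o' (ne_of_ty hxo' hxa h2) (ne_of_ty hxo' hxb h2)
      (ne_of_ty hxo' h h3.symm) (ne_of_ty hxo' h' h3.symm))
    have e2 : v.Ed c d u := hcd.of_eq (o1 c hca hcb k1 k3)
    obtain ⟨z, r2, e, f3, f4, o2⟩ := reach_swap s e1 f1 f2 hoo'.symm hs hα hβ (by rw [kα, ko])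
      (by rw [kβ, ko]) hp hq ho ho'
    exact ⟨z, (r1.trans r2).mono (by omega), e2.of_eq (o2 c k1 k3 k5 k7), f3, f4⟩
  · exact up le_rfl (mixed hp hq hα hβ kα kβ h h')
  · exact up' (by omega) (same hq (hG.left q hq) hp hcd hβ hα kβ kα (ed_of_ty h') ht'.ge h)
  · exact up' le_rfl (mixed hq hp hβ hα kβ kα h' h)
  · obtain ⟨k1, k2, fp, kp⟩ := fixed' hp h
    obtain ⟨k3, k4, fq, kq⟩ := fixed' hq h'
    obtain ⟨z, r, e, f1, f2, o1⟩ := reach_loop (x.d a) hab fp fq hpq (by rw [kp, kq]) hα hβ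
      (by rw [kα, kp]) (by rw [kβ, kp]) ha hb hp hq
    exact ⟨z, r, hcd.of_eq (o1 c hca hcb k1 k3), f1, f2⟩

/-- With the help of a 2-cycle outside `S`, two fixed points and a 2-cycle are settled. -/
lemma pure_two_of_helper (ht : t.Pair t') (hG : Good S x y) (hm : cnt S y .moved = 2)
    (hk : cnt S y t = 2) (ht' : cnt S y t' = 0) (hpos : cnt S y .pos = 0) {c d : Fin n}
    {u : Aff} (hcd : x.Ed c d u) (hc : c ∉ S) : Within 4 x y := by
  have h1 := ht.ne_moved
  have hm' : cnt S x .moved = 2 := by rw [hG.cnt_eq, hm]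
  have hcd' := hcd.symm
  have pure := fun k (hk : k ∈ S) => ty_of_pure ht ht' hpos hk
  have pure' := fun k (hk : k ∈ S) => ty_of_pure (x := x) ht (by rw [hG.cnt_eq, ht'])
    (by rw [hG.cnt_eq, hpos]) hk
  have shared : ∀ {i j a : Fin n} {g h : Aff}, x.Ed i a g → y.Ed i j h → i ∈ S → a ≠ j →
      Within 4 x y := by
    intro i j a g h hia hij hi haj
    have haS : a ∈ S := hia.2.1 ▸ hG.left i hi
    have hjS : j ∈ S := hij.2.1 ▸ hG.right i hi
    have hxi := hia.ty
    have hxa := hia.symm.ty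
    obtain ⟨ga, la⟩ := fx_of_ty (pure a haS (hij.not_moved hm.le hi hjS haS hia.1.symm haj)) h1
    obtain ⟨fj, kj⟩ := fx_of_ty (pure' j hjS (hia.not_moved hm'.le hi haS hjS hij.1.symm haj.symm))
      h1
    obtain ⟨q, hq, hxq, hqj⟩ := exists_ne (S := S) (x := x) (t := t) (by rw [hG.cnt_eq]; omega) j
    obtain ⟨fq, kq⟩ := fx_of_ty hxq h1
    have hqi : q ≠ i := by grind
    have hqa : q ≠ a := by grind
    obtain ⟨gq, lq⟩ := fx_of_ty (pure q hq (hij.not_moved hm.le hi hjS hq hqi hqj)) h1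
    obtain ⟨k1, k2⟩ := hG.not_mem hia hi hc
    have hST : ∀ {k}, k ∈ S → k ∈ insert c (insert d S) := fun hk => by simp [hk]
    obtain ⟨z, r, e, e1, f1, f2⟩ := reach_helper (S := insert c (insert d S)) h hia fj fq hcd
      hqj.symm (by rw [kj, kq]) k1 k2 ga.sq gq.sq (by rw [la, kj]) (by rw [lq, kj]) (hST hi)
      (hST haS) (hST hjS) (hST hq) (by simp) (by simp)
    have r := r.restore hcd e
    obtain ⟨a1, -, b1, b2, b3, b4⟩ := (hG.reach r).drop_edge ht e1 hij hi
    obtain ⟨a2, -, c1, c2, c3, c4⟩ := a1.drop_point ht f1 ga (by simp [haS, haj, hia.1.symm]) la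
    obtain ⟨a3, -, d1, d2, d3, d4⟩ := a2.drop_point ht f2 gq (by simp [hq, hqa, hqi, hqj]) lq
    rw [a3.eq_of_cnt_pair ht (by omega) (by omega) (by omega)]
    exact r.1
  obtain ⟨i, hi, hxi⟩ := exists_one (S := S) (x := x) (t := .moved) (by omega)
  have hia := ed_of_ty hxi
  have ha := hG.left i hi
  have hxa := hia.symm.ty
  by_cases h2 : y.ty i = .moved
  · by_cases h3 : x.p i = y.p i
    · have hy := ed_of_ty h2
      rw [← h3] at hy
      obtain ⟨p, hp, hxp⟩ := exists_one (S := S) (x := x) (t := t) (by rw [hG.cnt_eq]; omega)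
      obtain ⟨q, hq, hxq, hqp⟩ := exists_ne (S := S) (x := x) (t := t)
        (by rw [hG.cnt_eq]; omega) p
      obtain ⟨fp, kp⟩ := fx_of_ty hxp h1
      obtain ⟨fq, kq⟩ := fx_of_ty hxq h1
      have hpi : p ≠ i := by grind
      have hpa : p ≠ x.p i := by grind
      have hqi : q ≠ i := by grind
      have hqa : q ≠ x.p i := by grind
      obtain ⟨gp, lp⟩ := fx_of_ty (pure p hp (hy.not_moved hm.le hi ha hp hpi hpa)) h1
      obtain ⟨gq, lq⟩ := fx_of_ty (pure q hq (hy.not_moved hm.le hi ha hq hqi hqa)) h1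
      obtain ⟨z, r, e, f1, f2, -⟩ := reach_loop (y.d i) hia fp fq hqp.symm (by rw [kp, kq])
        gp.sq gq.sq (by rw [lp, kp]) (by rw [lq, kp]) hi ha hp hq
      obtain ⟨a1, -, b1, b2, b3, b4⟩ := (hG.reach r).drop_edge ht e hy hi
      obtain ⟨a2, -, c1, c2, c3, c4⟩ := a1.drop_point ht f1 gp (by simp [hp, hpa, hpi]) lp
      obtain ⟨a3, -, d1, d2, d3, d4⟩ := a2.drop_point ht f2 gq (by simp [hq, hqa, hqi, hqp]) lq
      rw [a3.eq_of_cnt_pair ht (by omega) (by omega) (by omega)]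
      exact r.1
    · exact shared hia (ed_of_ty h2) hi h3
  by_cases h3 : y.ty (x.p i) = .moved
  · refine shared hia.symm (ed_of_ty h3) ha fun h => h2 ?_
    rw [h]
    exact (ed_of_ty h3).symm.ty
  obtain ⟨j, hj, hyj⟩ := exists_one (S := S) (x := y) (t := .moved) (by omega)
  exact (pure_two_disjoint ht hG hm hk ht' hpos hia (ed_of_ty hyj) hi hj h2 h3).mono (by omega)

lemma within_of_helper_pure (ht : t.Pair t') (N : ℕ) : ∀ (S : Finset (Fin n)) (x : Cfg n)
    (c d : Fin n) (u : Aff), S.card = N → Good S x y → x.Ed c d u → c ∉ S → d ∉ S →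
    1 ≤ cnt S y .moved → cnt S y t = 2 → cnt S y t' = 0 → cnt S y .pos = 0 →
    Within (cnt S y .moved + 2) x y := by
  induction N using Nat.strong_induction_on with
  | _ N IH =>
  rintro S x c d u rfl hG hcd hc hd hm hk ht' hp
  have hm2 := one_lt_cnt_moved hG hm
  by_cases hm3 : 3 ≤ cnt S y .moved
  · obtain ⟨T, c, d, u, z, h1, -, -, h4, h5, h6, a1, a2, a3, a4, a5, a6⟩ := exists_edge hG hm3
      (by rcases ht with ⟨rfl, rfl⟩ | ⟨rfl, rfl⟩ <;> omega)
      (by rcases ht with ⟨rfl, rfl⟩ | ⟨rfl, rfl⟩ <;> omega) hp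
    have hk' : cnt T y t = 2 := by rcases ht with ⟨rfl, rfl⟩ | ⟨rfl, rfl⟩ <;> omega
    have ht'' : cnt T y t' = 0 := by rcases ht with ⟨rfl, rfl⟩ | ⟨rfl, rfl⟩ <;> omega
    exact (h1.trans (IH _ a2 _ z c d u rfl a1 h4 h5 h6 (by omega) hk' ht'' (by omega))).mono
      (by omega)
  exact (pure_two_of_helper ht hG (by omega) hk ht' hp hcd hc).mono (by omega)

lemma within_of_helper_mixed (N : ℕ) : ∀ (S : Finset (Fin n)) (x : Cfg n)
    (c d : Fin n) (u : Aff), S.card = N → Good S x y → x.Ed c d u → c ∉ S → d ∉ S →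
    1 ≤ cnt S y .moved → cnt S y .even = 2 → cnt S y .odd = 2 → cnt S y .pos = 0 →
    Within (cnt S y .moved + 6) x y := by
  induction N using Nat.strong_induction_on with
  | _ N IH =>
  rintro S x c d u rfl hG hcd hc hd hm hk ht' hp
  have hm2 := one_lt_cnt_moved hG hm
  by_cases hm3 : 3 ≤ cnt S y .moved
  · obtain ⟨T, c, d, u, z, h1, -, -, h4, h5, h6, a1, a2, a3, a4, a5, a6⟩ := exists_edge hG hm3
      (by omega) (by omega) hp
    exact (h1.trans (IH _ a2 _ z c d u rfl a1 h4 h5 h6 (by omega) (by omega) (by omega)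
      (by omega))).mono (by omega)
  have ht : Kind.even.Pair .odd := by simp [Kind.Pair]
  obtain ⟨p, hpS, hyp⟩ := exists_one (S := S) (x := y) (t := .odd) (by omega)
  obtain ⟨q, hqS, hyq, hqp⟩ := exists_ne (S := S) (x := y) (t := .odd) (by omega) p
  obtain ⟨gp, lp⟩ := fx_of_ty hyp (by simp)
  obtain ⟨gq, lq⟩ := fx_of_ty hyq (by simp)
  obtain ⟨z, r, e, f1, f2⟩ := exists_place_two ht hG (by omega) hk ht' hp hcd hc hd hqp.symm hpS hqS
    gp.sq gq.sq lp lq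
  obtain ⟨a1, -, b1, b2, b3, b4⟩ := (hG.reach r).drop_point ht.symm f1 gp hpS lp
  obtain ⟨a2, -, c1, c2, c3, c4⟩ := a1.drop_point ht.symm f2 gq (by simp [hqS, hqp]) lq
  exact (r.1.trans (pure_two_of_helper ht a2 (by omega) (by omega) (by omega) (by omega) e
    (by simp [hc]))).mono (by omega)

lemma within_of_no_pos_of_le (hG : Good S x y) (hm : 3 ≤ cnt S y .moved)
    (he : cnt S y .even = 0 ∨ cnt S y .even = 2) (ho : cnt S y .odd = 0 ∨ cnt S y .odd = 2)
    (hp : cnt S y .pos = 0) :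
    Within (cnt S y .moved + cnt S y .even + cnt S y .odd + 2) x y := by
  obtain ⟨T, c, d, u, z, h1, -, -, h4, h5, h6, a1, a2, a3, a4, a5, a6⟩ := exists_edge hG hm
    (by omega) (by omega) hp
  have ht : Kind.even.Pair .odd := by simp [Kind.Pair]
  rcases he with he | he <;> rcases ho with ho | ho
  · exact (within_of_moved _ S x rfl hG he ho hp).mono (by omega)
  · exact (h1.trans (within_of_helper_pure ht.symm _ T z c d u rfl a1 h4 h5 h6 (by omega)
      (by omega) (by omega) (by omega))).mono (by omega)
  · exact (h1.trans (within_of_helper_pure ht _ T z c d u rfl a1 h4 h5 h6 (by omega)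
      (by omega) (by omega) (by omega))).mono (by omega)
  · exact (h1.trans (within_of_helper_mixed _ T z c d u rfl a1 h4 h5 h6 (by omega)
      (by omega) (by omega) (by omega))).mono (by omega)

end

section

variable {x y z : Cfg n} {S : Finset (Fin n)} {t t' : Kind}

/-- Every property of a configuration which is preserved by the steps within the conjugacy class
holds on the whole class. -/
def Linked (x : Cfg n) : Prop :=
  ∀ P : Cfg n → Prop, P x → (∀ u v, ConjS x u → Step u v → P u → P v) → ∀ u, ConjS x u → P u

lemma exists_toG_of_isConj {g : AffineWeylC n} (h : IsConj x.toG g) : ∃ u : Cfg n, u.toG = g := by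
  refine exists_toG ?_
  obtain ⟨c, rfl⟩ := isConj_iff.1 h
  calc c * x.toG * c⁻¹ * (c * x.toG * c⁻¹) = c * (x.toG * x.toG) * c⁻¹ := by group
    _ = 1 := by rw [x.toG_sq]; group

lemma linked_of_connected (h : (commGraph (conjClass x.toG)).Connected) : x.Linked := by
  intro P hx hP u hu
  have hr := h.preconnected ⟨x.toG, IsConj.refl _⟩ ⟨u.toG, conjS_iff.1 hu⟩
  rw [SimpleGraph.reachable_iff_reflTransGen] at hr
  suffices ∀ g : conjClass x.toG, Relation.ReflTransGen
      (commGraph (conjClass x.toG)).Adj ⟨x.toG, IsConj.refl _⟩ g →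
      ∀ v : Cfg n, v.toG = g → P v from this _ hr u rfl
  intro g hg
  induction hg with
  | refl => exact fun v hv => toG_inj hv ▸ hx
  | @tail b c _ hbc ih =>
    intro v hv
    obtain ⟨w, hw⟩ := exists_toG_of_isConj b.2
    have hxw : ConjS x w := conjS_iff.2 (hw ▸ b.2)
    have hxv : ConjS x v := conjS_iff.2 (hv ▸ c.2)
    refine hP w v hxw ⟨comm_iff.2 ?_, hxw.symm.trans hxv⟩ (ih w hw)
    rw [hw, hv]
    exact hbc.2

lemma ConjS.good (h : ConjS x y) : Good Finset.univ x y :=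
  ⟨by simp, by simp, fun i hi => absurd (Finset.mem_univ i) hi, h⟩

lemma Comm.ty (h : Comm x y) (i : Fin n) : x.ty (y.p i) = x.ty i := by
  obtain ⟨h1, h2⟩ := h i
  by_cases hi : x.p i = i
  · rw [hi] at h1 h2
    rw [ty_of_fixed h1, ty_of_fixed hi, Aff.kind_conj h2.symm]
  · rw [ty_eq_moved.2 hi, ty_eq_moved, h1]
    exact fun h => hi (y.p_inj.1 h)

lemma Comm.fixed (h : Comm x y) {i : Fin n} (hi : cnt Finset.univ x (x.ty i) ≤ 1) :
    y.p i = i := by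
  by_contra hne
  have := two_le_cnt (S := Finset.univ) (by simp) (by simp) hne (h.ty i) rfl
  omega

lemma Comm.fx_of_fx (h : Comm x y) {i : Fin n} {α : Aff} (hx : x.Fx i α) (hα : α.kind ≠ .pos)
    (hi : y.p i = i) (hy : cnt Finset.univ y .pos = 0) : y.Fx i α := by
  have hk : (y.d i).kind ≠ .pos := by
    intro hk
    have := one_le_cnt (S := Finset.univ) (by simp) ((ty_of_fixed hi).trans hk)
    omega
  have := (h i).2
  rw [hi, hx.1, hx.2] at this
  exact ⟨hi, (Aff.eq_of_comm hα hk this).symm⟩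

lemma conj_ty (x : Cfg n) (σ : Equiv.Perm (Fin n)) (i : Fin n) :
    (x.conj σ 1).ty (σ i) = x.ty i := by
  unfold ty conj
  simp

/-- A fixed point outside of the class of the identity changes its label under a translation. -/
lemma exists_not_fx {i : Fin n} {α : Aff} (hx : x.Fx i α) (hα : α.kind ≠ .pos) :
    ∃ u : Cfg n, ConjS x u ∧ ¬ u.Fx i α := by
  refine ⟨_, conjS_conj x 1 fun _ => ⟨1, 1⟩, fun h => ?_⟩
  have h2 := congrArg Aff.c h.2
  have h3 := Aff.s_of_kind hα
  simp [conj, hx.2, h3] at h2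
  omega

/-- A class in which the label of some point cannot change is not connected. -/
lemma Linked.false_of_frozen (hx : x.Linked) (hp : cnt Finset.univ x .pos = 0) {i : Fin n}
    (hi : x.p i = i) (h : ∀ u v, ConjS x u → Step u v → u.ty i = x.ty i → v.p i = i) :
    False := by
  have hk : (x.d i).kind ≠ .pos := by
    intro hk
    have := one_le_cnt (S := Finset.univ) (by simp) ((ty_of_fixed hi).trans hk)
    omega
  obtain ⟨u, hu, hn⟩ := exists_not_fx ⟨hi, rfl⟩ hk
  refine hn (hx (fun u => u.Fx i (x.d i)) ⟨hi, rfl⟩ (fun u v hu huv h1 => ?_) u hu)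
  refine huv.1.fx_of_fx h1 hk (h u v hu huv ?_) ?_
  · rw [h1.ty, ty_of_fixed hi]
  · rw [← (hu.trans huv.2).good.cnt_eq, hp]

lemma Linked.false_of_no_moved (hx : x.Linked) (hn : 0 < n) (hm : cnt Finset.univ x .moved = 0)
    (hp : cnt Finset.univ x .pos = 0) : False := by
  have fixed : ∀ {u : Cfg n}, ConjS x u → ∀ i, u.p i = i := by
    intro u hu i
    by_contra h
    have := one_le_cnt (S := Finset.univ) (by simp) (ty_eq_moved.2 h)
    rw [← hu.good.cnt_eq] at this
    omega
  exact hx.false_of_frozen hp (fixed (.refl x) ⟨0, hn⟩) fun u v hu huv _ =>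
    fixed (hu.trans huv.2) _

lemma Linked.false_of_single (hx : x.Linked) (ht : t ≠ .moved)
    (h1 : cnt Finset.univ x t = 1) (hp : cnt Finset.univ x .pos = 0) : False := by
  obtain ⟨i, -, hi⟩ := exists_one h1.ge
  obtain ⟨f, k⟩ := fx_of_ty hi ht
  refine hx.false_of_frozen hp f.1 fun u v hu huv h => huv.1.fixed ?_
  rw [h, hi, ← hu.good.cnt_eq, h1]

lemma Linked.false_of_le_one (hx : x.Linked) (hm : 1 ≤ cnt Finset.univ x .moved)
    (he : cnt Finset.univ x .even ≤ 1) (ho : cnt Finset.univ x .odd ≤ 1)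
    (hp : cnt Finset.univ x .pos = 1) : False := by
  obtain ⟨a, -, ha⟩ := exists_one hm
  obtain ⟨f, -, hf⟩ := exists_one hp.ge
  have h := hx (fun u => u.p f = f) (fx_of_ty hf (by simp)).1.1 (fun u v hu huv h => ?_)
    (x.conj (Equiv.swap a f) 1) (conjS_conj ..)
  · refine ty_eq_moved.1 ?_ h
    rw [← ha, ← conj_ty x (Equiv.swap a f), Equiv.swap_apply_left]
  · refine huv.1.fixed ?_
    rw [← hu.good.cnt_eq]
    cases hk : u.ty f
    · exact absurd h (ty_eq_moved.1 hk)
    all_goals omega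

/-- A class whose kinds are all carried by at most two points is not connected. -/
lemma Linked.false_of_le_two (hx : x.Linked) (hm : cnt Finset.univ x .moved = 2)
    (ht : t ≠ .moved) (h1 : 1 ≤ cnt Finset.univ x t)
    (he : cnt Finset.univ x .even = 0 ∨ cnt Finset.univ x .even = 2)
    (ho : cnt Finset.univ x .odd = 0 ∨ cnt Finset.univ x .odd = 2)
    (hp : cnt Finset.univ x .pos = 0 ∨ (cnt Finset.univ x .pos = 2 ∧
      cnt Finset.univ x .even = 0 ∧ cnt Finset.univ x .odd = 0)) : False := by
  obtain ⟨a, -, ha⟩ := exists_one (by omega : 1 ≤ cnt Finset.univ x .moved)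
  obtain ⟨f, -, hf⟩ := exists_one h1
  have hab := ed_of_ty ha
  have hb := hab.symm.ty
  have h := hx (fun u => ∀ i j, x.ty i = x.ty j → u.ty i = u.ty j) (fun _ _ h => h)
    (fun u v hu huv h i j hij => ?_) (x.conj (Equiv.swap a f) 1) (conjS_conj ..)
    a (x.p a) (by rw [ha, hb])
  · have k1 := conj_ty x (Equiv.swap a f) f
    have k2 := conj_ty x (Equiv.swap a f) (x.p a)
    rw [Equiv.swap_apply_right] at k1
    rw [Equiv.swap_apply_of_ne_of_ne hab.1.symm (ne_of_ty hb hf ht.symm)] at k2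
    rw [k1, k2, hf, hb] at h
    exact ht h
  · by_cases hij' : i = j
    · rw [hij']
    have hv := (hu.trans huv.2).good
    have two : cnt Finset.univ u (u.ty i) ≤ 2 := by
      rw [← hu.good.cnt_eq]
      cases u.ty i <;> omega
    have mem : ∀ k, u.ty k = u.ty i → k = i ∨ k = j := by
      intro k hk
      by_contra! hne
      have := three_le_cnt (S := Finset.univ) (by simp) (by simp) (by simp) hij' hne.1.symm
        hne.2.symm rfl (h i j hij).symm hk
      omega
    by_cases hi : v.p i = i
    · have hj : v.p j = j := by
        rcases mem (v.p j) ((huv.1.ty j).trans (h i j hij).symm) with h | h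
        · exact absurd (v.p_inj.1 (h.trans hi.symm)).symm hij'
        · exact h
      rcases hp with hp | ⟨hp, he, ho⟩
      · by_cases hui : u.p i = i
        · have hk : u.ty i ≠ .moved := mt ty_eq_moved.1 (not_not.2 hui)
          have same : ∀ k, v.p k = k → u.ty k = u.ty i → v.ty k = u.ty k := by
            intro k hk' h
            obtain ⟨f, -⟩ := fx_of_ty h hk
            refine ((huv.1.fx_of_fx f (fun hpos => ?_) hk' (by rw [← hv.cnt_eq, hp])).ty).trans
              f.ty.symm
            have := one_le_cnt (S := Finset.univ) (by simp) (f.ty.trans hpos)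
            rw [← hu.good.cnt_eq] at this
            omega
          rw [same i hi rfl, same j hj (h i j hij).symm, h i j hij]
        · have hm : u.ty (u.p i) = u.ty i := by
            rw [ty_eq_moved.2 hui, ty_eq_moved, u.pp]
            exact fun h => hui h.symm
          rw [← (mem (u.p i) hm).resolve_left hui, huv.1.symm.ty]
      · have pos : ∀ k, v.p k = k → v.ty k = .pos := by
          intro k hk
          cases hk' : v.ty k
          · exact absurd hk (ty_eq_moved.1 hk')
          · have := one_le_cnt (S := Finset.univ) (by simp) hk'
            rw [← hv.cnt_eq] at this
            omega
          · have := one_le_cnt (S := Finset.univ) (by simp) hk'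
            rw [← hv.cnt_eq] at this
            omega
          · rfl
        rw [pos i hi, pos j hj]
    · have hj : v.p i = j := (mem (v.p i) (huv.1.ty i)).resolve_left hi
      rw [ty_eq_moved.2 hi, ← hj, ty_eq_moved.2 (fun h => hi (v.p_inj.1 h))]

/-- In a connected class of the affine Weyl group any two elements are close. -/
lemma Linked.within (hx : x.Linked) (hn : 0 < n) (hxy : ConjS x y) : Within (n + 2) x y := by
  have hG := hxy.good
  have hcard := card_eq_cnt Finset.univ y
  rw [Finset.card_univ, Fintype.card_fin] at hcard
  have eq := hG.cnt_eq
  have h1 : Kind.even.Pair .odd := Or.inl ⟨rfl, rfl⟩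
  have h2 := h1.symm
  have em := eq .moved
  have ee := eq .even
  have eo := eq .odd
  have ep := eq .pos
  have hm2 := one_lt_cnt_moved hG
  by_cases hm : cnt Finset.univ y .moved = 0
  · by_cases hp : cnt Finset.univ y .pos = 0
    · exact (hx.false_of_no_moved hn (by omega) (by omega)).elim
    · exact (within_of_fixed h1 hG hm (by omega)).mono (by omega)
  by_cases hp0 : cnt Finset.univ y .pos = 0
  · by_cases he1 : cnt Finset.univ y .even = 1
    · exact (hx.false_of_single (t := .even) (by simp) (by omega) (by omega)).elim
    by_cases ho1 : cnt Finset.univ y .odd = 1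
    · exact (hx.false_of_single (t := .odd) (by simp) (by omega) (by omega)).elim
    by_cases h3 : 3 ≤ cnt Finset.univ y .even ∨ 3 ≤ cnt Finset.univ y .odd
    · exact (within_of_no_pos _ _ x rfl hG (by omega) he1 ho1 h3 hp0).mono (by omega)
    by_cases hm3 : 3 ≤ cnt Finset.univ y .moved
    · exact (within_of_no_pos_of_le hG hm3 (by omega) (by omega) hp0).mono (by omega)
    by_cases he0 : cnt Finset.univ y .even = 0
    · by_cases ho0 : cnt Finset.univ y .odd = 0
      · exact (within_of_moved _ _ x rfl hG he0 ho0 hp0).mono (by omega)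
      · exact (hx.false_of_le_two (t := .odd) (by omega) (by simp) (by omega) (by omega)
          (by omega) (by omega)).elim
    · exact (hx.false_of_le_two (t := .even) (by omega) (by simp) (by omega) (by omega)
        (by omega) (by omega)).elim
  by_cases hp1 : cnt Finset.univ y .pos = 1
  · by_cases he2 : 2 ≤ cnt Finset.univ y .even
    · by_cases ho1 : cnt Finset.univ y .odd = 1
      · exact (within_of_one_pos_of_single h1 hG hp1 he2 ho1).mono (by omega)
      · exact (within_of_one_pos h1 _ _ x rfl hG hp1 he2 ho1).mono (by omega)
    by_cases ho2 : 2 ≤ cnt Finset.univ y .odd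
    · by_cases he1 : cnt Finset.univ y .even = 1
      · exact (within_of_one_pos_of_single h2 hG hp1 ho2 he1).mono (by omega)
      · exact (within_of_one_pos h2 _ _ x rfl hG hp1 ho2 he1).mono (by omega)
    exact (hx.false_of_le_one (by omega) (by omega) (by omega) (by omega)).elim
  by_cases h5 : 3 ≤ cnt Finset.univ y .moved ∨ 3 ≤ cnt Finset.univ y .pos ∨
      1 ≤ cnt Finset.univ y .even + cnt Finset.univ y .odd
  · exact (within_of_two_pos _ _ x rfl hG (by omega) (by omega)).mono (by omega)
  · exact (hx.false_of_le_two (t := .pos) (by omega) (by simp) (by omega) (by omega)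
      (by omega) (by omega)).elim

end

end Cfg

end AffineWeylC

/-- If the commuting involution graph on a conjugacy class of
involutions in the affine Weyl group of type C̃ₙ (n ≥ 2) is connected, then its
diameter is at most `n + 2`. -/
theorem stmt_0 (n : ℕ) (hn : 2 ≤ n) (a : AffineWeylC n) (ha : a.Involution)
    (X : Set (AffineWeylC n)) (hX : X = AffineWeylC.conjClass a)
    (hconn : (commGraph X).Connected) :
    (commGraph X).ediam ≤ (n : ℕ∞) + 2 := by
  subst hX
  refine SimpleGraph.ediam_le_of_edist_le ?_
  rintro ⟨g, hg⟩ ⟨h, hh⟩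
  have hgh : IsConj g h := hg.symm.trans hh
  obtain ⟨z, rfl⟩ := AffineWeylC.Cfg.exists_toG ha.2
  obtain ⟨x, rfl⟩ := AffineWeylC.Cfg.exists_toG_of_isConj hg
  obtain ⟨y, rfl⟩ := AffineWeylC.Cfg.exists_toG_of_isConj hh
  have hX : AffineWeylC.conjClass z.toG = AffineWeylC.conjClass x.toG :=
    Set.ext fun b => ⟨hg.symm.trans, hg.trans⟩
  have hx : x.Linked := AffineWeylC.Cfg.linked_of_connected (hX ▸ hconn)
  have hw := hx.within (by omega) (AffineWeylC.Cfg.conjS_iff.2 hgh)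
  exact_mod_cast hw.edist_le (fun u v huv (hu : IsConj _ _) =>
    hu.trans (AffineWeylC.Cfg.conjS_iff.1 huv)) hg hh
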